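/- There exist an exponent α ∈ (0,1) and a triple of continuous functions (v, p, θ) on ℝ₊ × T³, compactly supported in time, with v and θ not identically zero, which is a weak solution of the anisotropic Boussinesq system with only horizontal viscosity in the x-direction (∂_t v + div(v⊗v) + ∇p − ∂_xx v = θe₃, div v = 0, ∂_t θ + div(vθ) − ∂_xx θ = 0, interpreted in the sense of distributions by testing against smooth compactly supported functions as for the vertical-viscosity case but with ∂_xx in place of ∂_zz), and such that v ∈ C^α and θ ∈ C^α on ℝ₊ × T³. -/

import Mathlib

open MeasureTheory

noncomputable section

/-- Space-time ℝ × ℝ³; spatial functions are 2π-periodic, modelling ℝ × T³. -/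
abbrev SpaceTime := ℝ × (Fin 3 → ℝ)

/-- 2π-periodicity in each spatial variable. -/
def stPeriodic {E : Type*} (f : SpaceTime → E) : Prop :=
  ∀ (t : ℝ) (x : Fin 3 → ℝ) (m : Fin 3 → ℤ),
    f (t, fun i => x i + 2 * Real.pi * m i) = f (t, x)

/-- Time derivative. -/
noncomputable def tderiv {E : Type*} [NormedAddCommGroup E] [NormedSpace ℝ E]
    (f : SpaceTime → E) (q : SpaceTime) : E :=
  deriv (fun s => f (s, q.2)) q.1

/-- Spatial partial derivative in direction i (i = 0,1,2 for x,y,z). -/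
noncomputable def sderiv {E : Type*} [NormedAddCommGroup E] [NormedSpace ℝ E]
    (i : Fin 3) (f : SpaceTime → E) (q : SpaceTime) : E :=
  deriv (fun s => f (q.1, Function.update q.2 i s)) (q.2 i)

/-- A fundamental domain for T³. -/
def Tcube : Set (Fin 3 → ℝ) := Set.univ.pi fun _ => Set.Ioc 0 (2 * Real.pi)

/-- Test functions in C_c^∞(ℝ₊ × T³; E): smooth, periodic in space, compactly supported
in time inside (0,∞). -/
def IsTest {E : Type*} [NormedAddCommGroup E] [NormedSpace ℝ E]
    (φ : SpaceTime → E) : Prop :=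
  ContDiff ℝ (⊤ : ℕ∞) φ ∧ stPeriodic φ ∧
    ∃ a b : ℝ, 0 < a ∧ ∀ t x, t ∉ Set.Icc a b → φ (t, x) = 0

/-- Weak solution (in the sense of distributions) of the anisotropic Boussinesq system
with horizontal viscosity in the x-direction on ℝ₊ × T³:
∂_t v + div(v⊗v) + ∇p − ∂_xx v = θe₃, div v = 0, ∂_t θ + div(vθ) − ∂_xx θ = 0. -/
def IsWeakSolutionX (v : SpaceTime → Fin 3 → ℝ) (p θ : SpaceTime → ℝ) : Prop :=
  (∀ φ : SpaceTime → Fin 3 → ℝ, IsTest φ →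
    (∫ t in Set.Ioi (0 : ℝ), ∫ x in Tcube,
      ((∑ i, v (t, x) i * tderiv (fun q => φ q i) (t, x)) +
       (∑ i, ∑ j, v (t, x) i * v (t, x) j * sderiv j (fun q => φ q i) (t, x)) +
       p (t, x) * (∑ i, sderiv i (fun q => φ q i) (t, x)) +
       (∑ i, v (t, x) i * sderiv 0 (sderiv 0 (fun q => φ q i)) (t, x)) +
       θ (t, x) * φ (t, x) 2)) = 0) ∧
  (∀ ϕ : SpaceTime → ℝ, IsTest ϕ →
    (∫ t in Set.Ioi (0 : ℝ), ∫ x in Tcube,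
      (θ (t, x) * tderiv ϕ (t, x) +
       θ (t, x) * (∑ i, v (t, x) i * sderiv i ϕ (t, x)) +
       θ (t, x) * sderiv 0 (sderiv 0 ϕ) (t, x))) = 0) ∧
  (∀ ψ : SpaceTime → ℝ, IsTest ψ →
    (∫ t in Set.Ioi (0 : ℝ), ∫ x in Tcube,
      (∑ i, v (t, x) i * sderiv i ψ (t, x))) = 0)

namespace Boussinesq

/-- Points `(t, y, z)` of the reduced space-time: the solutions built here do not depend on `x`. -/
abbrev Pt := ℝ × ℝ × ℝ

/-- The coordinate directions of `Pt`. -/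
def bas : Fin 3 → Pt := ![(1, 0, 0), (0, 1, 0), (0, 0, 1)]

/-- The directional derivative as an operator on functions. -/
def D (u : Pt) (f : Pt → ℝ) : Pt → ℝ := fun q => fderiv ℝ f q u

/-- Smooth functions which are `2π`-periodic in both spatial variables. -/
structure Adm (f : Pt → ℝ) : Prop where
  smooth : ContDiff ℝ (⊤ : ℕ∞) f
  per : ∀ (q : Pt) (m n : ℤ), f (q + (0, 2 * Real.pi * m, 2 * Real.pi * n)) = f q

theorem Adm.diff {f : Pt → ℝ} (hf : Adm f) : Differentiable ℝ f :=
  hf.smooth.differentiable (by simp)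

theorem Adm.cont {f : Pt → ℝ} (hf : Adm f) : Continuous f := hf.smooth.continuous

theorem Adm.const (c : ℝ) : Adm (fun _ => c) := ⟨contDiff_const, fun _ _ _ => rfl⟩

theorem Adm.add {f g : Pt → ℝ} (hf : Adm f) (hg : Adm g) : Adm (fun q => f q + g q) :=
  ⟨hf.smooth.add hg.smooth, fun q m n => by rw [hf.per, hg.per]⟩

theorem Adm.mul {f g : Pt → ℝ} (hf : Adm f) (hg : Adm g) : Adm (fun q => f q * g q) :=
  ⟨hf.smooth.mul hg.smooth, fun q m n => by rw [hf.per, hg.per]⟩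

theorem Adm.D {f : Pt → ℝ} (hf : Adm f) (u : Pt) : Adm (D u f) := by
  refine ⟨(hf.smooth.fderiv_right (m := (⊤ : ℕ∞)) (by simp)).clm_apply contDiff_const, ?_⟩
  intro q m n
  have h : f = fun p => f (p + (0, 2 * Real.pi * m, 2 * Real.pi * n)) := by
    funext p; rw [hf.per]
  unfold Boussinesq.D
  conv_rhs => rw [h]
  rw [fderiv_comp_add_right]

theorem D_add {f g : Pt → ℝ} (hf : Adm f) (hg : Adm g) (u : Pt) :
    D u (fun q => f q + g q) = fun q => D u f q + D u g q := by
  funext q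
  simp only [D]
  rw [fderiv_fun_add (hf.diff q) (hg.diff q)]; rfl

theorem D_mul {f g : Pt → ℝ} (hf : Adm f) (hg : Adm g) (u : Pt) :
    D u (fun q => f q * g q) = fun q => D u f q * g q + f q * D u g q := by
  funext q
  simp only [D]
  rw [fderiv_fun_mul (hf.diff q) (hg.diff q)]
  simp; ring

theorem D_const (c : ℝ) (u : Pt) : D u (fun _ => c) = fun _ => 0 := by
  funext q; simp [D]

theorem D_const_mul {f : Pt → ℝ} (hf : Adm f) (c : ℝ) (u : Pt) :
    D u (fun q => c * f q) = fun q => c * D u f q := by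
  rw [D_mul (Adm.const c) hf, D_const]; simp

theorem D_comm {f : Pt → ℝ} (hf : Adm f) (u w : Pt) : D u (D w f) = D w (D u f) := by
  funext q
  have h2 : ContDiffAt ℝ 2 f q := (contDiff_infty.1 hf.smooth 2).contDiffAt
  have hs := h2.isSymmSndFDerivAt (by simp)
  have hd : DifferentiableAt ℝ (fderiv ℝ f) q :=
    (hf.smooth.fderiv_right (m := (⊤ : ℕ∞)) (by simp)).differentiable (by simp) q
  have key : ∀ a b : Pt, D a (D b f) q = fderiv ℝ (fderiv ℝ f) q a b := by
    intro a b
    have := fderiv_clm_apply hd (differentiableAt_const (c := b))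
    change fderiv ℝ (fun y => fderiv ℝ f y b) q a = _
    rw [this]; simp
  rw [key, key]; exact hs u w

theorem D_dir_add (f : Pt → ℝ) (u w : Pt) : D (u + w) f = fun q => D u f q + D w f q := by
  funext q; simp [D]

/-- Averages `q ↦ ∫ κ(ω) f(q + c(ω)) dν(ω)` of translates. -/
def avg {Ω : Type} [MeasurableSpace Ω] (ν : Measure Ω) (κ : Ω → ℝ) (c : Ω → Pt)
    (f : Pt → ℝ) : Pt → ℝ := fun q => ∫ ω, κ ω * f (q + c ω) ∂ν

section Avg

variable {Ω : Type} [TopologicalSpace Ω] [SecondCountableTopology Ω] [MeasurableSpace Ω]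
  [BorelSpace Ω] {ν : Measure Ω} [IsFiniteMeasure ν] {κ : Ω → ℝ} {c : Ω → Pt} {B R : ℝ}

theorem hasFDerivAt_avg {V : Type} [NormedAddCommGroup V] [NormedSpace ℝ V]
    (hκ : Continuous κ) (hc : Continuous c) (hB : ∀ᵐ ω ∂ν, |κ ω| ≤ B)
    (hR : ∀ᵐ ω ∂ν, ‖c ω‖ ≤ R) {f : Pt → V} (hf : ContDiff ℝ 1 f) (q : Pt) :
    HasFDerivAt (fun q => ∫ ω, κ ω • f (q + c ω) ∂ν)
      (∫ ω, κ ω • fderiv ℝ f (q + c ω) ∂ν) q := by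
  have hf' : Continuous (fderiv ℝ f) := hf.continuous_fderiv (by simp)
  obtain ⟨M, hM⟩ := (isCompact_closedBall q (1 + R)).exists_bound_of_continuousOn hf'.continuousOn
  obtain ⟨M₀, hM₀⟩ := (isCompact_closedBall q (1 + R)).exists_bound_of_continuousOn
    hf.continuous.continuousOn
  have hmem : ∀ x ∈ Metric.ball q 1, ∀ ω, ‖c ω‖ ≤ R → x + c ω ∈ Metric.closedBall q (1 + R) := by
    intro x hx ω hω
    rw [Metric.mem_closedBall, dist_eq_norm]
    rw [Metric.mem_ball, dist_eq_norm] at hx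
    calc ‖x + c ω - q‖ = ‖(x - q) + c ω‖ := by congr 1; abel
      _ ≤ 1 + R := (norm_add_le _ _).trans (add_le_add hx.le hω)
  refine hasFDerivAt_integral_of_dominated_of_fderiv_le (s := Metric.ball q 1)
    (F := fun q ω => κ ω • f (q + c ω)) (F' := fun q ω => κ ω • fderiv ℝ f (q + c ω))
    (bound := fun _ => B * M)
    (Metric.ball_mem_nhds q one_pos) ?_ ?_ ?_ ?_ (integrable_const _) ?_
  · refine Filter.Eventually.of_forall fun x => ?_
    exact (hκ.smul (hf.continuous.comp (continuous_const.add hc))).aestronglyMeasurable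
  · refine (integrable_const (B * M₀)).mono'
      (hκ.smul (hf.continuous.comp (continuous_const.add hc))).aestronglyMeasurable ?_
    filter_upwards [hB, hR] with ω h1 h2
    rw [norm_smul]
    exact mul_le_mul h1 (hM₀ _ (hmem q (Metric.mem_ball_self one_pos) ω h2)) (norm_nonneg _)
      ((abs_nonneg _).trans h1)
  · exact (hκ.smul (hf'.comp (continuous_const.add hc))).aestronglyMeasurable
  · filter_upwards [hB, hR] with ω h1 h2 x hx
    rw [norm_smul]
    exact mul_le_mul h1 (hM _ (hmem x hx ω h2)) (norm_nonneg _) ((abs_nonneg _).trans h1)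
  · refine Filter.Eventually.of_forall fun ω x _ => ?_
    have h := ((hf.differentiable (by simp)) (x + c ω)).hasFDerivAt
    have h' := h.comp x ((hasFDerivAt_id x).add_const (c ω))
    have h'' := h'.const_smul (κ ω)
    simp only [ContinuousLinearMap.comp_id] at h''
    exact h''

theorem contDiff_avg_nat (hκ : Continuous κ) (hc : Continuous c) (hB : ∀ᵐ ω ∂ν, |κ ω| ≤ B)
    (hR : ∀ᵐ ω ∂ν, ‖c ω‖ ≤ R) (n : ℕ) :
    ∀ {V : Type} [NormedAddCommGroup V] [NormedSpace ℝ V] {f : Pt → V},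
      ContDiff ℝ (n + 1) f → ContDiff ℝ n (fun q => ∫ ω, κ ω • f (q + c ω) ∂ν) := by
  induction n with
  | zero =>
    intro V _ _ f hf
    refine contDiff_zero.2 (continuous_iff_continuousAt.2 fun q => ?_)
    exact (hasFDerivAt_avg hκ hc hB hR (by simpa using hf) q).continuousAt
  | succ n ih =>
    intro V _ _ f hf
    have h1 : ContDiff ℝ 1 f := hf.of_le (by norm_cast; omega)
    push_cast
    rw [contDiff_succ_iff_fderiv]
    refine ⟨fun q => (hasFDerivAt_avg hκ hc hB hR h1 q).differentiableAt, by simp, ?_⟩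
    have : fderiv ℝ (fun q => ∫ ω, κ ω • f (q + c ω) ∂ν)
        = fun q => ∫ ω, κ ω • fderiv ℝ f (q + c ω) ∂ν :=
      funext fun q => (hasFDerivAt_avg hκ hc hB hR h1 q).fderiv
    rw [this]
    exact ih (hf.fderiv_right (by push_cast; exact le_rfl))

theorem Adm.avg (hκ : Continuous κ) (hc : Continuous c) (hB : ∀ᵐ ω ∂ν, |κ ω| ≤ B)
    (hR : ∀ᵐ ω ∂ν, ‖c ω‖ ≤ R) {f : Pt → ℝ} (hf : Adm f) : Adm (avg ν κ c f) := by
  refine ⟨contDiff_infty.2 fun n => ?_, fun q m n => ?_⟩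
  · exact contDiff_avg_nat hκ hc hB hR n (hf.smooth.of_le (by exact_mod_cast le_top))
  · simp only [Boussinesq.avg]
    congr 1; funext ω
    rw [add_right_comm, hf.per]

theorem D_avg (hκ : Continuous κ) (hc : Continuous c) (hB : ∀ᵐ ω ∂ν, |κ ω| ≤ B)
    (hR : ∀ᵐ ω ∂ν, ‖c ω‖ ≤ R) {f : Pt → ℝ} (hf : Adm f) (u : Pt) :
    D u (avg ν κ c f) = avg ν κ c (D u f) := by
  funext q
  have h1 : ContDiff ℝ 1 f := hf.smooth.of_le (by exact_mod_cast le_top)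
  have h := hasFDerivAt_avg hκ hc hB hR h1 q
  have e : Boussinesq.avg ν κ c f = fun q => ∫ ω, κ ω • f (q + c ω) ∂ν := rfl
  rw [D, e, h.fderiv, ContinuousLinearMap.integral_apply]
  · rfl
  · have hf' : Continuous (fderiv ℝ f) := h1.continuous_fderiv (by simp)
    obtain ⟨M, hM⟩ := (isCompact_closedBall q R).exists_bound_of_continuousOn hf'.continuousOn
    refine (integrable_const (B * M)).mono'
      (hκ.smul (hf'.comp (continuous_const.add hc))).aestronglyMeasurable ?_
    filter_upwards [hB, hR] with ω h1 h2
    rw [norm_smul]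
    refine mul_le_mul h1 (hM _ ?_) (norm_nonneg _) ((abs_nonneg _).trans h1)
    simpa [Metric.mem_closedBall, dist_eq_norm] using h2

theorem integrable_avg (hκ : Continuous κ) (hc : Continuous c) (hB : ∀ᵐ ω ∂ν, |κ ω| ≤ B)
    (hR : ∀ᵐ ω ∂ν, ‖c ω‖ ≤ R) {f : Pt → ℝ} (hf : Continuous f) (q : Pt) :
    Integrable (fun ω => κ ω * f (q + c ω)) ν := by
  obtain ⟨M, hM⟩ := (isCompact_closedBall q R).exists_bound_of_continuousOn hf.continuousOn
  refine (integrable_const (B * M)).mono'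
    (hκ.mul (hf.comp (continuous_const.add hc))).aestronglyMeasurable ?_
  filter_upwards [hB, hR] with ω h1 h2
  rw [norm_mul]
  refine mul_le_mul h1 (hM _ ?_) (norm_nonneg _) ((abs_nonneg _).trans h1)
  simpa [Metric.mem_closedBall, dist_eq_norm] using h2

theorem abs_avg_le (hB : ∀ᵐ ω ∂ν, |κ ω| ≤ B) {f : Pt → ℝ} {M : ℝ}
    (hM : ∀ q, |f q| ≤ M) (q : Pt) : |avg ν κ c f q| ≤ B * M * ν.real Set.univ := by
  change ‖∫ ω, κ ω * f (q + c ω) ∂ν‖ ≤ _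
  refine norm_integral_le_of_norm_le_const ?_
  filter_upwards [hB] with ω h1
  rw [norm_mul]
  exact mul_le_mul h1 (hM _) (norm_nonneg _) ((abs_nonneg _).trans h1)

end Avg

/-- The algebra of smooth functions on `Pt` that are periodic in space. -/
def admAlg : Subalgebra ℝ (Pt → ℝ) where
  carrier := {f | Adm f}
  mul_mem' := fun hf hg => hf.mul hg
  add_mem' := fun hf hg => hf.add hg
  algebraMap_mem' := fun c => Adm.const c

/-- Smooth functions on `Pt`, periodic in space. -/
abbrev A := admAlg

/-- Families of smooth periodic functions. -/
abbrev R (ι : Type) := ι → A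

theorem adm (f : A) : Adm f.1 := f.2

/-- The directional derivative on smooth periodic functions. -/
def dA (u : Pt) : A →ₗ[ℝ] A where
  toFun f := ⟨D u f.1, (adm f).D u⟩
  map_add' f g := Subtype.ext (D_add (adm f) (adm g) u)
  map_smul' c f := Subtype.ext (D_const_mul (adm f) c u)

variable {ι : Type}

/-- The directional derivative on families. -/
def d (u : Pt) : R ι →ₗ[ℝ] R ι := LinearMap.pi fun i => (dA u).comp (LinearMap.proj i)

@[simp] theorem d_apply (u : Pt) (F : R ι) (i : ι) : d u F i = dA u (F i) := rfl

theorem dA_coe (u : Pt) (f : A) : (dA u f).1 = D u f.1 := rfl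

theorem dA_mul (u : Pt) (f g : A) : dA u (f * g) = dA u f * g + f * dA u g :=
  Subtype.ext (D_mul (adm f) (adm g) u)

theorem d_mul (u : Pt) (F G : R ι) : d u (F * G) = d u F * G + F * d u G :=
  funext fun i => dA_mul u (F i) (G i)

theorem dA_comm (u w : Pt) (f : A) : dA u (dA w f) = dA w (dA u f) :=
  Subtype.ext (D_comm (adm f) u w)

theorem d_comm (u w : Pt) (F : R ι) : d u (d w F) = d w (d u F) :=
  funext fun i => dA_comm u w (F i)

theorem d_dir_add (u w : Pt) (F : R ι) : d (u + w) F = d u F + d w F :=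
  funext fun i => Subtype.ext (D_dir_add (F i).1 u w)

/-- Constant functions depending on the index. -/
def cst : (ι → ℝ) →+* R ι :=
  RingHom.pi fun i => (algebraMap ℝ A).comp (Pi.evalRingHom _ i)

@[simp] theorem cst_coe (a : ι → ℝ) (i : ι) (q : Pt) : (cst a i).1 q = a i := rfl

@[simp] theorem d_cst (u : Pt) (a : ι → ℝ) : d u (cst a) = 0 :=
  funext fun i => Subtype.ext (D_const (a i) u)

@[simp] theorem d_one (u : Pt) : d u (1 : R ι) = 0 := by
  rw [← map_one cst, d_cst]

@[simp] theorem d_ofNat (u : Pt) (n : ℕ) [n.AtLeastTwo] : d u (OfNat.ofNat n : R ι) = 0 := by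
  rw [← map_ofNat cst, d_cst]

section AvgL

variable {Ω : Type} [TopologicalSpace Ω] [SecondCountableTopology Ω] [MeasurableSpace Ω]
  [BorelSpace Ω] {ν : Measure Ω} [IsFiniteMeasure ν] {κ : Ω → ℝ} {c : Ω → Pt} {B R : ℝ}

/-- Averaging of translates as an operator on smooth periodic functions. -/
def avgL (hκ : Continuous κ) (hc : Continuous c) (hB : ∀ᵐ ω ∂ν, |κ ω| ≤ B)
    (hR : ∀ᵐ ω ∂ν, ‖c ω‖ ≤ R) : A →ₗ[ℝ] A where
  toFun f := ⟨avg ν κ c f.1, (adm f).avg hκ hc hB hR⟩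
  map_add' f g := by
    refine Subtype.ext (funext fun q => ?_)
    change ∫ ω, κ ω * (f.1 (q + c ω) + g.1 (q + c ω)) ∂ν = _
    simp only [mul_add]
    exact integral_add (integrable_avg hκ hc hB hR (adm f).cont q)
      (integrable_avg hκ hc hB hR (adm g).cont q)
  map_smul' a f := by
    refine Subtype.ext (funext fun q => ?_)
    change ∫ ω, κ ω * (a * f.1 (q + c ω)) ∂ν = a * ∫ ω, κ ω * f.1 (q + c ω) ∂ν
    rw [← integral_const_mul]
    congr 1; funext ω; ring

theorem dA_avgL (hκ : Continuous κ) (hc : Continuous c) (hB : ∀ᵐ ω ∂ν, |κ ω| ≤ B)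
    (hR : ∀ᵐ ω ∂ν, ‖c ω‖ ≤ R) (u : Pt) (f : A) :
    dA u (avgL hκ hc hB hR f) = avgL hκ hc hB hR (dA u f) :=
  Subtype.ext (D_avg hκ hc hB hR (adm f) u)

end AvgL

/-- Lebesgue measure on one period. -/
abbrev circ : Measure ℝ := volume.restrict (Set.Ioc 0 (2 * Real.pi))

theorem circ_bound (e : Pt) : ∀ᵐ σ ∂circ, ‖σ • e‖ ≤ 2 * Real.pi * ‖e‖ := by
  filter_upwards [ae_restrict_mem measurableSet_Ioc] with σ hσ
  rw [norm_smul, Real.norm_eq_abs, abs_of_pos hσ.1]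
  exact mul_le_mul_of_nonneg_right hσ.2 (norm_nonneg _)

theorem circ_weight : ∀ᵐ σ ∂circ, |σ / (2 * Real.pi)| ≤ 1 := by
  filter_upwards [ae_restrict_mem measurableSet_Ioc] with σ hσ
  rw [abs_of_pos (div_pos hσ.1 Real.two_pi_pos), div_le_one Real.two_pi_pos]
  exact hσ.2

theorem circ_const : ∀ᵐ _σ ∂circ, |1 / (2 * Real.pi)| ≤ 1 := by
  refine Filter.Eventually.of_forall fun _ => ?_
  rw [abs_of_pos (by positivity), div_le_one Real.two_pi_pos]
  linarith [Real.pi_gt_three]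

/-- The mean along the closed orbit in direction `e`. -/
def MA (e : Pt) : A →ₗ[ℝ] A :=
  avgL (ν := circ) (κ := fun _ => 1 / (2 * Real.pi)) (c := fun σ => σ • e)
    continuous_const (by fun_prop) circ_const (circ_bound e)

/-- A right inverse, up to means, of the derivative in direction `e`. -/
def IA (e : Pt) : A →ₗ[ℝ] A :=
  avgL (ν := circ) (κ := fun σ => σ / (2 * Real.pi)) (c := fun σ => σ • e)
    (by fun_prop) (by fun_prop) circ_weight (circ_bound e)

theorem hasDerivAt_line (f : A) (q e : Pt) (σ : ℝ) :
    HasDerivAt (fun σ : ℝ => f.1 (q + σ • e)) (D e f.1 (q + σ • e)) σ := by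
  have h1 : HasDerivAt (fun σ : ℝ => q + σ • e) e σ := by
    simpa using ((hasDerivAt_id σ).smul_const e).const_add q
  exact ((adm f).diff _).hasFDerivAt.comp_hasDerivAt σ h1

theorem continuous_line {f : Pt → ℝ} (hf : Continuous f) (q e : Pt) :
    Continuous fun σ : ℝ => f (q + σ • e) := hf.comp (by fun_prop)

theorem dA_MA_self {e : Pt} (he : ∀ (f : A) (q : Pt), f.1 (q + (2 * Real.pi) • e) = f.1 q)
    (f : A) : dA e (MA e f) = 0 := by
  rw [MA, dA_avgL]
  refine Subtype.ext (funext fun q => ?_)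
  change ∫ σ in Set.Ioc 0 (2 * Real.pi), 1 / (2 * Real.pi) * D e f.1 (q + σ • e) = 0
  rw [integral_const_mul, ← intervalIntegral.integral_of_le Real.two_pi_pos.le,
    intervalIntegral.integral_eq_sub_of_hasDerivAt (fun σ _ => hasDerivAt_line f q e σ)
      ((continuous_line ((adm f).D e).cont q e).intervalIntegrable _ _), he]
  simp

theorem dA_IA_self {e : Pt} (he : ∀ (f : A) (q : Pt), f.1 (q + (2 * Real.pi) • e) = f.1 q)
    (f : A) : dA e (IA e f) = f - MA e f := by
  rw [IA, dA_avgL]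
  refine Subtype.ext (funext fun q => ?_)
  change ∫ σ in Set.Ioc 0 (2 * Real.pi), σ / (2 * Real.pi) * D e f.1 (q + σ • e)
    = f.1 q - ∫ σ in Set.Ioc 0 (2 * Real.pi), 1 / (2 * Real.pi) * f.1 (q + σ • e)
  rw [← intervalIntegral.integral_of_le Real.two_pi_pos.le,
    ← intervalIntegral.integral_of_le Real.two_pi_pos.le,
    intervalIntegral.integral_mul_deriv_eq_deriv_mul (u := fun σ => σ / (2 * Real.pi))
      (u' := fun _ => 1 / (2 * Real.pi))
      (fun σ _ => (hasDerivAt_id σ).div_const _) (fun σ _ => hasDerivAt_line f q e σ)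
      intervalIntegrable_const
      ((continuous_line ((adm f).D e).cont q e).intervalIntegrable _ _), he]
  rw [div_self Real.two_pi_pos.ne']; simp

theorem dA_MA (u e : Pt) (f : A) : dA u (MA e f) = MA e (dA u f) := by
  rw [MA, dA_avgL]

theorem dA_IA (u e : Pt) (f : A) : dA u (IA e f) = IA e (dA u f) := by
  rw [IA, dA_avgL]

/-- Means of families. -/
def M (e : Pt) : R ι →ₗ[ℝ] R ι := LinearMap.pi fun i => (MA e).comp (LinearMap.proj i)

/-- Right inverses, up to means, of derivatives of families. -/
def I (e : Pt) : R ι →ₗ[ℝ] R ι := LinearMap.pi fun i => (IA e).comp (LinearMap.proj i)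

@[simp] theorem d_M (u e : Pt) (F : R ι) : d u (M e F) = M e (d u F) :=
  funext fun i => by exact dA_MA u e (F i)

@[simp] theorem d_I (u e : Pt) (F : R ι) : d u (I e F) = I e (d u F) :=
  funext fun i => by exact dA_IA u e (F i)

/-- The coordinate direction of `t`. -/
abbrev e0 : Pt := bas 0
/-- The coordinate direction of `y`. -/
abbrev e1 : Pt := bas 1
/-- The coordinate direction of `z`. -/
abbrev e2 : Pt := bas 2
/-- The diagonal direction. -/
abbrev eη : Pt := bas 1 + bas 2

theorem per_e1 (f : A) (q : Pt) : f.1 (q + (2 * Real.pi) • e1) = f.1 q := by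
  have := (adm f).per q 1 0
  simpa [e1, bas] using this

theorem per_e2 (f : A) (q : Pt) : f.1 (q + (2 * Real.pi) • e2) = f.1 q := by
  have := (adm f).per q 0 1
  simpa [e2, bas] using this

theorem per_eη (f : A) (q : Pt) : f.1 (q + (2 * Real.pi) • eη) = f.1 q := by
  have := (adm f).per q 1 1
  simpa [bas] using this

theorem M_d_one (F : R ι) : M e1 (d e1 F) = 0 := by
  rw [← d_M]; exact funext fun i => dA_MA_self per_e1 (F i)

theorem M_d_two (F : R ι) : M e2 (d e2 F) = 0 := by
  rw [← d_M]; exact funext fun i => dA_MA_self per_e2 (F i)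

theorem M_d_diag (F : R ι) : M eη (d eη F) = 0 := by
  rw [← d_M]; exact funext fun i => dA_MA_self per_eη (F i)

theorem I_d_one (F : R ι) : I e1 (d e1 F) = F - M e1 F := by
  rw [← d_I]; exact funext fun i => dA_IA_self per_e1 (F i)

theorem I_d_two (F : R ι) : I e2 (d e2 F) = F - M e2 F := by
  rw [← d_I]; exact funext fun i => dA_IA_self per_e2 (F i)

theorem I_d_diag (F : R ι) : I eη (d eη F) = F - M eη F := by
  rw [← d_I]; exact funext fun i => dA_IA_self per_eη (F i)

/-- Spatial divergences. -/
def IsDiv (g : R ι) : Prop := ∃ P Q : R ι, g = d e1 P + d e2 Q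

theorem IsDiv.add {g h : R ι} (hg : IsDiv g) (hh : IsDiv h) : IsDiv (g + h) := by
  obtain ⟨P, Q, rfl⟩ := hg
  obtain ⟨P', Q', rfl⟩ := hh
  exact ⟨P + P', Q + Q', by simp only [map_add]; abel⟩

theorem IsDiv.sub {g h : R ι} (hg : IsDiv g) (hh : IsDiv h) : IsDiv (g - h) := by
  obtain ⟨P, Q, rfl⟩ := hg
  obtain ⟨P', Q', rfl⟩ := hh
  exact ⟨P - P', Q - Q', by simp only [map_sub]; abel⟩

theorem isDiv_one (P : R ι) : IsDiv (d e1 P) := ⟨P, 0, by simp⟩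

theorem isDiv_two (P : R ι) : IsDiv (d e2 P) := ⟨0, P, by simp⟩

theorem isDiv_diag (P : R ι) : IsDiv (d eη P) := ⟨P, P, d_dir_add _ _ _⟩

theorem d_diag (F : R ι) : d eη F = d e1 F + d e2 F := d_dir_add _ _ _

theorem IsDiv.means {g : R ι} (hg : IsDiv g) :
    M e1 (M eη g) = 0 ∧ M eη (M e1 g) = 0 ∧ M e2 (M e1 g) = 0 ∧ M e2 (M eη g) = 0 := by
  obtain ⟨P, Q, rfl⟩ := hg
  have h2 : ∀ F : R ι, d e2 F = d eη F - d e1 F := fun F => by rw [d_diag]; abel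
  have h1 : ∀ F : R ι, d e1 F = d eη F - d e2 F := fun F => by rw [d_diag]; abel
  have c1 : ∀ (e : Pt) (F : R ι), M e1 (M e (d e1 F)) = 0 := fun e F => by
    rw [← d_M e1 e, M_d_one]
  have c2 : ∀ (e : Pt) (F : R ι), M e2 (M e (d e2 F)) = 0 := fun e F => by
    rw [← d_M e2 e, M_d_two]
  have cη : ∀ (e : Pt) (F : R ι), M eη (M e (d eη F)) = 0 := fun e F => by
    rw [← d_M eη e, M_d_diag]
  refine ⟨?_, ?_, ?_, ?_⟩
  · rw [map_add, map_add, c1, h2, map_sub, map_sub, c1, M_d_diag]; simp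
  · rw [map_add, map_add, M_d_one, h2, map_sub, map_sub, cη, M_d_one]; simp
  · rw [map_add, map_add, c2, M_d_one]; simp
  · rw [map_add, map_add, c2, h1, map_sub, map_sub, c2, M_d_diag]; simp

theorem antidiv_scalar {g : R ι} (hg : IsDiv g) :
    d e1 (I e1 g) + d eη (I eη (M e1 g)) = g := by
  rw [d_I, d_I, I_d_one, I_d_diag, hg.means.2.1]; abel

theorem antidiv_vector {g₁ g₂ : R ι} (h₁ : IsDiv g₁) (h₂ : IsDiv g₂) {r₀ r₁ π : R ι}
    (hr₀ : r₀ = I e1 (g₁ - g₂ + 2 • M eη g₂)) (hr₁ : r₁ = I eη (g₂ + M e1 (g₁ - g₂)))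
    (hπ : π = I e2 (M eη g₂ - M e1 (g₁ - g₂))) :
    d e1 r₀ + d eη r₁ + d e1 π = g₁ ∧ d eη r₁ + d e2 π = g₂ := by
  subst hr₀ hr₁ hπ
  obtain ⟨a1, a2, a3, a4⟩ := h₂.means
  obtain ⟨b1, b2, b3, b4⟩ := (h₁.sub h₂).means
  have key : I e2 (d e1 (M eη g₂)) = -M eη g₂ := by
    have : d e1 (M eη g₂) = -d e2 (M eη g₂) := by
      have h := M_d_diag g₂
      rw [d_diag, map_add] at h
      rw [d_M, d_M]; exact eq_neg_of_add_eq_zero_left h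
    rw [this, map_neg, I_d_two, a4]; simp
  have key2 : d e1 (M e1 (g₁ - g₂)) = 0 := by rw [d_M, M_d_one]
  simp only [d_I, I_d_one, I_d_two, I_d_diag]
  constructor
  · rw [map_sub (d e1), key2, sub_zero, key, map_add (M eη), b2, map_add (M e1),
      map_nsmul, a1]
    simp only [two_smul]; abel
  · rw [map_sub (M e2), b3, a4, map_add (M eη), b2]; abel

/-- A pair of large parameters: polynomial losses in `K` are harmless, powers of `μ` are tracked. -/
structure Scale (ι : Type) where
  K : ι → ℝ
  μ : ι → ℕ
  one_le_K : ∀ i, 1 ≤ K i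
  one_le_μ : ∀ i, 1 ≤ μ i

variable {ι : Type} {s : Scale ι}

namespace Scale

theorem one_le (s : Scale ι) (i : ι) : (1 : ℝ) ≤ s.μ i := by exact_mod_cast s.one_le_μ i

theorem μ_pos (s : Scale ι) (i : ι) : (0 : ℝ) < s.μ i := one_pos.trans_le (s.one_le i)

theorem K_pos (s : Scale ι) (i : ι) : 0 < s.K i := one_pos.trans_le (s.one_le_K i)

/-- Numbers of size `μ ^ m`, up to a power of `K`. -/
def Num (s : Scale ι) (m : ℤ) (a : ι → ℝ) : Prop :=
  ∃ (C : ℝ) (N : ℕ), 0 ≤ C ∧ ∀ i, |a i| ≤ C * s.K i ^ N * (s.μ i : ℝ) ^ m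

theorem num_const (s : Scale ι) (a : ℝ) : s.Num 0 fun _ => a :=
  ⟨|a|, 0, abs_nonneg _, fun i => by simp⟩

theorem num_zpow (s : Scale ι) (m : ℤ) : s.Num m fun i => (s.μ i : ℝ) ^ m :=
  ⟨1, 0, zero_le_one, fun i => by simp⟩

theorem num_K (s : Scale ι) : s.Num 0 s.K :=
  ⟨1, 1, zero_le_one, fun i => by simp [abs_of_pos (s.K_pos i)]⟩

theorem Num.mul {a b : ι → ℝ} {m n : ℤ} (ha : s.Num m a) (hb : s.Num n b) :
    s.Num (m + n) fun i => a i * b i := by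
  obtain ⟨C, N, hC, h⟩ := ha
  obtain ⟨C', N', hC', h'⟩ := hb
  refine ⟨C * C', N + N', mul_nonneg hC hC', fun i => ?_⟩
  rw [abs_mul, zpow_add₀ (s.μ_pos i).ne', pow_add]
  calc |a i| * |b i| ≤ (C * s.K i ^ N * (s.μ i : ℝ) ^ m) * (C' * s.K i ^ N' * (s.μ i : ℝ) ^ n) :=
        mul_le_mul (h i) (h' i) (abs_nonneg _) ((abs_nonneg _).trans (h i))
    _ = _ := by ring

end Scale

/-- Families of size `μ ^ m`, up to a power of `K`. -/
def Bd (s : Scale ι) (m : ℤ) (F : R ι) : Prop :=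
  ∃ (C : ℝ) (N : ℕ), 0 ≤ C ∧ ∀ i q, |(F i).1 q| ≤ C * s.K i ^ N * (s.μ i : ℝ) ^ m

theorem bound_mono (s : Scale ι) {C C' : ℝ} {N N' : ℕ} {m m' : ℤ} (hC : 0 ≤ C) (h : C ≤ C')
    (hN : N ≤ N') (hm : m ≤ m') (i : ι) :
    C * s.K i ^ N * (s.μ i : ℝ) ^ m ≤ C' * s.K i ^ N' * (s.μ i : ℝ) ^ m' := by
  have h1 := pow_le_pow_right₀ (s.one_le_K i) hN
  have h2 := zpow_le_zpow_right₀ (s.one_le i) hm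
  have := s.K_pos i
  have := s.μ_pos i
  have := hC.trans h
  gcongr

theorem Bd.mono {m m' : ℤ} {F : R ι} (h : Bd s m F) (hm : m ≤ m') : Bd s m' F := by
  obtain ⟨C, N, hC, h⟩ := h
  exact ⟨C, N, hC, fun i q => (h i q).trans (bound_mono s hC le_rfl le_rfl hm i)⟩

theorem Bd.add {m : ℤ} {F G : R ι} (hF : Bd s m F) (hG : Bd s m G) : Bd s m (F + G) := by
  obtain ⟨C, N, hC, h⟩ := hF
  obtain ⟨C', N', hC', h'⟩ := hG
  refine ⟨C + C', N + N', add_nonneg hC hC', fun i q => (abs_add_le _ _).trans ?_⟩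
  have a := (h i q).trans (bound_mono s hC le_rfl (Nat.le_add_right N N') (le_refl m) i)
  have b := (h' i q).trans (bound_mono s hC' le_rfl (Nat.le_add_left N' N) (le_refl m) i)
  calc _ ≤ _ := add_le_add a b
    _ = _ := by ring

theorem Bd.mul {m n : ℤ} {F G : R ι} (hF : Bd s m F) (hG : Bd s n G) :
    Bd s (m + n) (F * G) := by
  obtain ⟨C, N, hC, h⟩ := hF
  obtain ⟨C', N', hC', h'⟩ := hG
  refine ⟨C * C', N + N', mul_nonneg hC hC', fun i q => ?_⟩
  change |(F i).1 q * (G i).1 q| ≤ _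
  rw [abs_mul, zpow_add₀ (s.μ_pos i).ne', pow_add]
  calc _ ≤ (C * s.K i ^ N * (s.μ i : ℝ) ^ m) * (C' * s.K i ^ N' * (s.μ i : ℝ) ^ n) :=
        mul_le_mul (h i q) (h' i q) (abs_nonneg _) ((abs_nonneg _).trans (h i q))
    _ = _ := by ring

theorem bd_cst {m : ℤ} {a : ι → ℝ} (ha : s.Num m a) : Bd s m (cst a) := by
  obtain ⟨C, N, hC, h⟩ := ha
  exact ⟨C, N, hC, fun i q => h i⟩

theorem bd_of_le {m : ℤ} {F G : R ι} {C : ℝ} (hC : 0 ≤ C) (hF : Bd s m F)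
    (h : ∀ i B, (∀ q, |(F i).1 q| ≤ B) → ∀ q, |(G i).1 q| ≤ C * B) : Bd s m G := by
  obtain ⟨C', N, hC', h'⟩ := hF
  refine ⟨C * C', N, mul_nonneg hC hC', fun i q => ?_⟩
  calc _ ≤ C * (C' * s.K i ^ N * (s.μ i : ℝ) ^ m) := h i _ (h' i) q
    _ = _ := by ring

/-- Families whose derivatives of order at most `n` are controlled, a derivative in direction
`j` costing a factor `μ ^ c j`. -/
def Cl (s : Scale ι) (c : Fin 3 → ℕ) : ℕ → ℤ → R ι → Prop
  | 0, m, F => Bd s m F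
  | n + 1, m, F => Bd s m F ∧ ∀ j, Cl s c n (m + c j) (d (bas j) F)

variable {c : Fin 3 → ℕ}

theorem Cl.pred {n : ℕ} : ∀ {m : ℤ} {F : R ι}, Cl s c (n + 1) m F → Cl s c n m F := by
  induction n with
  | zero => exact fun h => h.1
  | succ n ih => exact fun h => ⟨h.1, fun j => ih (h.2 j)⟩

theorem Cl.mono {n : ℕ} {c' : Fin 3 → ℕ} (hc : c ≤ c') :
    ∀ {m m' : ℤ} {F : R ι}, m ≤ m' → Cl s c n m F → Cl s c' n m' F := by
  induction n with
  | zero => exact fun hm h => Bd.mono h hm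
  | succ n ih =>
    refine fun hm h => ⟨h.1.mono hm, fun j => ih ?_ (h.2 j)⟩
    have : (c j : ℤ) ≤ c' j := by exact_mod_cast hc j
    linarith

theorem Cl.add {n : ℕ} : ∀ {m : ℤ} {F G : R ι}, Cl s c n m F → Cl s c n m G →
    Cl s c n m (F + G) := by
  induction n with
  | zero => exact fun h h' => Bd.add h h'
  | succ n ih => exact fun h h' => ⟨h.1.add h'.1, fun j => by
      rw [map_add]; exact ih (h.2 j) (h'.2 j)⟩

theorem Cl.mul {n : ℕ} : ∀ {m m' : ℤ} {F G : R ι}, Cl s c n m F → Cl s c n m' G →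
    Cl s c n (m + m') (F * G) := by
  induction n with
  | zero => exact fun h h' => Bd.mul h h'
  | succ n ih =>
    refine fun {m m' F G} h h' => ⟨h.1.mul h'.1, fun j => ?_⟩
    rw [d_mul]
    refine Cl.add ?_ ?_
    · have := ih (h.2 j) h'.pred
      rwa [add_right_comm] at this
    · have := ih h.pred (h'.2 j)
      rwa [← add_assoc] at this

theorem cl_zero (s : Scale ι) (c : Fin 3 → ℕ) (n : ℕ) : ∀ m : ℤ, Cl s c n m 0 := by
  have hb : ∀ m, Bd s m 0 := fun m => ⟨0, 0, le_rfl, fun i q => by simp⟩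
  induction n with
  | zero => exact hb
  | succ n ih => exact fun m => ⟨hb m, fun j => by rw [map_zero]; exact ih _⟩

theorem cl_cst {m : ℤ} {a : ι → ℝ} (ha : s.Num m a) (n : ℕ) : Cl s c n m (cst a) := by
  cases n with
  | zero => exact bd_cst ha
  | succ n => exact ⟨bd_cst ha, fun j => by rw [d_cst]; exact cl_zero _ _ _ _⟩

theorem Cl.of_commute {n : ℕ} {T : R ι → R ι} (hT : ∀ m F, Bd s m F → Bd s m (T F))
    (hd : ∀ j F, d (bas j) (T F) = T (d (bas j) F)) :
    ∀ {m : ℤ} {F : R ι}, Cl s c n m F → Cl s c n m (T F) := by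
  induction n with
  | zero => exact fun h => hT _ _ h
  | succ n ih => exact fun h => ⟨hT _ _ h.1, fun j => by rw [hd]; exact ih (h.2 j)⟩

/-- Symbols of order `m`. -/
def Sy (s : Scale ι) (c : Fin 3 → ℕ) (m : ℤ) (F : R ι) : Prop := ∀ n, Cl s c n m F

namespace Sy

variable {m m' : ℤ} {F G : R ι}

theorem bd (h : Sy s c m F) : Bd s m F := h 0

theorem mono {c' : Fin 3 → ℕ} (h : Sy s c m F) (hc : c ≤ c') (hm : m ≤ m') : Sy s c' m' F :=
  fun n => (h n).mono hc hm

theorem le (h : Sy s c m F) (hm : m ≤ m') : Sy s c m' F := h.mono le_rfl hm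

theorem add (h : Sy s c m F) (h' : Sy s c m G) : Sy s c m (F + G) := fun n => (h n).add (h' n)

theorem mul (h : Sy s c m F) (h' : Sy s c m' G) : Sy s c (m + m') (F * G) :=
  fun n => (h n).mul (h' n)

theorem mul_of_eq {k : ℤ} (h : Sy s c m F) (h' : Sy s c m' G) (e : m + m' = k) :
    Sy s c k (F * G) := e ▸ h.mul h'

theorem cst {a : ι → ℝ} (ha : s.Num m a) : Sy s c m (cst a) := fun n => cl_cst ha n

theorem zero : Sy s c m 0 := fun n => cl_zero s c n m

theorem const_mul (a : ℝ) (h : Sy s c m F) : Sy s c m (Boussinesq.cst (fun _ => a) * F) := by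
  have := (cst (c := c) (s.num_const a)).mul h
  rwa [zero_add] at this

theorem neg (h : Sy s c m F) : Sy s c m (-F) := by
  have e : -F = Boussinesq.cst (fun _ => -1) * F := by
    rw [show (fun _ : ι => (-1 : ℝ)) = -1 from rfl, map_neg, map_one]; ring
  rw [e]; exact h.const_mul _

theorem sub (h : Sy s c m F) (h' : Sy s c m G) : Sy s c m (F - G) := by
  rw [sub_eq_add_neg]; exact h.add h'.neg

theorem one : Sy s c 0 (1 : R ι) := by
  have := cst (s := s) (c := c) (s.num_const (1 : ℝ))
  rwa [show (fun _ : ι => (1 : ℝ)) = 1 from rfl, map_one] at this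

theorem d (h : Sy s c m F) (j : Fin 3) : Sy s c (m + c j) (d (bas j) F) :=
  fun n => (h (n + 1)).2 j

theorem of_d (hb : Bd s m F) (h : ∀ j, Sy s c (m + c j) (Boussinesq.d (bas j) F)) :
    Sy s c m F := by
  intro n
  cases n with
  | zero => exact hb
  | succ n => exact ⟨hb, fun j => h j n⟩

theorem of_commute {T : R ι → R ι} (h : Sy s c m F) (hT : ∀ m F, Bd s m F → Bd s m (T F))
    (hd : ∀ j F, Boussinesq.d (bas j) (T F) = T (Boussinesq.d (bas j) F)) : Sy s c m (T F) :=
  fun n => (h n).of_commute hT hd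

theorem M (h : Sy s c m F) (e : Pt) : Sy s c m (M e F) := by
  refine h.of_commute (fun m F hF => bd_of_le (C := circ.real Set.univ) measureReal_nonneg hF ?_)
    (fun j F => d_M _ _ _)
  intro i B hB q
  have := abs_avg_le (c := fun σ => σ • e) circ_const hB q
  rwa [one_mul, mul_comm B] at this

theorem I (h : Sy s c m F) (e : Pt) : Sy s c m (I e F) := by
  refine h.of_commute (fun m F hF => bd_of_le (C := circ.real Set.univ) measureReal_nonneg hF ?_)
    (fun j F => d_I _ _ _)
  intro i B hB q
  have := abs_avg_le (c := fun σ => σ • e) circ_weight hB q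
  rwa [one_mul, mul_comm B] at this

end Sy

/-- The inverse square root of a family bounded below. -/
theorem exists_invSqrt (F : R ι) (hF : ∀ i q, 1 / 2 ≤ (F i).1 q) :
    ∃ G : R ι, G * G * F = 1 ∧ ∀ i q, 0 < (G i).1 q ∧ (G i).1 q ≤ 2 := by
  have pos : ∀ i q, 0 < (F i).1 q := fun i q => lt_of_lt_of_le (by norm_num) (hF i q)
  refine ⟨fun i => ⟨fun q => (Real.sqrt ((F i).1 q))⁻¹, ?_, ?_⟩, ?_, fun i q => ⟨?_, ?_⟩⟩
  · exact ((adm (F i)).smooth.sqrt fun q => (pos i q).ne').inv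
      fun q => (Real.sqrt_pos.2 (pos i q)).ne'
  · intro q m n; simp only [(adm (F i)).per]
  · refine funext fun i => Subtype.ext (funext fun q => ?_)
    change (Real.sqrt ((F i).1 q))⁻¹ * (Real.sqrt ((F i).1 q))⁻¹ * (F i).1 q = 1
    have h := Real.mul_self_sqrt (pos i q).le
    rw [← mul_inv, h, inv_mul_cancel₀ (pos i q).ne']
  · exact inv_pos.2 (Real.sqrt_pos.2 (pos i q))
  · change (Real.sqrt ((F i).1 q))⁻¹ ≤ 2
    rw [inv_le_comm₀ (Real.sqrt_pos.2 (pos i q)) two_pos]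
    refine Real.le_sqrt_of_sq_le (le_trans ?_ (hF i q))
    norm_num

theorem d_invSqrt {F G : R ι} (h : G * G * F = 1) (u : Pt) :
    d u G = cst (fun _ => -(1 / 2)) * (G * G * G * d u F) := by
  have h1 : d u (G * G * F) = 0 := by rw [h, d_one]
  simp only [d_mul] at h1
  have h2 : (2 : R ι) * cst (fun _ => -(1 / 2)) = -1 := by
    rw [← map_ofNat (cst : (ι → ℝ) →+* R ι) 2, ← map_mul, ← map_one cst, ← map_neg]
    congr 1; funext i; simp
  linear_combination -(cst (fun _ => -(1 / 2)) * G) * h1 + (d u G * G * G * F) * h2 - d u G * h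

theorem sy_invSqrt {F G : R ι} (h : G * G * F = 1) (hb : Bd s 0 G) (hF : Sy s c 0 F) :
    Sy s c 0 G := by
  intro n
  induction n with
  | zero => exact hb
  | succ n ih =>
    refine ⟨hb, fun j => ?_⟩
    rw [d_invSqrt h]
    have h1 := (cl_cst (c := c) (s.num_const (-(1 / 2))) n).mul
      (((ih.mul ih).mul ih).mul ((hF.d j) n))
    convert h1 using 1
    ring

/-- Functions all of whose derivatives are bounded. -/
structure BS (g : ℝ → ℝ) : Prop where
  smooth : ContDiff ℝ (⊤ : ℕ∞) g
  bound : ∀ n, ∃ C, ∀ x, |iteratedDeriv n g x| ≤ C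

theorem BS.deriv {g : ℝ → ℝ} (hg : BS g) : BS (deriv g) := by
  refine ⟨?_, fun n => ?_⟩
  · exact (contDiff_infty_iff_deriv.1 hg.smooth).2
  · obtain ⟨C, hC⟩ := hg.bound (n + 1)
    exact ⟨C, fun x => by rw [← iteratedDeriv_succ']; exact hC x⟩

/-- Functions of a rescaled time. -/
def timeF (g : ℝ → ℝ) (hg : BS g) (σ τ : ι → ℝ) : R ι := fun i =>
  ⟨fun q => g (σ i * q.1 + τ i), hg.smooth.comp (by fun_prop), fun q m n => by simp⟩

@[simp] theorem timeF_coe (g : ℝ → ℝ) (hg : BS g) (σ τ : ι → ℝ) (i : ι) (q : Pt) :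
    (timeF g hg σ τ i).1 q = g (σ i * q.1 + τ i) := rfl

theorem d_timeF (g : ℝ → ℝ) (hg : BS g) (σ τ : ι → ℝ) (u : Pt) :
    d u (timeF g hg σ τ) = cst (fun i => σ i * u.1) * timeF (deriv g) hg.deriv σ τ := by
  refine funext fun i => Subtype.ext (funext fun q => ?_)
  change fderiv ℝ (fun q : Pt => g (σ i * q.1 + τ i)) q u = σ i * u.1 * deriv g (σ i * q.1 + τ i)
  have h1 : HasFDerivAt (fun q : Pt => σ i * q.1 + τ i) (σ i • ContinuousLinearMap.fst ℝ ℝ (ℝ × ℝ)) q :=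
    ((hasFDerivAt_fst).const_mul _).add_const _
  have h2 := ((hg.smooth.differentiable (by simp)) (σ i * q.1 + τ i)).hasDerivAt
  have h3 := h2.comp_hasFDerivAt q h1
  rw [show (fun q : Pt => g (σ i * q.1 + τ i)) = g ∘ fun q : Pt => σ i * q.1 + τ i from rfl, h3.fderiv]
  simp; ring

theorem sy_timeF (g : ℝ → ℝ) (hg : BS g) (σ τ : ι → ℝ) (hσ : s.Num (c 0) σ) :
    Sy s c 0 (timeF g hg σ τ) := by
  intro n
  have hb : ∀ g (hg : BS g), Bd s 0 (timeF g hg σ τ) := fun g hg => by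
    obtain ⟨C, hC⟩ := hg.bound 0
    refine ⟨C, 0, (abs_nonneg _).trans (hC 0), fun i q => ?_⟩
    simpa using hC (σ i * q.1 + τ i)
  induction n generalizing g with
  | zero => exact hb g hg
  | succ n ih =>
    refine ⟨hb g hg, fun j => ?_⟩
    rw [d_timeF]
    have key : Cl s c n (c j) (cst fun i => σ i * (bas j).1) := by
      fin_cases j
      · simpa [bas] using cl_cst hσ n
      · have : (fun i => σ i * (bas 1).1) = 0 := by funext i; simp [bas]
        change Cl s c n _ (cst fun i => σ i * (bas 1).1)
        rw [this, map_zero]; exact cl_zero _ _ _ _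
      · have : (fun i => σ i * (bas 2).1) = 0 := by funext i; simp [bas]
        change Cl s c n _ (cst fun i => σ i * (bas 2).1)
        rw [this, map_zero]; exact cl_zero _ _ _ _
    have := key.mul (ih _ hg.deriv)
    rwa [add_comm] at this

/-- `cos (μ² k·x + μ h + a)`. -/
def osc (s : Scale ι) (k : ℤ × ℤ) (h : R ι) (a : ℝ) : R ι := fun i =>
  ⟨fun q => Real.cos ((s.μ i : ℝ) ^ 2 * (k.1 * q.2.1 + k.2 * q.2.2) + s.μ i * (h i).1 q + a), by
    have := (adm (h i)).smooth
    fun_prop, fun q m n => by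
    rw [(adm (h i)).per]
    have e : (s.μ i : ℝ) ^ 2 * (k.1 * (q + (0, 2 * Real.pi * m, 2 * Real.pi * n)).2.1
        + k.2 * (q + (0, 2 * Real.pi * m, 2 * Real.pi * n)).2.2) + s.μ i * (h i).1 q + a
        = ((s.μ i : ℝ) ^ 2 * (k.1 * q.2.1 + k.2 * q.2.2) + s.μ i * (h i).1 q + a)
          + ((s.μ i ^ 2 * (k.1 * m + k.2 * n) : ℤ) : ℝ) * (2 * Real.pi) := by
      simp; ring
    rw [e, Real.cos_add_int_mul_two_pi]⟩

theorem osc_coe (k : ℤ × ℤ) (h : R ι) (a : ℝ) (i : ι) (q : Pt) : (osc s k h a i).1 q =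
    Real.cos ((s.μ i : ℝ) ^ 2 * (k.1 * q.2.1 + k.2 * q.2.2) + s.μ i * (h i).1 q + a) := rfl

/-- Powers of the frequency parameter. -/
def mu (s : Scale ι) (m : ℤ) : R ι := cst fun i => (s.μ i : ℝ) ^ m

theorem mu_mul (m n : ℤ) : mu s m * mu s n = mu s (m + n) := by
  rw [mu, mu, mu, ← map_mul]; congr 1; funext i; exact (zpow_add₀ (s.μ_pos i).ne' _ _).symm

@[simp] theorem mu_zero : mu s 0 = 1 := by
  rw [mu, ← map_one cst]; exact congrArg cst (funext fun i => zpow_zero _)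

theorem sy_mu (m : ℤ) : Sy s c m (mu s m) := Sy.cst (s.num_zpow m)

@[simp] theorem d_mu (u : Pt) (m : ℤ) : d u (mu s m) = 0 := d_cst _ _

/-- Real constants. -/
def con (a : ℝ) : R ι := cst fun _ => a

@[simp] theorem d_con (u : Pt) (a : ℝ) : d u (con a : R ι) = 0 := d_cst _ _

theorem con_mul (a b : ℝ) : (con a : R ι) * con b = con (a * b) := by
  rw [con, con, ← map_mul]; rfl

@[simp] theorem con_one : (con 1 : R ι) = 1 := map_one cst

theorem sy_con (a : ℝ) : Sy s c 0 (con a) := Sy.cst (s.num_const a)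

theorem d_osc (k : ℤ × ℤ) (h : R ι) (a : ℝ) (u : Pt) :
    d u (osc s k h a) = osc s k h (a + Real.pi / 2) *
      (con (k.1 * u.2.1 + k.2 * u.2.2) * mu s 2 + mu s 1 * d u h) := by
  refine funext fun i => Subtype.ext (funext fun q => ?_)
  change fderiv ℝ (fun q : Pt => Real.cos ((s.μ i : ℝ) ^ 2 * (k.1 * q.2.1 + k.2 * q.2.2)
    + s.μ i * (h i).1 q + a)) q u = Real.cos _ * ((k.1 * u.2.1 + k.2 * u.2.2) * (s.μ i : ℝ) ^ (2:ℤ)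
    + (s.μ i : ℝ) ^ (1 : ℤ) * fderiv ℝ (h i).1 q u)
  have h0 := ((adm (h i)).diff q).hasFDerivAt
  have hy : HasFDerivAt (fun q : Pt => q.2.1)
    ((ContinuousLinearMap.fst ℝ ℝ ℝ).comp (ContinuousLinearMap.snd ℝ ℝ (ℝ × ℝ))) q :=
    hasFDerivAt_fst.comp q hasFDerivAt_snd
  have hz : HasFDerivAt (fun q : Pt => q.2.2)
    ((ContinuousLinearMap.snd ℝ ℝ ℝ).comp (ContinuousLinearMap.snd ℝ ℝ (ℝ × ℝ))) q :=
    hasFDerivAt_snd.comp q hasFDerivAt_snd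
  have h1 : HasFDerivAt (fun q : Pt => (s.μ i : ℝ) ^ 2 * (k.1 * q.2.1 + k.2 * q.2.2)
    + s.μ i * (h i).1 q + a) _ q := ((((hy.const_mul (k.1 : ℝ)).add (hz.const_mul (k.2 : ℝ))).const_mul
    ((s.μ i : ℝ) ^ 2)).add (h0.const_mul (s.μ i : ℝ))).add_const a
  rw [h1.cos.fderiv, ← add_assoc, Real.cos_add_pi_div_two]
  simp
  ring

/-- Costs of derivatives for functions at the length scale of `K`. -/
abbrev low : Fin 3 → ℕ := ![0, 0, 0]

/-- Costs of derivatives for amplitudes, which oscillate in time at frequency `μ`. -/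
abbrev sym : Fin 3 → ℕ := ![1, 0, 0]

/-- Costs of derivatives for functions oscillating at frequency `μ²`. -/
abbrev fast : Fin 3 → ℕ := ![2, 2, 2]

theorem low_le_sym : low ≤ sym := fun j => by fin_cases j <;> simp [low, sym]

theorem sym_le_fast : sym ≤ fast := fun j => by fin_cases j <;> simp [sym, fast]

section Wave

variable {ι : Type} {s : Scale ι} {m : ℤ} {A h : R ι} {k : ℤ × ℤ} {n : ℤ} {a : ℝ}

theorem Sy.fast {F : R ι} (hF : Sy s sym m F) : Sy s fast m F := hF.mono sym_le_fast le_rfl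

theorem Sy.sym {F : R ι} (hF : Sy s low m F) : Sy s sym m F := hF.mono low_le_sym le_rfl

theorem Sy.d_sym {F : R ι} (hF : Sy s Boussinesq.sym m F) (j : Fin 3) :
    Sy s Boussinesq.sym (m + 1) (Boussinesq.d (bas j) F) := by
  refine (hF.d j).le ?_
  fin_cases j <;> simp [Boussinesq.sym]

theorem Sy.d_space {F : R ι} (hF : Sy s Boussinesq.sym m F) {j : Fin 3} (hj : j ≠ 0) :
    Sy s Boussinesq.sym m (Boussinesq.d (bas j) F) := by
  refine (hF.d j).le ?_
  fin_cases j <;> simp_all [Boussinesq.sym]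

theorem Sy.d_low {F : R ι} (hF : Sy s Boussinesq.low m F) (j : Fin 3) :
    Sy s Boussinesq.low m (Boussinesq.d (bas j) F) := by
  refine (hF.d j).le ?_
  fin_cases j <;> simp [Boussinesq.low]

theorem Sy.d_fast {F : R ι} (hF : Sy s Boussinesq.fast m F) (j : Fin 3) :
    Sy s Boussinesq.fast (m + 2) (Boussinesq.d (bas j) F) := by
  refine (hF.d j).le ?_
  fin_cases j <;> simp [Boussinesq.fast]

theorem sy_osc (k : ℤ × ℤ) (hh : Sy s sym 0 h) (a : ℝ) : Sy s fast 0 (osc s k h a) := by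
  intro n
  have hb : ∀ a, Bd s 0 (osc s k h a) := fun a =>
    ⟨1, 0, zero_le_one, fun i q => by simpa [osc_coe] using Real.abs_cos_le_one _⟩
  induction n generalizing a with
  | zero => exact hb a
  | succ n ih =>
    refine ⟨hb a, fun j => ?_⟩
    rw [d_osc]
    refine (ih _).mul (Sy.le (m := 2) (.add ?_ ?_) ?_ n)
    · exact (sy_con _).mul_of_eq (sy_mu 2) (by norm_num)
    · exact (sy_mu 1).mul_of_eq (hh.d_sym j).fast (by norm_num)
    · fin_cases j <;> simp [fast]

/-- Sums of modulated plane waves with frequencies parallel to `μ² k`. -/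
inductive IsWave (s : Scale ι) (k : ℤ × ℤ) (m : ℤ) : R ι → Prop
  | base {A h : R ι} (n : ℤ) (a : ℝ) : n ≠ 0 → Sy s sym m A → Sy s sym 0 h →
      IsWave s k m (A * osc s (n * k.1, n * k.2) h a)
  | add {F G : R ι} : IsWave s k m F → IsWave s k m G → IsWave s k m (F + G)

namespace IsWave

variable {F G B : R ι} {m' : ℤ}

theorem sy (hG : IsWave s k m G) : Sy s fast m G := by
  induction hG with
  | base n a hn hA hh => exact hA.fast.mul_of_eq (sy_osc _ hh a) (by ring)
  | add _ _ h1 h2 => exact h1.add h2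

theorem mul_sym (hG : IsWave s k m G) (hB : Sy s sym m' B) : IsWave s k (m' + m) (B * G) := by
  induction hG with
  | base n a hn hA hh => rw [← mul_assoc]; exact base n a hn (hB.mul hA) hh
  | add _ _ h1 h2 => rw [mul_add]; exact h1.add h2

theorem mul_sym_of_eq {l : ℤ} (hB : Sy s sym m' B) (hG : IsWave s k m G) (e : m' + m = l) :
    IsWave s k l (B * G) := e ▸ hG.mul_sym hB

theorem le (hG : IsWave s k m G) (hm : m ≤ m') : IsWave s k m' G := by
  induction hG with
  | base n a hn hA hh => exact base n a hn (hA.le hm) hh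
  | add _ _ h1 h2 => exact h1.add h2

theorem con_mul (c : ℝ) (hG : IsWave s k m G) : IsWave s k m (con c * G) :=
  mul_sym_of_eq (sy_con c) hG (zero_add _)

theorem neg (hG : IsWave s k m G) : IsWave s k m (-G) := by
  have e : -G = con (-1) * G := by
    rw [con, show (fun _ : ι => (-1 : ℝ)) = -1 from rfl, map_neg, map_one]; ring
  rw [e]; exact hG.con_mul _

theorem sub (hF : IsWave s k m F) (hG : IsWave s k m G) : IsWave s k m (F - G) := by
  rw [sub_eq_add_neg]; exact hF.add hG.neg

theorem d (hG : IsWave s k m G) (j : Fin 3) : IsWave s k (m + 2) (d (bas j) G) := by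
  induction hG with
  | @base A h n a hn hA hh =>
    rw [d_mul, d_osc]
    refine add (base n a hn ((hA.d_sym j).le (by linarith)) hh) ?_
    rw [mul_comm (osc _ _ _ _), ← mul_assoc]
    refine base n _ hn (hA.mul (.add ?_ ?_)) hh
    · exact (sy_con _).mul_of_eq (sy_mu 2) (by norm_num)
    · exact (sy_mu 1).mul_of_eq (hh.d_sym j) (by norm_num)
  | add _ _ h1 h2 => rw [map_add]; exact h1.add h2

/-- The derivative along the wave fronts. -/
theorem d_front (hG : IsWave s k m G) :
    IsWave s k (m + 1) (con k.2 * Boussinesq.d e1 G - con k.1 * Boussinesq.d e2 G) := by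
  induction hG with
  | @base A h n a hn hA hh =>
    have h1 := hA.d_space (j := 1) (by simp)
    have h2 := hA.d_space (j := 2) (by simp)
    have h1' := hh.d_space (j := 1) (by simp)
    have h2' := hh.d_space (j := 2) (by simp)
    have e : con k.2 * Boussinesq.d e1 (A * osc s (n * k.1, n * k.2) h a)
        - con k.1 * Boussinesq.d e2 (A * osc s (n * k.1, n * k.2) h a)
        = (con k.2 * Boussinesq.d e1 A - con k.1 * Boussinesq.d e2 A)
            * osc s (n * k.1, n * k.2) h a
          + (mu s 1 * A * (con k.2 * Boussinesq.d e1 h - con k.1 * Boussinesq.d e2 h))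
            * osc s (n * k.1, n * k.2) h (a + Real.pi / 2) := by
      rw [d_mul, d_mul, d_osc, d_osc]
      have c1 : (con ((n * k.1 : ℤ) * e1.2.1 + (n * k.2 : ℤ) * e1.2.2) : R ι)
          = con n * con k.1 := by rw [Boussinesq.con_mul]; simp [e1, bas]
      have c2 : (con ((n * k.1 : ℤ) * e2.2.1 + (n * k.2 : ℤ) * e2.2.2) : R ι)
          = con n * con k.2 := by rw [Boussinesq.con_mul]; simp [e2, bas]
      rw [c1, c2]; ring
    rw [e]
    refine add (base n _ hn ?_ hh) (base n _ hn ?_ hh)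
    · exact Sy.sub (((sy_con _).mul_of_eq h1 (zero_add _)).le (by linarith))
        (((sy_con _).mul_of_eq h2 (zero_add _)).le (by linarith))
    · refine ((sy_mu 1).mul_of_eq hA rfl).mul_of_eq (m' := 0) ?_ (by ring)
      exact Sy.sub ((sy_con _).mul_of_eq h1' (zero_add _))
        ((sy_con _).mul_of_eq h2' (zero_add _))
  | @add F G _ _ h1 h2 =>
    have e : con k.2 * Boussinesq.d e1 (F + G) - con k.1 * Boussinesq.d e2 (F + G)
        = (con k.2 * Boussinesq.d e1 F - con k.1 * Boussinesq.d e2 F)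
          + (con k.2 * Boussinesq.d e1 G - con k.1 * Boussinesq.d e2 G) := by
      rw [map_add, map_add]; ring
    rw [e]; exact h1.add h2

/-- Approximate inversion of spatial derivatives of a single wave. -/
theorem parametrix_base (hn : n ≠ 0) (hA : Sy s Boussinesq.sym m A)
    (hh : Sy s Boussinesq.sym 0 h) (a : ℝ) :
    IsWave s k (m - 1) (Boussinesq.d e1 ((con (1 / n) * mu s (-2) * A) *
      osc s (n * k.1, n * k.2) h (a - Real.pi / 2))
        - con k.1 * (A * osc s (n * k.1, n * k.2) h a)) ∧
    IsWave s k (m - 1) (Boussinesq.d e2 ((con (1 / n) * mu s (-2) * A) *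
      osc s (n * k.1, n * k.2) h (a - Real.pi / 2))
        - con k.2 * (A * osc s (n * k.1, n * k.2) h a)) := by
  have hn' : (n : ℝ) ≠ 0 := by exact_mod_cast hn
  have key : ∀ (u : Pt) (κ : ℝ), (k.1 * u.2.1 + k.2 * u.2.2 : ℝ) = κ →
      Boussinesq.d u ((con (1 / n) * mu s (-2) * A)
        * osc s (n * k.1, n * k.2) h (a - Real.pi / 2))
        - con κ * (A * osc s (n * k.1, n * k.2) h a)
      = (con (1 / n) * mu s (-2) * Boussinesq.d u A)
          * osc s (n * k.1, n * k.2) h (a - Real.pi / 2)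
        + ((con (1 / n) * mu s (-1)) * (A * Boussinesq.d u h))
          * osc s (n * k.1, n * k.2) h a := by
    intro u κ hκ
    rw [d_mul, d_mul, d_mul, d_con, d_mu, d_osc, sub_add_cancel]
    have c1 : (con ((n * k.1 : ℤ) * u.2.1 + (n * k.2 : ℤ) * u.2.2) : R ι)
        = con n * con κ := by rw [Boussinesq.con_mul, ← hκ]; congr 1; push_cast; ring
    have c2 : (con (1 / n) : R ι) * con n = 1 := by
      rw [Boussinesq.con_mul, one_div_mul_cancel hn', con_one]
    have c3 : (mu s (-2) : R ι) * mu s 2 = 1 := by rw [mu_mul]; simp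
    have c4 : (mu s (-1) : R ι) = mu s (-2) * mu s 1 := by rw [mu_mul]; simp
    rw [c1, c4]
    linear_combination (mu s (-2) * mu s 2 * con κ * A * osc s (n * k.1, n * k.2) h a) * c2
      + (con κ * A * osc s (n * k.1, n * k.2) h a) * c3
  have aux : ∀ j : Fin 3, j ≠ 0 → IsWave s k (m - 1)
      ((con (1 / n) * mu s (-2) * Boussinesq.d (bas j) A)
          * osc s (n * k.1, n * k.2) h (a - Real.pi / 2)
        + ((con (1 / n) * mu s (-1)) * (A * Boussinesq.d (bas j) h))
          * osc s (n * k.1, n * k.2) h a) := by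
    intro j hj
    refine add (base n _ hn ?_ hh) (base n _ hn ?_ hh)
    · exact (((sy_con _).mul_of_eq (sy_mu (-2)) (zero_add _)).mul (hA.d_space hj)).le
        (by linarith)
    · exact (((sy_con _).mul_of_eq (sy_mu (-1)) (zero_add _)).mul
        (hA.mul (hh.d_space hj))).le (by linarith)
  exact ⟨by rw [key e1 k.1 (by simp [e1, bas])]; exact aux 1 (by simp),
    by rw [key e2 k.2 (by simp [e2, bas])]; exact aux 2 (by simp)⟩

theorem sy_potential (hA : Sy s Boussinesq.sym m A) :
    Sy s Boussinesq.sym (m - 2) (con (1 / n) * mu s (-2) * A) :=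
  ((sy_con _).mul_of_eq (sy_mu (-2)) (zero_add _)).mul_of_eq hA (by ring)

/-- Approximate inversion of spatial derivatives. -/
theorem parametrix (hG : IsWave s k m G) : ∃ F, IsWave s k (m - 2) F ∧
    IsWave s k (m - 1) (Boussinesq.d e1 F - con k.1 * G) ∧
    IsWave s k (m - 1) (Boussinesq.d e2 F - con k.2 * G) := by
  induction hG with
  | base n a hn hA hh => exact ⟨_, base n _ hn (sy_potential hA) hh, parametrix_base hn hA hh a⟩
  | @add G G' _ _ h1 h2 =>
    obtain ⟨F, f0, f1, f2⟩ := h1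
    obtain ⟨F', g0, g1, g2⟩ := h2
    refine ⟨F + F', f0.add g0, ?_, ?_⟩
    · rw [map_add, mul_add, add_sub_add_comm]; exact f1.add g1
    · rw [map_add, mul_add, add_sub_add_comm]; exact f2.add g2

end IsWave

/-- The material derivative. -/
def mat (v₁ v₂ F : R ι) : R ι := d e0 F + v₁ * d e1 F + v₂ * d e2 F

theorem mat_add (v₁ v₂ F G : R ι) : mat v₁ v₂ (F + G) = mat v₁ v₂ F + mat v₁ v₂ G := by
  simp only [mat, map_add]; ring

theorem mat_mul (v₁ v₂ F G : R ι) :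
    mat v₁ v₂ (F * G) = mat v₁ v₂ F * G + F * mat v₁ v₂ G := by
  simp only [mat, d_mul]; ring

theorem Sy.mat {v₁ v₂ F : R ι} (h₁ : Sy s low 0 v₁) (h₂ : Sy s low 0 v₂)
    (hF : Sy s Boussinesq.sym m F) : Sy s Boussinesq.sym (m + 1) (mat v₁ v₂ F) :=
  ((hF.d_sym 0).add (h₁.sym.mul_of_eq (hF.d_sym 1) (zero_add _))).add
    (h₂.sym.mul_of_eq (hF.d_sym 2) (zero_add _))

/-- Waves transported by the flow lose only one factor of `μ` in the material derivative. -/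
theorem isWave_mat {v₁ v₂ B : R ι} (h₁ : Sy s low 0 v₁) (h₂ : Sy s low 0 v₂) (hn : n ≠ 0)
    (hA : Sy s sym m A) (hh : Sy s sym 0 h) (hB : Sy s sym (m + 1) B)
    (e : A * (con n * mu s 2 * (con k.1 * v₁ + con k.2 * v₂) + mu s 1 * mat v₁ v₂ h) = B) :
    IsWave s k (m + 1) (mat v₁ v₂ (A * osc s (n * k.1, n * k.2) h a)) := by
  have key : mat v₁ v₂ (A * osc s (n * k.1, n * k.2) h a)
      = mat v₁ v₂ A * osc s (n * k.1, n * k.2) h a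
        + B * osc s (n * k.1, n * k.2) h (a + Real.pi / 2) := by
    rw [mat_mul, ← e]
    congr 1
    simp only [mat, d_osc]
    have c0 : (con ((n * k.1 : ℤ) * e0.2.1 + (n * k.2 : ℤ) * e0.2.2) : R ι) = 0 := by
      simp only [e0, bas]; simp; exact map_zero cst
    have c1 : (con ((n * k.1 : ℤ) * e1.2.1 + (n * k.2 : ℤ) * e1.2.2) : R ι)
        = con n * con k.1 := by rw [con_mul]; simp [e1, bas]
    have c2 : (con ((n * k.1 : ℤ) * e2.2.1 + (n * k.2 : ℤ) * e2.2.2) : R ι)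
        = con n * con k.2 := by rw [con_mul]; simp [e2, bas]
    rw [c0, c1, c2]; ring
  rw [key]
  exact (IsWave.base n _ hn (Sy.mat h₁ h₂ hA) hh).add (.base n _ hn hB hh)

theorem osc_mul (k k' : ℤ × ℤ) (h h' : R ι) (a a' : ℝ) :
    osc s k h a * osc s k' h' a' = con (1 / 2) *
      (osc s (k + k') (h + h') (a + a') + osc s (k - k') (h - h') (a - a')) := by
  refine funext fun i => Subtype.ext (funext fun q => ?_)
  change Real.cos _ * Real.cos _ = 1 / 2 * (Real.cos _ + Real.cos _)
  rw [Real.cos_add_cos]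
  have h1 : (h i + h' i).1 q = (h i).1 q + (h' i).1 q := rfl
  have h2 : (h i - h' i).1 q = (h i).1 q - (h' i).1 q := rfl
  simp only [Pi.add_apply, Pi.sub_apply, h1, h2, Prod.fst_add, Prod.snd_add, Prod.fst_sub,
    Prod.snd_sub]
  push_cast
  rw [show ∀ x y : ℝ, 1 / 2 * (2 * x * y) = x * y from fun x y => by ring]
  congr 2 <;> ring

theorem osc_zero : osc s (0, 0) (0 : R ι) 0 = 1 := by
  refine funext fun i => Subtype.ext (funext fun q => ?_)
  change Real.cos (_ * ((0 : ℤ) * _ + (0 : ℤ) * _) + _ * 0 + 0) = 1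
  simp

end Wave

/-- The wave vectors used to cancel errors in the two directions. -/
def kv : Bool → ℤ × ℤ
  | false => (0, 1)
  | true => (-1, 1)

section Solve

variable {ι : Type} {s : Scale ι} {m : ℤ} {G G₁ G₂ : R ι}

@[simp] theorem con_zero : (con 0 : R ι) = 0 := map_zero cst

@[simp] theorem con_neg_one : (con (-1) : R ι) = -1 := by
  rw [con, show (fun _ : ι => (-1 : ℝ)) = -1 from rfl, map_neg, map_one]

theorem isWave_solve_scalar_approx (b : Bool) (hG : IsWave s (kv b) m G) :
    ∃ f₀ f₁, Sy s fast (m - 2) f₀ ∧ Sy s fast (m - 2) f₁ ∧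
      IsWave s (kv b) (m - 1) (G - (d e1 f₀ + d eη f₁)) := by
  obtain ⟨F, h0, h1, h2⟩ := hG.parametrix
  cases b with
  | false =>
    refine ⟨0, F, .zero, h0.sy, ?_⟩
    have e : G - (d e1 0 + d eη F) = -((d e1 F - con (kv false).1 * G)
        + (d e2 F - con (kv false).2 * G)) := by
      rw [d_diag]; simp [kv]; ring
    rw [e]; exact (h1.add h2).neg
  | true =>
    refine ⟨-F, 0, h0.sy.neg, .zero, ?_⟩
    have e : G - (d e1 (-F) + d eη 0) = d e1 F - con (kv true).1 * G := by simp [kv]; ring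
    rw [e]; exact h1

theorem isWave_solve_vector_approx (b : Bool) (hG₁ : IsWave s (kv b) m G₁)
    (hG₂ : IsWave s (kv b) m G₂) : ∃ r₀ r₁ π, Sy s fast (m - 2) r₀ ∧ Sy s fast (m - 2) r₁ ∧
      Sy s fast (m - 2) π ∧ IsWave s (kv b) (m - 1) (G₁ - (d e1 r₀ + d eη r₁ + d e1 π)) ∧
      IsWave s (kv b) (m - 1) (G₂ - (d eη r₁ + d e2 π)) := by
  obtain ⟨F, f0, f1, f2⟩ := hG₁.parametrix
  obtain ⟨F', g0, g1, g2⟩ := hG₂.parametrix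
  cases b with
  | false =>
    refine ⟨0, F, F' - F, .zero, f0.sy, g0.sy.sub f0.sy, ?_, ?_⟩
    · have e : G₁ - (d e1 0 + d eη F + d e1 (F' - F)) = -((d e2 F - con (kv false).2 * G₁)
        + (d e1 F' - con (kv false).1 * G₂)) := by rw [d_diag]; simp [kv]; ring
      rw [e]; exact (f2.add g1).neg
    · have e : G₂ - (d eη F + d e2 (F' - F)) = -((d e1 F - con (kv false).1 * G₁)
        + (d e2 F' - con (kv false).2 * G₂)) := by rw [d_diag]; simp [kv]; ring
      rw [e]; exact (f1.add g2).neg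
  | true =>
    refine ⟨-F - F', 0, F', f0.sy.neg.sub g0.sy, .zero, g0.sy, ?_, ?_⟩
    · have e : G₁ - (d e1 (-F - F') + d eη 0 + d e1 F') = d e1 F - con (kv true).1 * G₁ := by
        simp [kv]; ring
      rw [e]; exact f1
    · have e : G₂ - (d eη 0 + d e2 F') = -(d e2 F' - con (kv true).2 * G₂) := by simp [kv]
      rw [e]; exact g2.neg

theorem antidiv_vector_sy {c : Fin 3 → ℕ} (h₁ : IsDiv G₁) (h₂ : IsDiv G₂) (hS₁ : Sy s c m G₁)
    (hS₂ : Sy s c m G₂) : ∃ r₀ r₁ π, Sy s c m r₀ ∧ Sy s c m r₁ ∧ Sy s c m π ∧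
      d e1 r₀ + d eη r₁ + d e1 π = G₁ ∧ d eη r₁ + d e2 π = G₂ := by
  refine ⟨_, _, _, ?_, ?_, ?_, antidiv_vector h₁ h₂ rfl rfl rfl⟩
  · refine ((hS₁.sub hS₂).add ?_).I _
    rw [two_smul]; exact (hS₂.M _).add (hS₂.M _)
  · exact (hS₂.add ((hS₁.sub hS₂).M _)).I _
  · exact ((hS₂.M _).sub ((hS₁.sub hS₂).M _)).I _

/-- Waves of order `m` which are divergences are divergences of fluxes of order `m - 2`. -/
theorem isWave_solve_scalar (b : Bool) (hG : IsWave s (kv b) m G) (hd : IsDiv G) :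
    ∃ f₀ f₁, Sy s fast (m - 2) f₀ ∧ Sy s fast (m - 2) f₁ ∧ d e1 f₀ + d eη f₁ = G := by
  obtain ⟨f₀, f₁, h0, h1, h⟩ := isWave_solve_scalar_approx b hG
  obtain ⟨g₀, g₁, k0, k1, k⟩ := isWave_solve_scalar_approx b h
  have hE := (hd.sub ((isDiv_one f₀).add (isDiv_diag f₁))).sub
    ((isDiv_one g₀).add (isDiv_diag g₁))
  have hS := k.sy.le (m' := m - 2) (by linarith)
  refine ⟨f₀ + g₀ + I e1 _, f₁ + g₁ + I eη (M e1 _), (h0.add (k0.le (by linarith))).add (hS.I _),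
    (h1.add (k1.le (by linarith))).add ((hS.M _).I _), ?_⟩
  have key := antidiv_scalar hE
  simp only [map_add] at key ⊢
  linear_combination key

theorem isWave_solve_vector (b : Bool) (hG₁ : IsWave s (kv b) m G₁)
    (hG₂ : IsWave s (kv b) m G₂) (hd₁ : IsDiv G₁) (hd₂ : IsDiv G₂) :
    ∃ r₀ r₁ π, Sy s fast (m - 2) r₀ ∧ Sy s fast (m - 2) r₁ ∧ Sy s fast (m - 2) π ∧
      d e1 r₀ + d eη r₁ + d e1 π = G₁ ∧ d eη r₁ + d e2 π = G₂ := by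
  obtain ⟨r₀, r₁, π, h0, h1, h2, h, h'⟩ := isWave_solve_vector_approx b hG₁ hG₂
  obtain ⟨t₀, t₁, π', k0, k1, k2, k, k'⟩ := isWave_solve_vector_approx b h h'
  have hE := (hd₁.sub (((isDiv_one r₀).add (isDiv_diag r₁)).add (isDiv_one π))).sub
    (((isDiv_one t₀).add (isDiv_diag t₁)).add (isDiv_one π'))
  have hE' := (hd₂.sub ((isDiv_diag r₁).add (isDiv_two π))).sub
    ((isDiv_diag t₁).add (isDiv_two π'))
  have hS := k.sy.le (m' := m - 2) (by linarith)
  have hS' := k'.sy.le (m' := m - 2) (by linarith)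
  obtain ⟨u₀, u₁, π'', l0, l1, l2, a1, a2⟩ := antidiv_vector_sy hE hE' hS hS'
  refine ⟨r₀ + t₀ + u₀, r₁ + t₁ + u₁, π + π' + π'', (h0.add (k0.le (by linarith))).add l0,
    (h1.add (k1.le (by linarith))).add l1, (h2.add (k2.le (by linarith))).add l2, ?_, ?_⟩
  · simp only [map_add]; linear_combination a1
  · simp only [map_add]; linear_combination a2

end Solve

/-- Velocity, temperature, pressure, and the errors in the momentum and heat equations. -/
structure Fld (ι : Type) where
  v₁ : R ι
  v₂ : R ι
  θ : R ι
  p : R ι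
  r : Bool → R ι
  f : Bool → R ι

/-- The inviscid Boussinesq system in the `(y, z)` plane with errors. -/
structure Fld.IsSol {ι : Type} (S : Fld ι) : Prop where
  mom₁ : d e0 S.v₁ + d e1 (S.v₁ * S.v₁) + d e2 (S.v₁ * S.v₂) + d e1 S.p
    = d e1 (S.r false) + d eη (S.r true)
  mom₂ : d e0 S.v₂ + d e1 (S.v₁ * S.v₂) + d e2 (S.v₂ * S.v₂) + d e2 S.p
    = S.θ + d eη (S.r true)
  heat : d e0 S.θ + d e1 (S.v₁ * S.θ) + d e2 (S.v₂ * S.θ) = d e1 (S.f false) + d eη (S.f true)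
  div : d e1 S.v₁ + d e2 S.v₂ = 0

section WaveStep

variable {ι : Type} {s : Scale ι} {k : ℤ × ℤ} {v₁ v₂ : R ι}

theorem osc_mul_of_eq {k k' l l' : ℤ × ℤ} (e : k + k' = l) (e' : k - k' = l') (h h' : R ι) :
    osc s k h 0 * osc s k' h' 0
      = con (1 / 2) * (osc s l (h + h') 0 + osc s l' (h - h') 0) := by
  rw [osc_mul, e, e', add_zero, sub_zero]

theorem osc_sq {k l : ℤ × ℤ} (e : k + k = l) (h : R ι) :
    osc s k h 0 * osc s k h 0 = con (1 / 2) * (osc s l (h + h) 0 + 1) := by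
  rw [osc_mul_of_eq e (l' := (0, 0)) (by rw [sub_self]; rfl), sub_self, osc_zero]

/-- The low frequency part of a product of two sums of waves. -/
theorem wave_mul {a a' b b' h h' : R ι} (ha : Sy s sym 0 a) (ha' : Sy s sym 0 a')
    (hb : Sy s sym 0 b) (hb' : Sy s sym 0 b') (hh : Sy s sym 0 h) (hh' : Sy s sym 0 h')
    (k : ℤ × ℤ) : ∃ H, IsWave s k 0 H ∧
      (a * osc s ((1 : ℤ) * k.1, (1 : ℤ) * k.2) h 0 + a' * osc s ((2 : ℤ) * k.1, (2 : ℤ) * k.2) h' 0)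
      * (b * osc s ((1 : ℤ) * k.1, (1 : ℤ) * k.2) h 0 + b' * osc s ((2 : ℤ) * k.1, (2 : ℤ) * k.2) h' 0)
      = con (1 / 2) * (a * b + a' * b') + H := by
  have e1 := osc_sq (s := s) (k := ((1 : ℤ) * k.1, (1 : ℤ) * k.2))
    (l := ((2 : ℤ) * k.1, (2 : ℤ) * k.2)) (by ext <;> simp <;> ring) h
  have e2 := osc_sq (s := s) (k := ((2 : ℤ) * k.1, (2 : ℤ) * k.2))
    (l := ((4 : ℤ) * k.1, (4 : ℤ) * k.2)) (by ext <;> simp <;> ring) h'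
  have e3 := osc_mul_of_eq (s := s) (k := ((1 : ℤ) * k.1, (1 : ℤ) * k.2))
    (k' := ((2 : ℤ) * k.1, (2 : ℤ) * k.2)) (l := ((3 : ℤ) * k.1, (3 : ℤ) * k.2))
    (l' := ((-1 : ℤ) * k.1, (-1 : ℤ) * k.2)) (by ext <;> simp <;> ring)
    (by ext <;> simp <;> ring) h h'
  have hm : ∀ {x y : R ι}, Sy s sym 0 x → Sy s sym 0 y → Sy s sym 0 (x * y) :=
    fun hx hy => hx.mul_of_eq hy (zero_add _)
  have hab := (hm ha hb).const_mul (1 / 2)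
  have hab' := (hm ha' hb').const_mul (1 / 2)
  have hx := ((hm ha hb').add (hm ha' hb)).const_mul (1 / 2)
  refine ⟨_, (((IsWave.base 2 0 (by norm_num) hab (hh.add hh)).add
    (.base 4 0 (by norm_num) hab' (hh'.add hh'))).add
    (.base 3 0 (by norm_num) hx (hh.add hh'))).add (.base (-1) 0 (by norm_num) hx (hh.sub hh')), ?_⟩
  rw [← con]
  linear_combination a * b * e1 + a' * b' * e2 + (a * b' + a' * b) * e3

/-- The potential of a transported wave. -/
theorem exists_potential (h₁ : Sy s low 0 v₁) (h₂ : Sy s low 0 v₂) {A h B : R ι} {n : ℤ}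
    (hn : n ≠ 0) (hA : Sy s sym 0 A) (hh : Sy s sym 0 h) (hB : Sy s sym 1 B)
    (e : A * (con n * mu s 2 * (con k.1 * v₁ + con k.2 * v₂) + mu s 1 * mat v₁ v₂ h) = B) :
    ∃ Ψ, IsWave s k (-2) Ψ ∧ IsWave s k (-1) (mat v₁ v₂ Ψ) ∧
      IsWave s k (-1) (d e1 Ψ - con k.1 * (A * osc s (n * k.1, n * k.2) h 0)) ∧
      IsWave s k (-1) (d e2 Ψ - con k.2 * (A * osc s (n * k.1, n * k.2) h 0)) ∧
      ∀ Y, Y * A = 0 → Y * Ψ = 0 := by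
  have hP : Sy s sym (-2) (con (1 / n) * mu s (-2) * A) := IsWave.sy_potential hA
  have hQ : Sy s sym (-2 + 1) (con (1 / n) * mu s (-2) * B) :=
    (IsWave.sy_potential hB).le (by norm_num)
  obtain ⟨a1, a2⟩ := IsWave.parametrix_base (k := k) hn hA hh 0
  refine ⟨_, .base n (0 - Real.pi / 2) hn hP hh, ?_, a1, a2, fun Y hY => ?_⟩
  · exact (isWave_mat h₁ h₂ hn hP hh hQ (by rw [← e]; ring)).le (by norm_num)
  · linear_combination (con (1 / n) * mu s (-2)
      * osc s (n * k.1, n * k.2) h (0 - Real.pi / 2)) * hY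

/-- Amplitudes and phase corrections of a pair of transported waves. -/
structure Slices (s : Scale ι) (k : ℤ × ℤ) (v₁ v₂ h h' a a' : R ι) : Prop where
  sh : Sy s sym 0 h
  sh' : Sy s sym 0 h'
  sa : Sy s sym 0 a
  sa' : Sy s sym 0 a'
  tr : Sy s sym 1 (a * (con (1 : ℤ) * mu s 2 * (con k.1 * v₁ + con k.2 * v₂)
    + mu s 1 * mat v₁ v₂ h))
  tr' : Sy s sym 1 (a' * (con (2 : ℤ) * mu s 2 * (con k.1 * v₁ + con k.2 * v₂)
    + mu s 1 * mat v₁ v₂ h'))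

/-- The leading part of a sum of two waves. -/
def lead (s : Scale ι) (k : ℤ × ℤ) (h h' a a' : R ι) : R ι :=
  a * osc s ((1 : ℤ) * k.1, (1 : ℤ) * k.2) h 0 + a' * osc s ((2 : ℤ) * k.1, (2 : ℤ) * k.2) h' 0

variable {h h' a a' b b' : R ι}

theorem Slices.sy_lead (H : Slices s k v₁ v₂ h h' a a') : Sy s fast 0 (lead s k h h' a a') :=
  (H.sa.fast.mul_of_eq (sy_osc _ H.sh _) (zero_add _)).add
    (H.sa'.fast.mul_of_eq (sy_osc _ H.sh' _) (zero_add _))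

theorem Slices.exists_potential (h₁ : Sy s low 0 v₁) (h₂ : Sy s low 0 v₂)
    (H : Slices s k v₁ v₂ h h' a a') :
    ∃ Ψ, IsWave s k (-2) Ψ ∧ IsWave s k (-1) (mat v₁ v₂ Ψ) ∧
      IsWave s k (-1) (d e1 Ψ - con k.1 * lead s k h h' a a') ∧
      IsWave s k (-1) (d e2 Ψ - con k.2 * lead s k h h' a a') ∧
      ∀ Y, Y * a = 0 → Y * a' = 0 → Y * Ψ = 0 := by
  obtain ⟨Ψ, A1, A2, A3, A4, A5⟩ :=
    Boussinesq.exists_potential h₁ h₂ (one_ne_zero) H.sa H.sh H.tr rfl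
  obtain ⟨Φ, B1, B2, B3, B4, B5⟩ :=
    Boussinesq.exists_potential h₁ h₂ (two_ne_zero) H.sa' H.sh' H.tr' rfl
  refine ⟨Ψ + Φ, A1.add B1, by rw [mat_add]; exact A2.add B2, ?_, ?_, fun Y h1 h2 => ?_⟩
  · rw [map_add, lead, mul_add, add_sub_add_comm]; exact A3.add B3
  · rw [map_add, lead, mul_add, add_sub_add_comm]; exact A4.add B4
  · rw [mul_add, A5 Y h1, B5 Y h2, add_zero]

theorem d_mat (u : Pt) (v₁ v₂ F : R ι) :
    d u (mat v₁ v₂ F) = mat v₁ v₂ (d u F) + d u v₁ * d e1 F + d u v₂ * d e2 F := by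
  simp only [mat, map_add, d_mul, d_comm u]; ring

/-- Derivatives of transported potentials. -/
theorem isWave_mat_d (h₁ : Sy s low 0 v₁) (h₂ : Sy s low 0 v₂) {Ψ : R ι}
    (hΨ : IsWave s k (-2) Ψ) (hm : IsWave s k (-1) (mat v₁ v₂ Ψ)) (j : Fin 3) :
    IsWave s k 1 (mat v₁ v₂ (d (bas j) Ψ)) := by
  have e : mat v₁ v₂ (d (bas j) Ψ) = d (bas j) (mat v₁ v₂ Ψ)
      - (d (bas j) v₁ * d e1 Ψ + d (bas j) v₂ * d e2 Ψ) := by rw [d_mat]; ring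
  rw [e]
  refine ((hm.d j).le (by norm_num)).sub (IsWave.le (m := 0) ?_ zero_le_one)
  exact ((hΨ.d 1).mul_sym_of_eq (h₁.d_low j).sym (by norm_num)).add
    ((hΨ.d 2).mul_sym_of_eq (h₂.d_low j).sym (by norm_num))

end WaveStep

/-- The direction in which waves are polarised. -/
def dir : Bool → Pt
  | false => e1
  | true => eη

section WaveTheorem

variable {ι : Type} {s : Scale ι}

/-- The second component of the polarisation. -/
def pol (ι : Type) : Bool → R ι
  | false => 0
  | true => 1

theorem con_kv_fst (b : Bool) : (con (kv b).1 : R ι) = -pol ι b := by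
  cases b <;> simp [kv, pol]

theorem con_kv_snd (b : Bool) : (con (kv b).2 : R ι) = 1 := by
  cases b <;> simp [kv]

theorem d_dir (b : Bool) (F : R ι) : d (dir b) F = d e1 F + pol ι b * d e2 F := by
  cases b <;> simp [dir, pol, d_diag]

theorem pol_mul_pol (b : Bool) : pol ι b * pol ι b = pol ι b := by cases b <;> simp [pol]

@[simp] theorem d_pol (u : Pt) (b : Bool) : d u (pol ι b) = 0 := by cases b <;> simp [pol]

theorem sy_pol {c : Fin 3 → ℕ} (b : Bool) : Sy s c 0 (pol ι b) := by
  cases b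
  · exact .zero
  · exact .one

theorem isWave_d_dir {b : Bool} {m : ℤ} {G : R ι} (hG : IsWave s (kv b) m G) :
    IsWave s (kv b) (m + 1) (d (dir b) G) := by
  have := hG.d_front
  rw [con_kv_fst, con_kv_snd] at this
  rw [d_dir]
  convert this using 1
  ring

theorem isDiv_dir (b : Bool) (F : R ι) : IsDiv (d (dir b) F) := by
  cases b
  · exact isDiv_one F
  · exact isDiv_diag F

/-- The error removed by a wave. -/
def killed (b : Bool) (T : R ι) : Bool → R ι := fun c => if c = b then T else 0

theorem d_killed (b : Bool) (T : R ι) :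
    d e1 (killed b T false) + d eη (killed b T true) = d (dir b) T := by
  cases b <;> simp [killed, dir]

theorem d_killed_true (b : Bool) (T : R ι) :
    d eη (killed b T true) = pol ι b * d (dir b) T := by
  cases b <;> simp [killed, dir, pol]

theorem sy_mul_sub_mul {F G F₀ G₀ : R ι} (hF : Sy s fast 0 F) (hG₀ : Sy s fast 0 G₀)
    (h : Sy s fast (-1) (F - F₀)) (h' : Sy s fast (-1) (G - G₀)) :
    Sy s fast (-1) (F * G - F₀ * G₀) := by
  have e : F * G - F₀ * G₀ = F * (G - G₀) + (F - F₀) * G₀ := by ring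
  rw [e]
  exact (hF.mul_of_eq h' (by norm_num)).add (h.mul_of_eq hG₀ (by norm_num))

/-- The algebra behind the addition of waves. -/
theorem Fld.IsSol.add_wave {S : Fld ι} (hS : S.IsSol) (b : Bool)
    {w₁ w₂ ϑ w t P T T' L L' r₀ r₁ π f₀ f₁ : R ι} (hP : d e1 P = 0) (hP' : d e2 P = 0)
    (eL : w * w = P - T + L) (eL' : w * t = -T' + L') (hw : d e1 w₁ + d e2 w₂ = 0)
    (h₁ : d e1 r₀ + d eη r₁ + d e1 π = d e0 w₁ + d e1 (2 * S.v₁ * w₁)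
      + d e2 (S.v₁ * w₂ + w₁ * S.v₂) + d (dir b) L)
    (h₂ : d eη r₁ + d e2 π = d e0 w₂ + d e1 (S.v₁ * w₂ + w₁ * S.v₂)
      + d e2 (2 * S.v₂ * w₂) + d (dir b) (pol ι b * L) - ϑ)
    (h₃ : d e1 f₀ + d eη f₁ = d e0 ϑ + d e1 (S.v₁ * ϑ + w₁ * S.θ)
        + d e2 (S.v₂ * ϑ + w₂ * S.θ) + d (dir b) L') :
    Fld.IsSol ⟨S.v₁ + w₁, S.v₂ + w₂, S.θ + ϑ,
      S.p + (-π - (w₂ * w₂ - pol ι b * w * (pol ι b * w) - (w₁ * w₂ - w * (pol ι b * w)))),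
      fun l => S.r l - killed b T l + (if l then r₁ + (w₁ * w₂ - w * (pol ι b * w))
        else r₀ + ((w₁ * w₁ - w * w) - (w₂ * w₂ - pol ι b * w * (pol ι b * w)))),
      fun l => S.f l - killed b T' l + (if l then f₁ + (w₂ * ϑ - pol ι b * w * t)
        else f₀ + ((w₁ * ϑ - w * t) - (w₂ * ϑ - pol ι b * w * t)))⟩ := by
  have q : pol ι b * w * (pol ι b * w) = pol ι b * (P - T + L) := by
    rw [← eL]; linear_combination (w * w) * pol_mul_pol b
  have q' : w * (pol ι b * w) = pol ι b * (P - T + L) := by rw [← eL]; ring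
  have q'' : pol ι b * w * t = pol ι b * (-T' + L') := by rw [← eL']; ring
  have dp : ∀ (u : Pt) (F : R ι), d u (pol ι b * F) = pol ι b * d u F := fun u F => by
    rw [d_mul, d_pol, zero_mul, zero_add]
  have m₁ := hS.mom₁
  have m₂ := hS.mom₂
  have m₃ := hS.heat
  have m₄ := hS.div
  have pp := pol_mul_pol (ι := ι) b
  have k := d_killed b T
  have k' := d_killed_true b T
  have l := d_killed b T'
  have x1 : (S.v₁ + w₁) * (S.v₁ + w₁) = S.v₁ * S.v₁ + 2 * S.v₁ * w₁ + w₁ * w₁ := by ring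
  have x2 : (S.v₁ + w₁) * (S.v₂ + w₂) = S.v₁ * S.v₂ + (S.v₁ * w₂ + w₁ * S.v₂) + w₁ * w₂ := by
    ring
  have x3 : (S.v₂ + w₂) * (S.v₂ + w₂) = S.v₂ * S.v₂ + 2 * S.v₂ * w₂ + w₂ * w₂ := by ring
  have x4 : (S.v₁ + w₁) * (S.θ + ϑ) = S.v₁ * S.θ + (S.v₁ * ϑ + w₁ * S.θ) + w₁ * ϑ := by ring
  have x5 : (S.v₂ + w₂) * (S.θ + ϑ) = S.v₂ * S.θ + (S.v₂ * ϑ + w₂ * S.θ) + w₂ * ϑ := by ring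
  simp only [d_dir, d_diag, dp, map_add] at h₁ h₂ h₃ k k' l m₁ m₂ m₃
  refine ⟨?_, ?_, ?_, ?_⟩
  · simp only [x1, x2, q, q', eL, if_true, Bool.false_eq_true, if_false, map_add, map_sub,
      map_neg, dp, d_diag, hP, hP']
    linear_combination m₁ - h₁ + k
  · simp only [x2, x3, q, q', eL, if_true, map_add, map_sub,
      map_neg, dp, d_diag, hP, hP']
    linear_combination m₂ - h₂ + k' + (d e2 T - d e2 L) * pp
  · simp only [x4, x5, q'', eL', if_true, Bool.false_eq_true, if_false, map_add, map_sub,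
      map_neg, dp, d_diag]
    linear_combination m₃ - h₃ + l
  · simp only [map_add]
    linear_combination m₄ + hw

/-- Adding waves to a solution replaces the errors `T` and `T'` by errors of order `-1`. -/
theorem wave_step (S : Fld ι) (hS : S.IsSol) (b : Bool) (h₁ : Sy s low 0 S.v₁)
    (h₂ : Sy s low 0 S.v₂) (h₃ : Sy s low 0 S.θ) {h h' a a' c c' P T T' : R ι}
    (H : Slices s (kv b) S.v₁ S.v₂ h h' a a') (H' : Slices s (kv b) S.v₁ S.v₂ h h' c c')
    (hP : d e1 P = 0) (hP' : d e2 P = 0)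
    (hT : con (1 / 2) * (a * a + a' * a') = P - T)
    (hT' : con (1 / 2) * (a * c + a' * c') = -T') :
    ∃ (w₁ w₂ ϑ π : R ι) (E F : Bool → R ι),
      Fld.IsSol ⟨S.v₁ + w₁, S.v₂ + w₂, S.θ + ϑ, S.p + π,
        fun l => S.r l - killed b T l + E l, fun l => S.f l - killed b T' l + F l⟩ ∧
      Sy s fast (-1) (w₁ - lead s (kv b) h h' a a') ∧
      Sy s fast (-1) (w₂ - pol ι b * lead s (kv b) h h' a a') ∧
      Sy s fast (-1) (ϑ - lead s (kv b) h h' c c') ∧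
      Sy s fast (-1) π ∧ (∀ l, Sy s fast (-1) (E l)) ∧ (∀ l, Sy s fast (-1) (F l)) ∧
      ∀ Y, d e1 Y = 0 → d e2 Y = 0 → Y * a = 0 → Y * a' = 0 → Y * c = 0 → Y * c' = 0 →
        Y * w₁ = 0 ∧ Y * w₂ = 0 ∧ Y * ϑ = 0 := by
  obtain ⟨Ψ, p0, p1, p2, p3, p4⟩ := H.exists_potential h₁ h₂
  obtain ⟨Ξ, x0, x1, x2, x3, x4⟩ := H'.exists_potential h₁ h₂
  obtain ⟨L, hL, eL⟩ := wave_mul H.sa H.sa' H.sa H.sa' H.sh H.sh' (kv b)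
  obtain ⟨L', hL', eL'⟩ := wave_mul H.sa H.sa' H'.sa H'.sa' H.sh H.sh' (kv b)
  rw [hT] at eL
  rw [hT'] at eL'
  change lead s (kv b) h h' a a' * lead s (kv b) h h' a a' = _ at eL
  change lead s (kv b) h h' a a' * lead s (kv b) h h' c c' = _ at eL'
  have l0 := H.sy_lead
  have t0 := H'.sy_lead
  set w := lead s (kv b) h h' a a'
  set t := lead s (kv b) h h' c c'
  have hw₁ : Sy s fast (-1) (d e2 Ψ - w) := by
    have := p3.sy; rwa [con_kv_snd, one_mul] at this
  have hw₂ : Sy s fast (-1) (-d e1 Ψ - pol ι b * w) := by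
    have := p2.sy.neg; rw [con_kv_fst] at this
    convert this using 1; ring
  have ht : Sy s fast (-1) (d e2 Ξ - t) := by
    have := x3.sy; rwa [con_kv_snd, one_mul] at this
  have k1 : IsWave s (kv b) 0 (d e2 Ψ) := p0.d 2
  have k2 : IsWave s (kv b) 0 (d e1 Ψ) := p0.d 1
  have k3 : IsWave s (kv b) 0 (d e2 Ξ) := x0.d 2
  have lw : Sy s fast 0 (pol ι b * w) := (sy_pol b).mul_of_eq l0 (zero_add _)
  have ss : ∀ {F : R ι} (j : Fin 3), Sy s low 0 F → Sy s sym 0 (d (bas j) F) :=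
    fun j hF => (hF.d_low j).sym
  have hdiv := hS.div
  have hdw : d e1 (d e2 Ψ) + d e2 (-d e1 Ψ) = 0 := by rw [map_neg, d_comm e1 e2]; ring
  have two : ∀ u, d u (2 : R ι) = 0 := fun u => d_ofNat u 2
  have W₁ : IsWave s (kv b) 1 (d e0 (d e2 Ψ) + d e1 (2 * S.v₁ * d e2 Ψ)
      + d e2 (S.v₁ * (-d e1 Ψ) + d e2 Ψ * S.v₂) + d (dir b) L) := by
    have e : d e0 (d e2 Ψ) + d e1 (2 * S.v₁ * d e2 Ψ)
        + d e2 (S.v₁ * -d e1 Ψ + d e2 Ψ * S.v₂) + d (dir b) L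
        = mat S.v₁ S.v₂ (d e2 Ψ) + (d e1 S.v₁ * d e2 Ψ - d e2 S.v₁ * d e1 Ψ) + d (dir b) L := by
      simp only [mat, map_add, map_neg, d_mul, two]
      linear_combination (d e2 Ψ) * hdiv + S.v₁ * d_comm e1 e2 Ψ
    rw [e]
    exact ((isWave_mat_d h₁ h₂ p0 p1 2).add (((k1.mul_sym_of_eq (ss 1 h₁) (zero_add _)).sub
      (k2.mul_sym_of_eq (ss 2 h₁) (zero_add _))).le zero_le_one)).add (isWave_d_dir hL)
  have W₂ : IsWave s (kv b) 1 (d e0 (-d e1 Ψ) + d e1 (S.v₁ * (-d e1 Ψ) + d e2 Ψ * S.v₂)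
      + d e2 (2 * S.v₂ * (-d e1 Ψ)) + d (dir b) (pol ι b * L) - d e2 Ξ) := by
    have e : d e0 (-d e1 Ψ) + d e1 (S.v₁ * -d e1 Ψ + d e2 Ψ * S.v₂)
        + d e2 (2 * S.v₂ * -d e1 Ψ) + d (dir b) (pol ι b * L) - d e2 Ξ
        = -mat S.v₁ S.v₂ (d e1 Ψ) + (d e1 S.v₂ * d e2 Ψ - d e2 S.v₂ * d e1 Ψ)
          + pol ι b * d (dir b) L - d e2 Ξ := by
      simp only [mat, map_add, map_neg, d_mul, two, d_pol]
      linear_combination (-d e1 Ψ) * hdiv + S.v₂ * d_comm e1 e2 Ψ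
    rw [e]
    exact (((isWave_mat_d h₁ h₂ p0 p1 1).neg.add (((k1.mul_sym_of_eq (ss 1 h₂) (zero_add _)).sub
      (k2.mul_sym_of_eq (ss 2 h₂) (zero_add _))).le zero_le_one)).add
        ((isWave_d_dir hL).mul_sym_of_eq (sy_pol b) (zero_add _))).sub (k3.le zero_le_one)
  have W₃ : IsWave s (kv b) 1 (d e0 (d e2 Ξ) + d e1 (S.v₁ * d e2 Ξ + d e2 Ψ * S.θ)
      + d e2 (S.v₂ * d e2 Ξ + (-d e1 Ψ) * S.θ) + d (dir b) L') := by
    have e : d e0 (d e2 Ξ) + d e1 (S.v₁ * d e2 Ξ + d e2 Ψ * S.θ)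
        + d e2 (S.v₂ * d e2 Ξ + -d e1 Ψ * S.θ) + d (dir b) L'
        = mat S.v₁ S.v₂ (d e2 Ξ) + (d e1 S.θ * d e2 Ψ - d e2 S.θ * d e1 Ψ) + d (dir b) L' := by
      simp only [mat, map_add, map_neg, d_mul]
      linear_combination (d e2 Ξ) * hdiv + S.θ * d_comm e1 e2 Ψ
    rw [e]
    exact ((isWave_mat_d h₁ h₂ x0 x1 2).add (((k1.mul_sym_of_eq (ss 1 h₃) (zero_add _)).sub
      (k2.mul_sym_of_eq (ss 2 h₃) (zero_add _))).le zero_le_one)).add (isWave_d_dir hL')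
  have D₁ : IsDiv (d e0 (d e2 Ψ) + d e1 (2 * S.v₁ * d e2 Ψ)
      + d e2 (S.v₁ * (-d e1 Ψ) + d e2 Ψ * S.v₂) + d (dir b) L) := by
    rw [d_comm e0 e2]
    exact (((isDiv_two _).add (isDiv_one _)).add (isDiv_two _)).add (isDiv_dir b _)
  have D₂ : IsDiv (d e0 (-d e1 Ψ) + d e1 (S.v₁ * (-d e1 Ψ) + d e2 Ψ * S.v₂)
      + d e2 (2 * S.v₂ * (-d e1 Ψ)) + d (dir b) (pol ι b * L) - d e2 Ξ) := by
    rw [map_neg, d_comm e0 e1, ← map_neg]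
    exact ((((isDiv_one _).add (isDiv_one _)).add (isDiv_two _)).add (isDiv_dir b _)).sub
      (isDiv_two _)
  have D₃ : IsDiv (d e0 (d e2 Ξ) + d e1 (S.v₁ * d e2 Ξ + d e2 Ψ * S.θ)
      + d e2 (S.v₂ * d e2 Ξ + (-d e1 Ψ) * S.θ) + d (dir b) L') := by
    rw [d_comm e0 e2]
    exact (((isDiv_two _).add (isDiv_one _)).add (isDiv_two _)).add (isDiv_dir b _)
  obtain ⟨r₀, r₁, π, s0, s1, s2, s3, s4⟩ := isWave_solve_vector b W₁ W₂ D₁ D₂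
  obtain ⟨f₀, f₁, s0', s1', s3'⟩ := isWave_solve_scalar b W₃ D₃
  have q11 := sy_mul_sub_mul k1.sy l0 hw₁ hw₁
  have q12 := sy_mul_sub_mul k1.sy lw hw₁ hw₂
  have q22 := sy_mul_sub_mul k2.sy.neg lw hw₂ hw₂
  have q1 := sy_mul_sub_mul k1.sy t0 hw₁ ht
  have q2 := sy_mul_sub_mul k2.sy.neg t0 hw₂ ht
  refine ⟨d e2 Ψ, -d e1 Ψ, d e2 Ξ,
    -π - ((-d e1 Ψ) * (-d e1 Ψ) - pol ι b * w * (pol ι b * w)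
      - (d e2 Ψ * (-d e1 Ψ) - w * (pol ι b * w))),
    fun l => if l then r₁ + (d e2 Ψ * (-d e1 Ψ) - w * (pol ι b * w))
      else r₀ + ((d e2 Ψ * d e2 Ψ - w * w)
        - ((-d e1 Ψ) * (-d e1 Ψ) - pol ι b * w * (pol ι b * w))),
    fun l => if l then f₁ + ((-d e1 Ψ) * d e2 Ξ - pol ι b * w * t)
      else f₀ + ((d e2 Ψ * d e2 Ξ - w * t) - ((-d e1 Ψ) * d e2 Ξ - pol ι b * w * t)),
    hS.add_wave b hP hP' eL eL' hdw s3 s4 s3',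
    hw₁, hw₂, ht, s2.neg.sub (q22.sub q12), ?_, ?_, ?_⟩
  · rintro (_ | _)
    · exact s0.add (q11.sub q22)
    · exact s1.add q12
  · rintro (_ | _)
    · exact s0'.add (q1.sub q2)
    · exact s1'.add q2
  · intro Y y1 y2 y3 y4 y5 y6
    have z1 := p4 Y y3 y4
    have z2 := x4 Y y5 y6
    have aux : ∀ (u : Pt) (F : R ι), d u Y = 0 → Y * F = 0 → Y * d u F = 0 := by
      intro u F e e'
      have := d_mul u Y F
      rw [e', e, map_zero, zero_mul, zero_add] at this
      exact this.symm
    exact ⟨aux _ _ y2 z1, by linear_combination -(aux _ _ y1 z1), aux _ _ y2 z2⟩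

end WaveTheorem

section Profiles

theorem BS.of_periodic {g : ℝ → ℝ} (hg : ContDiff ℝ (⊤ : ℕ∞) g)
    (hp : Function.Periodic g (2 * Real.pi)) : BS g := by
  refine ⟨hg, fun n => ?_⟩
  have hc : Continuous (iteratedDeriv n g) := hg.continuous_iteratedDeriv n (by exact_mod_cast le_top)
  have hper : Function.Periodic (iteratedDeriv n g) (2 * Real.pi) := by
    intro x
    have h := iteratedDeriv_comp_add_const n g (2 * Real.pi)
    rw [show (fun z => g (z + 2 * Real.pi)) = g from funext hp] at h
    exact (congrFun h x).symm
  obtain ⟨C, hC⟩ := (isCompact_Icc (a := 0) (b := 2 * Real.pi)).exists_bound_of_continuousOn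
    hc.continuousOn
  refine ⟨C, fun x => ?_⟩
  obtain ⟨y, hy, e⟩ := hper.exists_mem_Ico₀ Real.two_pi_pos x
  rw [e]
  exact hC y (Set.Ico_subset_Icc_self hy)

theorem bs_smoothTransition : BS Real.smoothTransition := by
  have hs : ContDiff ℝ (⊤ : ℕ∞) Real.smoothTransition := Real.smoothTransition.contDiff
  refine ⟨hs, fun n => ?_⟩
  cases n with
  | zero =>
    refine ⟨1, fun x => ?_⟩
    rw [iteratedDeriv_zero, abs_of_nonneg (Real.smoothTransition.nonneg x)]
    exact Real.smoothTransition.le_one x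
  | succ n =>
    have hc : Continuous (iteratedDeriv (n + 1) Real.smoothTransition) :=
      hs.continuous_iteratedDeriv _ (by exact_mod_cast le_top)
    obtain ⟨C, hC⟩ := (isCompact_Icc (a := (0 : ℝ)) (b := 1)).exists_bound_of_continuousOn
      hc.continuousOn
    have hC0 : 0 ≤ C := (norm_nonneg _).trans (hC 0 ⟨le_rfl, zero_le_one⟩)
    have key : ∀ (c x : ℝ), Real.smoothTransition =ᶠ[nhds x] (fun _ => c) →
        iteratedDeriv (n + 1) Real.smoothTransition x = 0 := by
      intro c x h
      rw [h.iteratedDeriv_eq]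
      simp [iteratedDeriv_const]
    refine ⟨C, fun x => ?_⟩
    rcases lt_or_ge x 0 with h | h
    · rw [key 0 x]
      · simpa using hC0
      · filter_upwards [Iio_mem_nhds h] with y hy
        exact Real.smoothTransition.zero_of_nonpos hy.le
    · rcases lt_or_ge 1 x with h' | h'
      · rw [key 1 x]
        · simpa using hC0
        · filter_upwards [Ioi_mem_nhds h'] with y hy
          exact Real.smoothTransition.one_of_one_le hy.le
      · exact hC x ⟨h, h'⟩

/-- The angle whose sine and cosine are the partition of time. -/
def angle (x : ℝ) : ℝ := Real.pi / 2 * Real.smoothTransition (Real.cos x + 1 / 2)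

/-- The even time profile. -/
def chiE (x : ℝ) : ℝ := Real.sin (angle x)

/-- The odd time profile. -/
def chiO (x : ℝ) : ℝ := Real.cos (angle x)

theorem contDiff_angle : ContDiff ℝ (⊤ : ℕ∞) angle :=
  contDiff_const.mul (Real.smoothTransition.contDiff.comp (Real.contDiff_cos.add contDiff_const))

theorem angle_periodic : Function.Periodic angle (2 * Real.pi) := fun x => by
  simp [angle, Real.cos_add_two_pi]

theorem bs_chiE : BS chiE :=
  .of_periodic (Real.contDiff_sin.comp contDiff_angle) fun x => by simp [chiE, angle_periodic x]

theorem bs_chiO : BS chiO :=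
  .of_periodic (Real.contDiff_cos.comp contDiff_angle) fun x => by simp [chiO, angle_periodic x]

theorem chiE_eq_zero {x : ℝ} (h : Real.cos x ≤ -(1 / 2)) : chiE x = 0 := by
  rw [chiE, angle, Real.smoothTransition.zero_of_nonpos (by linarith)]; simp

theorem chiO_eq_zero {x : ℝ} (h : 1 / 2 ≤ Real.cos x) : chiO x = 0 := by
  rw [chiO, angle, Real.smoothTransition.one_of_one_le (by linarith)]; simp

/-- A positive function equal to `1 + c` for `c ≥ -1/2`. -/
def denom (c : ℝ) : ℝ := 1 + c + (1 - Real.smoothTransition (2 * c + 2))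

theorem denom_eq {c : ℝ} (h : -(1 / 2) ≤ c) : denom c = 1 + c := by
  rw [denom, Real.smoothTransition.one_of_one_le (by linarith)]; ring

theorem denom_pos {c : ℝ} (h : -1 ≤ c) : 0 < denom c := by
  rcases h.eq_or_lt with rfl | h
  · rw [denom, Real.smoothTransition.zero_of_nonpos (by norm_num)]; norm_num
  · have := Real.smoothTransition.le_one (2 * c + 2)
    rw [denom]; linarith

/-- A periodic function with derivative one where the even profile lives. -/
def clockE (x : ℝ) : ℝ := 2 * Real.arctan (Real.sin x / denom (Real.cos x))

/-- A periodic function with derivative one where the odd profile lives. -/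
def clockO (x : ℝ) : ℝ := clockE (x + Real.pi)

theorem contDiff_clockE : ContDiff ℝ (⊤ : ℕ∞) clockE := by
  have hd : ContDiff ℝ (⊤ : ℕ∞) denom :=
    (contDiff_const.add contDiff_id).add (contDiff_const.sub
      (Real.smoothTransition.contDiff.comp ((contDiff_const.mul contDiff_id).add contDiff_const)))
  exact contDiff_const.mul (Real.contDiff_arctan.comp (Real.contDiff_sin.div
    (hd.comp Real.contDiff_cos) fun x => (denom_pos (Real.neg_one_le_cos x)).ne'))

theorem bs_clockE : BS clockE :=
  .of_periodic contDiff_clockE fun x => by simp [clockE]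

theorem bs_clockO : BS clockO :=
  .of_periodic (contDiff_clockE.comp (contDiff_id.add contDiff_const)) fun x => by
    simp only [clockO, clockE]
    rw [add_right_comm, Real.sin_add_two_pi, Real.cos_add_two_pi]

theorem deriv_clockE {x : ℝ} (h : -(1 / 2) < Real.cos x) : deriv clockE x = 1 := by
  have hev : clockE =ᶠ[nhds x] fun y => 2 * Real.arctan (Real.sin y / (1 + Real.cos y)) := by
    filter_upwards [Real.continuous_cos.continuousAt.eventually (lt_mem_nhds h)] with y hy
    rw [clockE, denom_eq hy.le]
  have hp : 1 + Real.cos x ≠ 0 := by linarith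
  have h1 := (((Real.hasDerivAt_sin x).div ((Real.hasDerivAt_cos x).const_add 1) hp).arctan).const_mul 2
  rw [hev.deriv_eq]
  refine h1.deriv.trans ?_
  have e := Real.sin_sq_add_cos_sq x
  have e2 : 1 + (Real.sin x / (1 + Real.cos x)) ^ 2 = 2 / (1 + Real.cos x) := by
    field_simp; nlinarith
  simp only [Pi.div_apply]
  rw [e2]
  field_simp
  nlinarith

theorem deriv_clockO {x : ℝ} (h : Real.cos x < 1 / 2) : deriv clockO x = 1 := by
  have : deriv clockO x = deriv clockE (x + Real.pi) := deriv_comp_add_const clockE Real.pi x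
  rw [this, deriv_clockE]
  rw [Real.cos_add_pi]; linarith

theorem chiE_mul (x : ℝ) : chiE x * deriv clockE x = chiE x := by
  rcases le_or_gt (Real.cos x) (-(1 / 2)) with h | h
  · rw [chiE_eq_zero h, zero_mul]
  · rw [deriv_clockE h, mul_one]

theorem chiO_mul (x : ℝ) : chiO x * deriv clockO x = chiO x := by
  rcases le_or_gt (1 / 2) (Real.cos x) with h | h
  · rw [chiO_eq_zero h, zero_mul]
  · rw [deriv_clockO h, mul_one]

end Profiles

section Amplitude

variable {ι : Type} {s : Scale ι} {v₁ v₂ : R ι}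

/-- Functions of `μ t`. -/
def clk (s : Scale ι) (g : ℝ → ℝ) (hg : BS g) : R ι :=
  timeF g hg (fun i => (s.μ i : ℝ)) fun _ => 0

theorem sy_clk (g : ℝ → ℝ) (hg : BS g) : Sy s sym 0 (clk s g hg) :=
  sy_timeF g hg _ _ (by simpa [sym] using s.num_zpow 1)

theorem d_timeF_one (g : ℝ → ℝ) (hg : BS g) (σ τ : ι → ℝ) : d e1 (timeF g hg σ τ) = 0 := by
  have : (fun i => σ i * e1.1) = 0 := by funext i; simp [e1, bas]
  rw [d_timeF, this, map_zero, zero_mul]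

theorem d_timeF_two (g : ℝ → ℝ) (hg : BS g) (σ τ : ι → ℝ) : d e2 (timeF g hg σ τ) = 0 := by
  have : (fun i => σ i * e2.1) = 0 := by funext i; simp [e2, bas]
  rw [d_timeF, this, map_zero, zero_mul]

theorem d_clk_zero (g : ℝ → ℝ) (hg : BS g) :
    d e0 (clk s g hg) = mu s 1 * clk s (deriv g) hg.deriv := by
  rw [clk, d_timeF]
  congr 2
  funext i; simp [e0, bas]

theorem sy_transport (h₁ : Sy s low 0 v₁) (h₂ : Sy s low 0 v₂) {A : R ι} (hA : Sy s sym 0 A)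
    (n : ℤ) (k : ℤ × ℤ) (g : ℝ → ℝ) (hg : BS g) (e : A * clk s (deriv g) hg.deriv = A) :
    Sy s sym 0 (con (-n) * (clk s g hg * (con k.1 * v₁ + con k.2 * v₂))) ∧
    Sy s sym 1 (A * (con n * mu s 2 * (con k.1 * v₁ + con k.2 * v₂)
      + mu s 1 * mat v₁ v₂ (con (-n) * (clk s g hg * (con k.1 * v₁ + con k.2 * v₂))))) := by
  have hW : Sy s low 0 (con k.1 * v₁ + con k.2 * v₂) :=
    ((sy_con _).mul_of_eq h₁ (zero_add _)).add ((sy_con _).mul_of_eq h₂ (zero_add _))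
  set W := con k.1 * v₁ + con k.2 * v₂
  have hc := sy_clk (s := s) g hg
  refine ⟨(sy_con _).mul_of_eq (hc.mul_of_eq hW.sym (zero_add _)) (zero_add _), ?_⟩
  have hm : Sy s low 0 (mat v₁ v₂ W) :=
    ((hW.d_low 0).add (h₁.mul_of_eq (hW.d_low 1) (zero_add _))).add
      (h₂.mul_of_eq (hW.d_low 2) (zero_add _))
  have key : A * (con n * mu s 2 * W + mu s 1 * mat v₁ v₂ (con (-n) * (clk s g hg * W)))
      = mu s 1 * (A * (con (-n) * (clk s g hg * mat v₁ v₂ W))) := by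
    have c1 : d e1 (clk s g hg) = 0 := d_timeF_one _ _ _ _
    have c2 : d e2 (clk s g hg) = 0 := d_timeF_two _ _ _ _
    have c3 : (mu s 1 : R ι) * mu s 1 = mu s 2 := by rw [mu_mul]; rfl
    have c4 : (con (-(n : ℝ)) : R ι) = -con n := map_neg cst _
    simp only [mat, d_mul, d_con, c1, c2, d_clk_zero, c4, map_neg]
    linear_combination -(con n * mu s 1 * mu s 1 * W) * e - con n * A * W * c3
  rw [key]
  exact (sy_mu 1).mul_of_eq (hA.mul_of_eq ((sy_con _).mul_of_eq
    (hc.mul_of_eq hm.sym (zero_add _)) (zero_add _)) (zero_add _)) (add_zero _)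

/-- Amplitudes removing the errors `T` and `T'`. -/
theorem exists_amplitudes (h₁ : Sy s low 0 v₁) (h₂ : Sy s low 0 v₂) (k : ℤ × ℤ) {T T' X : R ι}
    {δ : ι → ℝ} (hδ : ∀ i, 0 < δ i) (hδ1 : ∀ i, δ i ≤ 1) (hδK : ∀ i, 1 / δ i ≤ s.K i)
    (hT : Sy s low 0 T) (hT' : Sy s low 0 T') (hX : Sy s low 0 X)
    (bT : ∀ i q, |(T i).1 q| ≤ δ i) (bT' : ∀ i q, |(T' i).1 q| ≤ δ i)
    (bX : ∀ i q, |(X i).1 q| ≤ 1) (dX : d e1 X = 0) (dX' : d e2 X = 0) (xT : X * T = T)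
    (xT' : X * T' = T') :
    ∃ h h' a a' c c' P : R ι, Slices s k v₁ v₂ h h' a a' ∧ Slices s k v₁ v₂ h h' c c' ∧
      d e1 P = 0 ∧ d e2 P = 0 ∧ con (1 / 2) * (a * a + a' * a') = P - T ∧
      con (1 / 2) * (a * c + a' * c') = -T' ∧
      (∀ Y, Y * X = 0 → Y * a = 0 ∧ Y * a' = 0 ∧ Y * c = 0 ∧ Y * c' = 0) ∧
      ∀ i q, |(a i).1 q| ≤ 8 * √(δ i) ∧ |(a' i).1 q| ≤ 8 * √(δ i) ∧
        |(c i).1 q| ≤ 8 * √(δ i) ∧ |(c' i).1 q| ≤ 8 * √(δ i) := by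
  have hsq : ∀ i, √(δ i) * √(δ i) = δ i := fun i => Real.mul_self_sqrt (hδ i).le
  have hsp : ∀ i, 0 < √(δ i) := fun i => Real.sqrt_pos.2 (hδ i)
  have hs1 : ∀ i, √(δ i) ≤ 1 := fun i => Real.sqrt_le_one.2 (hδ1 i)
  have n1 : s.Num 0 fun i => √(δ i) :=
    ⟨1, 0, zero_le_one, fun i => by simpa [abs_of_pos (hsp i)] using hs1 i⟩
  have n2 : s.Num 0 fun i => 1 / δ i :=
    ⟨1, 1, zero_le_one, fun i => by
      simpa [abs_of_pos (hδ i)] using hδK i⟩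
  have n3 : s.Num 0 fun i => 1 / √(δ i) := by
    refine ⟨1, 1, zero_le_one, fun i => ?_⟩
    rw [abs_of_pos (one_div_pos.2 (hsp i))]
    have : 1 / √(δ i) ≤ 1 / δ i := by
      refine one_div_le_one_div_of_le (hδ i) ?_
      nlinarith [hsq i, hs1 i, hsp i]
    simpa using this.trans (hδK i)
  have hδ' : (cst (fun i => √(δ i)) : R ι) * cst (fun i => √(δ i)) * cst (fun i => 1 / δ i) = 1 := by
    rw [← map_mul, ← map_mul, ← map_one cst]
    congr 1; funext i
    change √(δ i) * √(δ i) * (1 / δ i) = 1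
    rw [hsq, mul_one_div_cancel (hδ i).ne']
  have hδ'' : (cst (fun i => √(δ i)) : R ι) * cst (fun i => 1 / √(δ i)) = 1 := by
    rw [← map_mul, ← map_one cst]
    congr 1; funext i
    exact mul_one_div_cancel (hsp i).ne'
  have half : (2 : R ι) * con (1 / 2) = 1 := by
    rw [show (2 : R ι) = con 2 from (map_ofNat cst 2).symm, con_mul]; norm_num
  have sF : Sy s low 0 (1 - con (1 / 2) * (cst (fun i => 1 / δ i) * T)) :=
    Sy.one.sub ((sy_con _).mul_of_eq ((Sy.cst n2).mul_of_eq hT (zero_add _)) (zero_add _))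
  have bF : ∀ i q, |((con (1 / 2) * (cst (fun i => 1 / δ i) * T) : R ι) i).1 q| ≤ 1 / 2 := by
    intro i q
    change |1 / 2 * (1 / δ i * (T i).1 q)| ≤ 1 / 2
    rw [abs_mul, abs_mul, abs_of_pos (one_div_pos.2 (hδ i)), abs_of_pos (by norm_num : (0 : ℝ) < 1 / 2)]
    have := mul_le_mul_of_nonneg_left (bT i q) (one_div_pos.2 (hδ i)).le
    rw [one_div_mul_cancel (hδ i).ne'] at this
    linarith
  obtain ⟨G, hG, bG⟩ := exists_invSqrt (1 - con (1 / 2) * (cst (fun i => 1 / δ i) * T)) fun i q => by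
    have := (abs_le.1 (bF i q)).2
    change 1 / 2 ≤ 1 - ((con (1 / 2) * (cst (fun i => 1 / δ i) * T) : R ι) i).1 q
    linarith
  have sG : Sy s low 0 G := sy_invSqrt hG ⟨2, 0, zero_le_two, fun i q => by
    simpa [abs_of_pos (bG i q).1] using (bG i q).2⟩ sF
  have bF' : ∀ i q, |((1 - con (1 / 2) * (cst (fun i => 1 / δ i) * T) : R ι) i).1 q| ≤ 3 / 2 := by
    intro i q
    have := abs_le.1 (bF i q)
    change |1 - ((con (1 / 2) * (cst (fun i => 1 / δ i) * T) : R ι) i).1 q| ≤ 3 / 2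
    rw [abs_le]; constructor <;> linarith
  have eF : cst (fun i => √(δ i)) * cst (fun i => √(δ i))
      * (1 - con (1 / 2) * (cst (fun i => 1 / δ i) * T))
      = cst (fun i => √(δ i)) * cst (fun i => √(δ i)) - con (1 / 2) * T := by
    linear_combination -(con (1 / 2) * T) * hδ'
  generalize (1 - con (1 / 2) * (cst (fun i => 1 / δ i) * T)) = F at *
  obtain ⟨σ, hσ⟩ : ∃ σ : R ι, σ = cst (fun i => √(δ i)) := ⟨_, rfl⟩
  obtain ⟨σ', hσ'⟩ : ∃ σ' : R ι, σ' = cst (fun i => 1 / √(δ i)) := ⟨_, rfl⟩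
  have sσ : Sy s low 0 σ := hσ ▸ Sy.cst n1
  have sσ' : Sy s low 0 σ' := hσ' ▸ Sy.cst n3
  have z : ∀ {c : Fin 3 → ℕ} {A B : R ι}, Sy s c 0 A → Sy s c 0 B → Sy s c 0 (A * B) :=
    fun h h' => h.mul_of_eq h' (zero_add _)
  rw [← hσ] at eF
  rw [← hσ, ← hσ'] at hδ''
  have sa : Sy s low 0 (con 2 * (X * (σ * (F * G)))) := z (sy_con _) (z hX (z sσ (z sF sG)))
  have sc : Sy s low 0 (-(X * (σ' * (T' * G)))) := (z hX (z sσ' (z hT' sG))).neg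
  have ba : ∀ i q, |((con 2 * (X * (σ * (F * G))) : R ι) i).1 q| ≤ 8 * √(δ i) := by
    intro i q
    have e : ((con 2 * (X * (σ * (F * G))) : R ι) i).1 q
      = 2 * ((X i).1 q * (√(δ i) * ((F i).1 q * (G i).1 q))) := by rw [hσ]; rfl
    rw [e, abs_mul, abs_mul, abs_mul, abs_mul, abs_two, abs_of_pos (hsp i), abs_of_pos (bG i q).1]
    have := bX i q
    have := bF' i q
    have := (bG i q).2
    have := (bG i q).1
    have := hsp i
    calc 2 * (|(X i).1 q| * (√(δ i) * (|(F i).1 q| * (G i).1 q)))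
        ≤ 2 * (1 * (√(δ i) * ((3 / 2) * 2))) := by gcongr
      _ ≤ _ := by linarith
  have bc : ∀ i q, |((-(X * (σ' * (T' * G))) : R ι) i).1 q| ≤ 8 * √(δ i) := by
    intro i q
    have e : ((-(X * (σ' * (T' * G))) : R ι) i).1 q
      = -((X i).1 q * (1 / √(δ i) * ((T' i).1 q * (G i).1 q))) := by rw [hσ']; rfl
    rw [e, abs_neg, abs_mul, abs_mul, abs_mul, abs_of_pos (one_div_pos.2 (hsp i)),
      abs_of_pos (bG i q).1]
    have := bX i q
    have := bT' i q
    have := (bG i q).2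
    have := (bG i q).1
    have := hsp i
    have := hδ i
    calc |(X i).1 q| * (1 / √(δ i) * (|(T' i).1 q| * (G i).1 q))
        ≤ 1 * (1 / √(δ i) * (δ i * 2)) := by gcongr
      _ = 2 * √(δ i) := by
        field_simp; nlinarith [hsq i]
      _ ≤ _ := by linarith
  have eaa : con 2 * (X * (σ * (F * G))) * (con 2 * (X * (σ * (F * G))))
      = 4 * (σ * σ * (X * X)) - 2 * T := by
    have : (con 2 : R ι) = 2 := map_ofNat cst 2
    rw [this]
    linear_combination (4 * X * X * σ * σ * F) * hG + 4 * X * X * eF - 2 * X * X * T * half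
      - 2 * (X + 1) * xT
  have eac : con 2 * (X * (σ * (F * G))) * (-(X * (σ' * (T' * G)))) = -(2 * T') := by
    have : (con 2 : R ι) = 2 := map_ofNat cst 2
    rw [this]
    linear_combination (-2 * X * X * σ * σ' * T') * hG - 2 * X * X * T' * hδ'' - 2 * (X + 1) * xT'
  have yX : ∀ Y, Y * X = 0 → Y * (con 2 * (X * (σ * (F * G)))) = 0 ∧
      Y * (-(X * (σ' * (T' * G)))) = 0 := fun Y hY => by
    constructor
    · linear_combination (con 2 * (σ * (F * G))) * hY
    · linear_combination (-(σ' * (T' * G))) * hY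
  have dPX : ∀ u, d u X = 0 → d u (con (1 / 2) * (4 * (σ * σ * (X * X)))) = 0 := fun u h => by
    have h4 : d u (4 : R ι) = 0 := d_ofNat u 4
    simp [d_mul, d_con, h4, h, hσ, d_cst]
  generalize con 2 * (X * (σ * (F * G))) = a at *
  generalize -(X * (σ' * (T' * G))) = c at *
  set E : R ι := clk s chiE bs_chiE with hE
  set O : R ι := clk s chiO bs_chiO with hO
  have sE : Sy s sym 0 E := sy_clk _ _
  have sO : Sy s sym 0 O := sy_clk _ _
  have eEO : E * E + O * O = 1 := by
    funext i; apply Subtype.ext; funext q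
    change chiE _ * chiE _ + chiO _ * chiO _ = 1
    simp only [chiE, chiO, ← sq, Real.sin_sq_add_cos_sq]
  have eE : E * clk s (deriv clockE) bs_clockE.deriv = E := by
    funext i; apply Subtype.ext; funext q
    exact chiE_mul _
  have eO : O * clk s (deriv clockO) bs_clockO.deriv = O := by
    funext i; apply Subtype.ext; funext q
    exact chiO_mul _
  have bE : ∀ (F : R ι), (∀ i q, |(F i).1 q| ≤ 8 * √(δ i)) →
      ∀ i q, |((E * F) i).1 q| ≤ 8 * √(δ i) ∧ |((O * F) i).1 q| ≤ 8 * √(δ i) := by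
    intro F hF i q
    have e1 : ∀ x y : ℝ, |x| ≤ 1 → |y| ≤ 8 * √(δ i) → |x * y| ≤ 8 * √(δ i) := fun x y hx hy => by
      rw [abs_mul]
      nlinarith [abs_nonneg x, abs_nonneg y]
    exact ⟨e1 _ _ (Real.abs_sin_le_one _) (hF i q), e1 _ _ (Real.abs_cos_le_one _) (hF i q)⟩
  have tE := fun {A : R ι} (hA : Sy s low 0 A) => sy_transport h₁ h₂ (z sE hA.sym) 1 k clockE
    bs_clockE (by linear_combination A * eE)
  have tO := fun {A : R ι} (hA : Sy s low 0 A) => sy_transport h₁ h₂ (z sO hA.sym) 2 k clockO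
    bs_clockO (by linear_combination A * eO)
  refine ⟨_, _, E * a, O * a, E * c, O * c, _,
    ⟨(tE sa).1, (tO sa).1, z sE sa.sym, z sO sa.sym, (tE sa).2, (tO sa).2⟩,
    ⟨(tE sa).1, (tO sa).1, z sE sc.sym, z sO sc.sym, (tE sc).2, (tO sc).2⟩,
    dPX _ dX, dPX _ dX', ?_, ?_, ?_, ?_⟩
  · linear_combination con (1 / 2) * eaa + con (1 / 2) * a * a * eEO - T * half
  · linear_combination con (1 / 2) * eac + con (1 / 2) * a * c * eEO - T' * half
  · intro Y hY
    obtain ⟨y1, y2⟩ := yX Y hY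
    exact ⟨by linear_combination E * y1, by linear_combination O * y1,
      by linear_combination E * y2, by linear_combination O * y2⟩
  · intro i q
    exact ⟨(bE a ba i q).1, (bE a ba i q).2, (bE c bc i q).1, (bE c bc i q).2⟩

end Amplitude

section Bounds

variable {ι : Type} {s : Scale ι} {F G : R ι} {a b : ι → ℝ}

/-- Uniform bounds for families of functions. -/
def AbsLe (F : R ι) (a : ι → ℝ) : Prop := ∀ i q, |(F i).1 q| ≤ a i

theorem AbsLe.mono (h : AbsLe F a) (hab : ∀ i, a i ≤ b i) : AbsLe F b :=
  fun i q => (h i q).trans (hab i)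

theorem AbsLe.nonneg (h : AbsLe F a) (i : ι) : 0 ≤ a i := (abs_nonneg _).trans (h i 0)

theorem AbsLe.add (hF : AbsLe F a) (hG : AbsLe G b) : AbsLe (F + G) fun i => a i + b i :=
  fun i q => (abs_add_le _ _).trans (add_le_add (hF i q) (hG i q))

theorem AbsLe.neg (hF : AbsLe F a) : AbsLe (-F) a := fun i q => by
  change |-(F i).1 q| ≤ a i
  rw [abs_neg]; exact hF i q

theorem AbsLe.sub (hF : AbsLe F a) (hG : AbsLe G b) : AbsLe (F - G) fun i => a i + b i := by
  rw [sub_eq_add_neg]; exact hF.add hG.neg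

theorem AbsLe.mul (hF : AbsLe F a) (hG : AbsLe G b) : AbsLe (F * G) fun i => a i * b i :=
  fun i q => by
    change |(F i).1 q * (G i).1 q| ≤ a i * b i
    rw [abs_mul]
    exact mul_le_mul (hF i q) (hG i q) (abs_nonneg _) (hF.nonneg i)

theorem AbsLe.one_mul (hF : AbsLe F fun _ => 1) (hG : AbsLe G b) : AbsLe (F * G) b :=
  (hF.mul hG).mono fun _ => (_root_.one_mul _).le

/-- Bounds for a family and its first derivatives. -/
def C1Le (F : R ι) (a : ι → ℝ) : Prop := AbsLe F a ∧ ∀ j, AbsLe (d (bas j) F) a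

theorem C1Le.mul (hF : C1Le F a) (hG : C1Le G a) : C1Le (F * G) fun i => 2 * a i * a i := by
  refine ⟨(hF.1.mul hG.1).mono fun i => ?_, fun j => ?_⟩
  · nlinarith [hF.1.nonneg i]
  · rw [d_mul]
    exact (((hF.2 j).mul hG.1).add (hF.1.mul (hG.2 j))).mono fun i => by linarith

theorem AbsLe.bd {C : ℝ} (hF : AbsLe F a) (N : ℕ) (h : ∀ i, a i ≤ C * s.K i ^ N) (hC : 0 ≤ C) :
    Bd s 0 F :=
  ⟨C, N, hC, fun i q => (hF i q).trans (by simpa using h i)⟩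

theorem fderiv_eq_sum (f : A) (q u : Pt) :
    fderiv ℝ f.1 q u = u.1 * D e0 f.1 q + u.2.1 * D e1 f.1 q + u.2.2 * D e2 f.1 q := by
  have h : u = u.1 • (e0 : Pt) + u.2.1 • (e1 : Pt) + u.2.2 • (e2 : Pt) := by
    simp [e0, e1, e2, bas]
  conv_lhs => rw [h]
  simp [D]

theorem C1Le.abs_sub_le (h : C1Le F a) (i : ι) (q q' : Pt) :
    |(F i).1 q - (F i).1 q'| ≤ 3 * a i * ‖q - q'‖ := by
  have hb : ∀ x ∈ (Set.univ : Set Pt), ‖fderiv ℝ (F i).1 x‖ ≤ 3 * a i := by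
    intro x _
    have h0 := h.1.nonneg i
    refine ContinuousLinearMap.opNorm_le_bound _ (by positivity) fun u => ?_
    rw [fderiv_eq_sum, Real.norm_eq_abs]
    have d0 : |D e0 (F i).1 x| ≤ a i := h.2 0 i x
    have d1 : |D e1 (F i).1 x| ≤ a i := h.2 1 i x
    have d2 : |D e2 (F i).1 x| ≤ a i := h.2 2 i x
    have u0 : |u.1| ≤ ‖u‖ := norm_fst_le u
    have u1 : |u.2.1| ≤ ‖u‖ := (norm_fst_le u.2).trans (norm_snd_le u)
    have u2 : |u.2.2| ≤ ‖u‖ := (norm_snd_le u.2).trans (norm_snd_le u)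
    have key : ∀ y z : ℝ, |y| ≤ ‖u‖ → |z| ≤ a i → |y * z| ≤ a i * ‖u‖ := fun y z hy hz => by
      rw [abs_mul, mul_comm (a i)]
      exact mul_le_mul hy hz (abs_nonneg _) (norm_nonneg _)
    calc _ ≤ |u.1 * D e0 (F i).1 x| + |u.2.1 * D e1 (F i).1 x| + |u.2.2 * D e2 (F i).1 x| :=
          abs_add_three _ _ _
      _ ≤ a i * ‖u‖ + a i * ‖u‖ + a i * ‖u‖ :=
          add_le_add (add_le_add (key _ _ u0 d0) (key _ _ u1 d1)) (key _ _ u2 d2)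
      _ = _ := by ring
  exact convex_univ.norm_image_sub_le_of_norm_fderiv_le (fun x _ => (adm (F i)).diff x) hb
    (Set.mem_univ q') (Set.mem_univ q)

end Bounds

section Support

variable {ι : Type} {s : Scale ι} {α β : ι → ℝ} {j : ℝ} {F G : R ι}

/-- Families supported, in time, in the `j / K`-neighbourhood of `[α, β]`. -/
def Supp (s : Scale ι) (α β : ι → ℝ) (j : ℝ) (F : R ι) : Prop :=
  ∀ i q, q.1 ∉ Set.Icc (α i - j / s.K i) (β i + j / s.K i) → (F i).1 q = 0

theorem Supp.mono {j' : ℝ} (h : Supp s α β j F) (hj : j ≤ j') : Supp s α β j' F := by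
  refine fun i q hq => h i q fun hq' => hq ?_
  have := div_le_div_of_nonneg_right hj (s.K_pos i).le
  exact ⟨by linarith [hq'.1], by linarith [hq'.2]⟩

theorem Supp.add (h : Supp s α β j F) (h' : Supp s α β j G) : Supp s α β j (F + G) := by
  intro i q hq
  change (F i).1 q + (G i).1 q = 0
  rw [h i q hq, h' i q hq, add_zero]

theorem Supp.mul (h : Supp s α β j F) : Supp s α β j (F * G) := by
  intro i q hq
  change (F i).1 q * (G i).1 q = 0
  rw [h i q hq, zero_mul]

theorem Supp.d (h : Supp s α β j F) (u : Pt) : Supp s α β j (d u F) := by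
  intro i q hq
  have ho : IsOpen {q : Pt | q.1 ∉ Set.Icc (α i - j / s.K i) (β i + j / s.K i)} :=
    (isClosed_Icc.preimage continuous_fst).isOpen_compl
  have hev : (F i).1 =ᶠ[nhds q] fun _ => 0 := by
    filter_upwards [ho.mem_nhds hq] with x hx using h i x hx
  change fderiv ℝ (F i).1 q u = 0
  rw [hev.fderiv_eq]; simp

/-- Time cutoffs. -/
def cut (s : Scale ι) (α β : ι → ℝ) (j : ℝ) : R ι :=
  timeF Real.smoothTransition bs_smoothTransition s.K (fun i => -(s.K i * α i) + j) *
    timeF Real.smoothTransition bs_smoothTransition (fun i => -s.K i) (fun i => s.K i * β i + j)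

theorem cut_coe (i : ι) (q : Pt) : ((cut s α β j) i).1 q =
    Real.smoothTransition (s.K i * q.1 + (-(s.K i * α i) + j)) *
      Real.smoothTransition (-s.K i * q.1 + (s.K i * β i + j)) := rfl

theorem sy_cut : Sy s low 0 (cut s α β j) := by
  refine (sy_timeF _ _ _ _ ?_).mul_of_eq (sy_timeF _ _ _ _ ?_) (zero_add _)
  · simpa [low] using s.num_K
  · exact ⟨1, 1, zero_le_one, fun i => by simp [low, abs_of_pos (s.K_pos i)]⟩

theorem absLe_cut : AbsLe (cut s α β j) fun _ => 1 := fun i q => by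
  rw [cut_coe, abs_of_nonneg (mul_nonneg (Real.smoothTransition.nonneg _)
    (Real.smoothTransition.nonneg _))]
  exact mul_le_one₀ (Real.smoothTransition.le_one _) (Real.smoothTransition.nonneg _)
    (Real.smoothTransition.le_one _)

theorem d_cut_one : d e1 (cut s α β j) = 0 := by
  rw [cut, d_mul, d_timeF_one, d_timeF_one, zero_mul, mul_zero, add_zero]

theorem d_cut_two : d e2 (cut s α β j) = 0 := by
  rw [cut, d_mul, d_timeF_two, d_timeF_two, zero_mul, mul_zero, add_zero]

theorem supp_cut : Supp s α β j (cut s α β j) := by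
  intro i q hq
  have hK := s.K_pos i
  rw [cut_coe]
  rcases not_and_or.1 hq with h | h
  · rw [Real.smoothTransition.zero_of_nonpos, zero_mul]
    have h1 := mul_lt_mul_of_pos_left (not_le.1 h) hK
    rw [mul_sub, mul_div_cancel₀ _ hK.ne'] at h1
    linarith
  · rw [mul_comm, Real.smoothTransition.zero_of_nonpos, zero_mul]
    have h1 := mul_lt_mul_of_pos_left (not_le.1 h) hK
    rw [mul_add, mul_div_cancel₀ _ hK.ne'] at h1
    linarith

theorem cut_mul (h : Supp s α β j F) : cut s α β (j + 1) * F = F := by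
  funext i; apply Subtype.ext; funext q
  change ((cut s α β (j + 1)) i).1 q * (F i).1 q = (F i).1 q
  by_cases hq : q.1 ∈ Set.Icc (α i - j / s.K i) (β i + j / s.K i)
  · have hK := s.K_pos i
    have h1 := mul_le_mul_of_nonneg_left hq.1 hK.le
    have h2 := mul_le_mul_of_nonneg_left hq.2 hK.le
    rw [mul_sub, mul_div_cancel₀ _ hK.ne'] at h1
    rw [mul_add, mul_div_cancel₀ _ hK.ne'] at h2
    rw [cut_coe, Real.smoothTransition.one_of_one_le (by linarith),
      Real.smoothTransition.one_of_one_le (by linarith), one_mul, one_mul]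
  · rw [h i q hq, mul_zero]

theorem supp_of_mul_eq_zero (h : (1 - cut s α β j) * F = 0) : Supp s α β j F := by
  have e : F = cut s α β j * F := by linear_combination h
  rw [e]; exact supp_cut.mul

end Support

section Mollification

/-- Smooth kernels supported in the unit ball. -/
structure Ker (η : Pt → ℝ) : Prop where
  smooth : ContDiff ℝ (⊤ : ℕ∞) η
  supp : ∀ ω, 1 < ‖ω‖ → η ω = 0

theorem Ker.D {η : Pt → ℝ} (h : Ker η) (u : Pt) : Ker (D u η) := by
  refine ⟨?_, fun ω hω => ?_⟩
  · exact ((contDiff_infty_iff_fderiv.1 h.smooth).2).clm_apply contDiff_const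
  · have hev : η =ᶠ[nhds ω] fun _ => 0 := by
      filter_upwards [(isOpen_lt continuous_const continuous_norm).mem_nhds hω] with x hx
        using h.supp x hx
    change fderiv ℝ η ω u = 0
    rw [hev.fderiv_eq]; simp

theorem Ker.hasCompactSupport {η : Pt → ℝ} (h : Ker η) : HasCompactSupport η :=
  HasCompactSupport.intro (isCompact_closedBall 0 1) fun x hx => h.supp x (by simpa using hx)

instance : (volume : Measure Pt).IsAddHaarMeasure := by
  have h2 : (volume : Measure (ℝ × ℝ)).IsAddHaarMeasure :=
    inferInstanceAs ((volume : Measure ℝ).prod (volume : Measure ℝ)).IsAddHaarMeasure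
  exact inferInstanceAs ((volume : Measure ℝ).prod (volume : Measure (ℝ × ℝ))).IsAddHaarMeasure

/-- Lebesgue measure on the unit ball. -/
abbrev unitBall : Measure Pt := volume.restrict (Metric.closedBall 0 1)

instance : IsFiniteMeasure unitBall :=
  ⟨by rw [Measure.restrict_apply_univ]; exact (isCompact_closedBall 0 1).measure_lt_top⟩

theorem Ker.exists_bound {η : Pt → ℝ} (h : Ker η) : ∃ B, ∀ ω, |η ω| ≤ B := by
  obtain ⟨B, hB⟩ := h.hasCompactSupport.exists_bound_of_continuous h.smooth.continuous
  exact ⟨B, hB⟩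

theorem Ker.ae_bound {η : Pt → ℝ} (h : Ker η) : ∀ᵐ ω ∂unitBall, |η ω| ≤ h.exists_bound.choose :=
  Filter.Eventually.of_forall h.exists_bound.choose_spec

theorem ae_shift (ρ : ℝ) : ∀ᵐ ω ∂unitBall, ‖-(ρ • ω)‖ ≤ |ρ| := by
  filter_upwards [ae_restrict_mem Metric.isClosed_closedBall.measurableSet] with ω hω
  rw [norm_neg, norm_smul, Real.norm_eq_abs]
  have : ‖ω‖ ≤ 1 := by simpa using hω
  nlinarith [abs_nonneg ρ]

variable {ι : Type} {s : Scale ι} {η : Pt → ℝ} {F G : R ι} {α β : ι → ℝ} {j : ℝ}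

/-- Mollification at the length scale `1 / K`. -/
def mol (s : Scale ι) (hη : Ker η) : R ι →ₗ[ℝ] R ι :=
  LinearMap.pi fun i => (avgL (ν := unitBall) (κ := η) (c := fun ω => -((1 / s.K i) • ω))
    hη.smooth.continuous (by fun_prop) hη.ae_bound (ae_shift _)).comp (LinearMap.proj i)

theorem mol_coe (hη : Ker η) (F : R ι) (i : ι) (q : Pt) :
    (mol s hη F i).1 q = ∫ ω in Metric.closedBall 0 1, η ω * (F i).1 (q + -((1 / s.K i) • ω)) := rfl

theorem mol_coe' (hη : Ker η) (F : R ι) (i : ι) (q : Pt) :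
    (mol s hη F i).1 q = ∫ ω, η ω * (F i).1 (q + -((1 / s.K i) • ω)) := by
  rw [mol_coe, setIntegral_eq_integral_of_forall_compl_eq_zero]
  intro ω hω
  rw [hη.supp ω (by simpa using hω), zero_mul]

theorem d_mol (hη : Ker η) (u : Pt) (F : R ι) : d u (mol s hη F) = mol s hη (d u F) :=
  funext fun i => dA_avgL hη.smooth.continuous (by fun_prop) hη.ae_bound (ae_shift _) u (F i)

theorem d_mol_eq (hη : Ker η) (u : Pt) (F : R ι) :
    d u (mol s hη F) = cst s.K * mol s (hη.D u) F := by
  rw [d_mol]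
  funext i; apply Subtype.ext; funext q
  change _ = s.K i * (mol s (hη.D u) F i).1 q
  rw [mol_coe', mol_coe', ← integral_const_mul]
  have hK := s.K_pos i
  set g : Pt → ℝ := fun ω => (F i).1 (q + -((1 / s.K i) • ω)) with hg
  have gd : ∀ ω, HasFDerivAt g ((fderiv ℝ (F i).1 (q + -((1 / s.K i) • ω))).comp
      (-((1 / s.K i) • ContinuousLinearMap.id ℝ Pt))) ω := fun ω =>
    ((adm (F i)).diff _).hasFDerivAt.comp ω
      ((((hasFDerivAt_id ω).const_smul (1 / s.K i)).neg).const_add q)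
  have gs : ContDiff ℝ (⊤ : ℕ∞) g := (adm (F i)).smooth.comp (by fun_prop)
  have ge : ∀ ω, fderiv ℝ g ω u = -(1 / s.K i) * (d u F i).1 (q + -((1 / s.K i) • ω)) := fun ω => by
    rw [(gd ω).fderiv]
    change fderiv ℝ (F i).1 _ (-((1 / s.K i) • u)) = _
    rw [map_neg, map_smul]
    simp [dA_coe, Boussinesq.D]
  have h_int : ∀ {κ h : Pt → ℝ}, Ker κ → Continuous h → Integrable fun ω => κ ω * h ω :=
    fun hκ hh => (hκ.smooth.continuous.mul hh).integrable_of_hasCompactSupport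
      hκ.hasCompactSupport.mul_right
  have gc : Continuous fun ω => fderiv ℝ g ω u :=
    (gs.continuous_fderiv (by simp)).clm_apply continuous_const
  have key := integral_mul_fderiv_eq_neg_fderiv_mul_of_integrable (μ := (volume : Measure Pt))
    (f := η) (g := g) (v := u) (h_int (hη.D u) gs.continuous) (h_int hη gc) (h_int hη gs.continuous)
    (fun x _ => hη.smooth.differentiable (by simp) x) fun x _ => gs.differentiable (by simp) x
  have e1 : ∀ ω, η ω * (d u F i).1 (q + -((1 / s.K i) • ω))
      = -s.K i * (η ω * fderiv ℝ g ω u) := fun ω => by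
    rw [ge]; field_simp
  simp only [e1]
  rw [integral_const_mul, key, integral_const_mul]
  simp only [Boussinesq.D]
  ring

theorem bd_mol (hη : Ker η) {m : ℤ} (hF : Bd s m F) : Bd s m (mol s hη F) := by
  obtain ⟨B, hB⟩ := hη.exists_bound
  have hB0 : 0 ≤ B := (abs_nonneg _).trans (hB 0)
  refine bd_of_le (C := B * unitBall.real Set.univ) (by positivity) hF fun i M hM q => ?_
  have := abs_avg_le (ν := unitBall) (c := fun ω => -((1 / s.K i) • ω))
    (Filter.Eventually.of_forall hB) hM q
  refine this.trans (le_of_eq (by ring))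

theorem sy_mol (hη : Ker η) (hF : Bd s 0 F) : Sy s low 0 (mol s hη F) := by
  intro n
  induction n generalizing η with
  | zero => exact bd_mol hη hF
  | succ n ih =>
    refine ⟨bd_mol hη hF, fun j => ?_⟩
    rw [d_mol_eq]
    have h1 := (Sy.cst (c := low) s.num_K n).mul (ih (hη.D (bas j)))
    rw [zero_add] at h1
    have h2 : (0 : ℤ) + (low j : ℕ) = 0 := by fin_cases j <;> simp [low]
    rwa [h2]

theorem Supp.mol (hη : Ker η) (h : Supp s α β j F) : Supp s α β (j + 1) (mol s hη F) := by
  intro i q hq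
  rw [mol_coe]
  refine setIntegral_eq_zero_of_forall_eq_zero fun ω hω => ?_
  rw [h i, mul_zero]
  intro hq'
  apply hq
  have hK := s.K_pos i
  have h1 : |ω.1| ≤ 1 := (norm_fst_le ω).trans (by simpa using hω)
  have h2 : |1 / s.K i * ω.1| ≤ 1 / s.K i := by
    rw [abs_mul, abs_of_pos (one_div_pos.2 hK)]
    exact mul_le_of_le_one_right (one_div_pos.2 hK).le h1
  have h3 := abs_le.1 h2
  change q.1 + -(1 / s.K i * ω.1) ∈ _ at hq'
  rw [Set.mem_Icc] at hq' ⊢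
  rw [add_div]
  constructor <;> linarith [hq'.1, hq'.2, h3.1, h3.2]

/-- Kernels that are probability densities. -/
structure ProbKer (η : Pt → ℝ) : Prop extends Ker η where
  nonneg : ∀ ω, 0 ≤ η ω
  integral : ∫ ω, η ω = 1

theorem exists_probKer : ∃ η, ProbKer η := by
  let f : ContDiffBump (0 : Pt) :=
    { rIn := 1 / 2, rOut := 1, rIn_pos := by norm_num, rIn_lt_rOut := by norm_num }
  refine ⟨f.normed volume, ⟨⟨f.contDiff_normed, fun ω hω => ?_⟩, fun ω => f.nonneg_normed ω,
    f.integral_normed⟩⟩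
  have := f.support_normed_eq (μ := (volume : Measure Pt))
  rw [← Function.notMem_support, this]
  simpa [f] using hω.le

theorem ProbKer.abs_le (hη : ProbKer η) {g : Pt → ℝ} {M : ℝ}
    (hM : ∀ ω, ‖ω‖ ≤ 1 → |g ω| ≤ M) : |∫ ω, η ω * g ω| ≤ M := by
  have hi : Integrable η := hη.smooth.continuous.integrable_of_hasCompactSupport
    hη.toKer.hasCompactSupport
  calc |∫ ω, η ω * g ω| ≤ ∫ ω, η ω * M := by
        rw [← Real.norm_eq_abs]
        refine norm_integral_le_of_norm_le (hi.mul_const M) (Filter.Eventually.of_forall fun ω => ?_)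
        rw [norm_mul, Real.norm_eq_abs, abs_of_nonneg (hη.nonneg ω)]
        rcases le_or_gt ‖ω‖ 1 with h | h
        · exact mul_le_mul_of_nonneg_left (hM ω h) (hη.nonneg ω)
        · rw [hη.supp ω h, zero_mul, zero_mul]
    _ = M := by rw [integral_mul_const, hη.integral, one_mul]

theorem AbsLe.mol (hη : ProbKer η) {a : ι → ℝ} (hF : AbsLe F a) :
    AbsLe (mol s hη.toKer F) a := fun i q => by
  rw [mol_coe']
  exact hη.abs_le fun ω _ => hF i _

theorem C1Le.mol_sub (hη : ProbKer η) {a : ι → ℝ} (hF : C1Le F a) :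
    AbsLe (mol s hη.toKer F - F) fun i => 3 * (a i / s.K i) := fun i q => by
  have hi : Integrable η := hη.smooth.continuous.integrable_of_hasCompactSupport
    hη.toKer.hasCompactSupport
  have hc : Continuous fun ω => (F i).1 (q + -((1 / s.K i) • ω)) :=
    (adm (F i)).cont.comp (by fun_prop)
  have e : (mol s hη.toKer F i).1 q - (F i).1 q
      = ∫ ω, η ω * ((F i).1 (q + -((1 / s.K i) • ω)) - (F i).1 q) := by
    simp only [mul_sub]
    rw [integral_sub, integral_mul_const, hη.integral, one_mul, mol_coe']
    · exact (hη.smooth.continuous.mul hc).integrable_of_hasCompactSupport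
        hη.toKer.hasCompactSupport.mul_right
    · exact hi.mul_const _
  change |(mol s hη.toKer F i).1 q - (F i).1 q| ≤ _
  rw [e]
  refine hη.abs_le fun ω hω => ?_
  have hK := s.K_pos i
  have h0 := hF.1.nonneg i
  refine (hF.abs_sub_le i _ _).trans ?_
  rw [add_sub_cancel_left, norm_neg, norm_smul, Real.norm_eq_abs, abs_of_pos (one_div_pos.2 hK)]
  calc 3 * a i * (1 / s.K i * ‖ω‖) ≤ 3 * a i * (1 / s.K i * 1) := by gcongr
    _ = _ := by ring

theorem mol_mul_sub (hη : ProbKer η) {a : ι → ℝ} (hF : C1Le F a) (hG : C1Le G a) :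
    AbsLe (mol s hη.toKer F * mol s hη.toKer G - mol s hη.toKer (F * G))
      fun i => 12 * (a i ^ 2 / s.K i) := by
  have e : mol s hη.toKer F * mol s hη.toKer G - mol s hη.toKer (F * G)
      = (mol s hη.toKer F - F) * mol s hη.toKer G + F * (mol s hη.toKer G - G)
        - (mol s hη.toKer (F * G) - F * G) := by ring
  rw [e]
  refine ((((hF.mol_sub hη).mul (hG.1.mol hη)).add (hF.1.mul (hG.mol_sub hη))).sub
    ((hF.mul hG).mol_sub hη)).mono fun i => le_of_eq ?_
  ring

end Mollification

section Step

variable {ι : Type} {s : Scale ι} {Λ : ι → ℝ} {F G : R ι}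

/-- The size of the errors made in one step. -/
def err (s : Scale ι) (Λ : ι → ℝ) (N : ℕ) (i : ι) : ℝ :=
  N * (Λ i ^ 2 / s.K i + s.K i ^ N / s.μ i)

theorem err_mono {N N' : ℕ} (h : N ≤ N') (i : ι) : err s Λ N i ≤ err s Λ N' i := by
  have h1 := pow_le_pow_right₀ (s.one_le_K i) h
  have h2 : (N : ℝ) ≤ N' := by exact_mod_cast h
  have := s.K_pos i
  have := s.μ_pos i
  exact mul_le_mul h2 (by gcongr) (by positivity) (by positivity)

theorem err_add (N N' : ℕ) (i : ι) : err s Λ N i + err s Λ N' i ≤ err s Λ (N + N') i := by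
  have h1 := pow_le_pow_right₀ (s.one_le_K i) (Nat.le_add_right N N')
  have h2 := pow_le_pow_right₀ (s.one_le_K i) (Nat.le_add_left N' N)
  have := s.K_pos i
  have := s.μ_pos i
  calc err s Λ N i + err s Λ N' i
      ≤ N * (Λ i ^ 2 / s.K i + s.K i ^ (N + N') / s.μ i)
        + N' * (Λ i ^ 2 / s.K i + s.K i ^ (N + N') / s.μ i) := by
        unfold err; gcongr
    _ = _ := by unfold err; push_cast; ring

/-- Errors which become small as the parameters grow. -/
def Small (s : Scale ι) (Λ : ι → ℝ) (F : R ι) : Prop := ∃ N : ℕ, AbsLe F (err s Λ N)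

theorem Small.add (hF : Small s Λ F) (hG : Small s Λ G) : Small s Λ (F + G) := by
  obtain ⟨N, h⟩ := hF
  obtain ⟨N', h'⟩ := hG
  exact ⟨N + N', (h.add h').mono fun i => err_add N N' i⟩

theorem Small.neg (hF : Small s Λ F) : Small s Λ (-F) := hF.imp fun _ h => h.neg

theorem Small.sub (hF : Small s Λ F) (hG : Small s Λ G) : Small s Λ (F - G) := by
  rw [sub_eq_add_neg]; exact hF.add hG.neg

theorem Small.one_mul (hF : Small s Λ F) (hG : AbsLe G fun _ => 1) : Small s Λ (G * F) :=
  hF.imp fun _ h => hG.one_mul h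

theorem small_of_sy (hF : Sy s fast (-1) F) : Small s Λ F := by
  obtain ⟨C, N, hC, h⟩ := hF.bd
  refine ⟨N + ⌈C⌉₊, fun i q => (h i q).trans ?_⟩
  have := s.K_pos i
  have := s.μ_pos i
  have h1 := pow_le_pow_right₀ (s.one_le_K i) (Nat.le_add_right N ⌈C⌉₊)
  have h2 : C ≤ (N + ⌈C⌉₊ : ℕ) := (Nat.le_ceil C).trans (by exact_mod_cast Nat.le_add_left _ _)
  rw [zpow_neg_one, mul_assoc, ← div_eq_mul_inv]
  refine mul_le_mul h2 ?_ (by positivity) (by positivity)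
  have : 0 ≤ Λ i ^ 2 / s.K i := by positivity
  have : s.K i ^ N / s.μ i ≤ s.K i ^ (N + ⌈C⌉₊) / s.μ i := by gcongr
  linarith

theorem small_of_absLe (C : ℕ) (h : AbsLe F fun i => C * (Λ i ^ 2 / s.K i)) : Small s Λ F := by
  refine ⟨C, h.mono fun i => ?_⟩
  have := s.K_pos i
  have := s.μ_pos i
  have : 0 ≤ s.K i ^ C / s.μ i := by positivity
  exact mul_le_mul_of_nonneg_left (by linarith) (Nat.cast_nonneg _)

theorem Small.eventually (hF : Small s Λ F) :
    ∀ᶠ N : ℕ in Filter.atTop, AbsLe F (err s Λ N) := by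
  obtain ⟨N, h⟩ := hF
  filter_upwards [Filter.eventually_ge_atTop N] with N' hN
  exact h.mono fun i => err_mono hN i

/-- The size of first derivatives after one step. -/
def grow (s : Scale ι) (N : ℕ) (i : ι) : ℝ := N * s.K i ^ N * (s.μ i : ℝ) ^ 2

theorem Bd.eventually_grow (hF : Bd s 2 F) :
    ∀ᶠ N : ℕ in Filter.atTop, AbsLe F (grow s N) := by
  obtain ⟨C, N, hC, h⟩ := hF
  filter_upwards [Filter.eventually_ge_atTop (N + ⌈C⌉₊)] with N' hN
  intro i q
  refine (h i q).trans ?_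
  have h2 : C ≤ (N' : ℝ) := (Nat.le_ceil C).trans (by exact_mod_cast (by omega : ⌈C⌉₊ ≤ N'))
  exact bound_mono s hC h2 (by omega : N ≤ N') (le_refl (2 : ℤ)) i

theorem eventually_c1Le (hF : Sy s fast 0 F) :
    ∀ᶠ N : ℕ in Filter.atTop, C1Le F (grow s N) := by
  have h : ∀ j, ∀ᶠ N : ℕ in Filter.atTop, AbsLe (d (bas j) F) (grow s N) := fun j =>
    ((hF.d_fast j).bd.mono (by norm_num)).eventually_grow
  exact (hF.bd.mono (by norm_num : (0 : ℤ) ≤ 2)).eventually_grow.and (Filter.eventually_all.2 h)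

/-- A property of all the components. -/
structure Fld.All (S : Fld ι) (P : R ι → Prop) : Prop where
  v₁ : P S.v₁
  v₂ : P S.v₂
  θ : P S.θ
  p : P S.p
  r : ∀ l, P (S.r l)
  f : ∀ l, P (S.f l)

theorem Fld.All.eventually {S : Fld ι} {P : ℕ → R ι → Prop}
    (h : S.All fun F => ∀ᶠ N in Filter.atTop, P N F) : ∀ᶠ N in Filter.atTop, S.All (P N) := by
  filter_upwards [h.v₁, h.v₂, h.θ, h.p, Filter.eventually_all.2 h.r, Filter.eventually_all.2 h.f]
    with N h1 h2 h3 h4 h5 h6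
  exact ⟨h1, h2, h3, h4, h5, h6⟩

/-- The outcome of one step of the iteration. -/
structure Fld.Step (s : Scale ι) (Λ δ ε α β : ι → ℝ) (b : Bool) (S S' : Fld ι) (N : ℕ) : Prop where
  sol : S'.IsSol
  supp : S'.All (Supp s α β 4)
  c1 : S'.All fun F => C1Le F (grow s N)
  v₁ : AbsLe (S'.v₁ - S.v₁) fun i => 16 * √(δ i) + err s Λ N i
  v₂ : AbsLe (S'.v₂ - S.v₂) fun i => 16 * √(δ i) + err s Λ N i
  θ : AbsLe (S'.θ - S.θ) fun i => 16 * √(δ i) + err s Λ N i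
  p : AbsLe (S'.p - S.p) (err s Λ N)
  r : AbsLe (S'.r b) (err s Λ N)
  f : AbsLe (S'.f b) (err s Λ N)
  r' : AbsLe (S'.r !b) fun i => ε i + err s Λ N i
  f' : AbsLe (S'.f !b) fun i => ε i + err s Λ N i

/-- Mollification of a solution, with commutators moved into the errors. -/
def Fld.mol (s : Scale ι) {η : Pt → ℝ} (hη : Ker η) (S : Fld ι) : Fld ι :=
  let m := Boussinesq.mol s hη
  let Q := fun F G : R ι => m F * m G - m (F * G)
  { v₁ := m S.v₁
    v₂ := m S.v₂
    θ := m S.θ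
    p := m S.p - (Q S.v₂ S.v₂ - Q S.v₁ S.v₂)
    r := fun
      | false => m (S.r false) + (Q S.v₁ S.v₁ - Q S.v₂ S.v₂)
      | true => m (S.r true) + Q S.v₁ S.v₂
    f := fun
      | false => m (S.f false) + (Q S.v₁ S.θ - Q S.v₂ S.θ)
      | true => m (S.f true) + Q S.v₂ S.θ }

theorem Fld.IsSol.mol {η : Pt → ℝ} (hη : Ker η) {S : Fld ι} (hS : S.IsSol) :
    (S.mol s hη).IsSol := by
  have h1 := congrArg (Boussinesq.mol s hη) hS.mom₁
  have h2 := congrArg (Boussinesq.mol s hη) hS.mom₂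
  have h3 := congrArg (Boussinesq.mol s hη) hS.heat
  have h4 := congrArg (Boussinesq.mol s hη) hS.div
  simp only [map_add, map_zero, ← d_mol] at h1 h2 h3 h4
  constructor
  · simp only [Fld.mol, d_diag, map_add, map_sub] at h1 ⊢
    linear_combination h1
  · simp only [Fld.mol, d_diag, map_add, map_sub] at h2 ⊢
    linear_combination h2
  · simp only [Fld.mol, d_diag, map_add, map_sub] at h3 ⊢
    linear_combination h3
  · exact h4

theorem Fld.IsSol.cutoff {S : Fld ι} (hS : S.IsSol) {X : R ι} (h1 : d e1 X = 0) (h2 : d e2 X = 0)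
    (hX : ∀ u, X * d u S.v₁ = d u S.v₁ ∧ X * d u S.v₂ = d u S.v₂ ∧ X * d u S.θ = d u S.θ)
    (x1 : X * S.v₁ = S.v₁) (x2 : X * S.v₂ = S.v₂) (x3 : X * S.θ = S.θ) :
    Fld.IsSol ⟨S.v₁, S.v₂, S.θ, X * S.p, fun l => X * S.r l, fun l => X * S.f l⟩ := by
  have m1 := hS.mom₁
  have m2 := hS.mom₂
  have m3 := hS.heat
  have y : ∀ u F G, X * F = F → X * d u F = d u F → X * d u (F * G) = d u (F * G) := by
    intro u F G hF hd
    rw [d_mul]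
    linear_combination G * hd + d u G * hF
  have a1 := fun u G => y u _ G x1 (hX u).1
  have a2 := fun u G => y u _ G x2 (hX u).2.1
  refine ⟨?_, ?_, ?_, hS.div⟩
  · simp only [d_diag, d_mul e1 X, d_mul e2 X, h1, h2] at m1 ⊢
    linear_combination X * m1 - (hX e0).1 - a1 e1 S.v₁ - a1 e2 S.v₂
  · simp only [d_diag, d_mul e1 X, d_mul e2 X, h1, h2] at m2 ⊢
    linear_combination X * m2 - (hX e0).2.1 - a1 e1 S.v₂ - a2 e2 S.v₂ + x3
  · simp only [d_diag, d_mul e1 X, d_mul e2 X, h1, h2] at m3 ⊢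
    linear_combination X * m3 - (hX e0).2.2 - a1 e1 S.θ - a2 e2 S.θ

end Step

section StepExists

variable {ι : Type} {s : Scale ι} {Λ α β δ ε : ι → ℝ} {η : Pt → ℝ}

theorem Fld.All.imp {S : Fld ι} {P Q : R ι → Prop} (h : S.All P) (hPQ : ∀ F, P F → Q F) :
    S.All Q :=
  ⟨hPQ _ h.v₁, hPQ _ h.v₂, hPQ _ h.θ, hPQ _ h.p, fun l => hPQ _ (h.r l), fun l => hPQ _ (h.f l)⟩

theorem Fld.All.sy_mol (hη : Ker η) {S : Fld ι} (hS : S.All (Bd s 0)) :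
    (S.mol s hη).All (Sy s low 0) := by
  have hm : ∀ {F}, Bd s 0 F → Sy s low 0 (Boussinesq.mol s hη F) := fun h => Boussinesq.sy_mol hη h
  have hQ : ∀ {F G}, Bd s 0 F → Bd s 0 G → Sy s low 0
      (Boussinesq.mol s hη F * Boussinesq.mol s hη G - Boussinesq.mol s hη (F * G)) := fun h h' =>
    ((hm h).mul_of_eq (hm h') (zero_add _)).sub (hm ((h.mul h').mono (by norm_num)))
  refine ⟨hm hS.v₁, hm hS.v₂, hm hS.θ, (hm hS.p).sub ((hQ hS.v₂ hS.v₂).sub (hQ hS.v₁ hS.v₂)), ?_, ?_⟩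
  · rintro (_ | _)
    · exact (hm (hS.r _)).add ((hQ hS.v₁ hS.v₁).sub (hQ hS.v₂ hS.v₂))
    · exact (hm (hS.r _)).add (hQ hS.v₁ hS.v₂)
  · rintro (_ | _)
    · exact (hm (hS.f _)).add ((hQ hS.v₁ hS.θ).sub (hQ hS.v₂ hS.θ))
    · exact (hm (hS.f _)).add (hQ hS.v₂ hS.θ)

/-- The commutator errors created by mollification. -/
structure Fld.MolErr (s : Scale ι) (Λ : ι → ℝ) (hη : Ker η) (S : Fld ι) : Prop where
  v₁ : Small s Λ ((S.mol s hη).v₁ - S.v₁)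
  v₂ : Small s Λ ((S.mol s hη).v₂ - S.v₂)
  θ : Small s Λ ((S.mol s hη).θ - S.θ)
  p : Small s Λ ((S.mol s hη).p - S.p)
  r : ∀ l, Small s Λ ((S.mol s hη).r l - Boussinesq.mol s hη (S.r l))
  f : ∀ l, Small s Λ ((S.mol s hη).f l - Boussinesq.mol s hη (S.f l))

theorem Fld.molErr (hη : ProbKer η) {S : Fld ι} (hS : S.All fun F => C1Le F Λ)
    (hΛ : ∀ i, 1 ≤ Λ i) : S.MolErr s Λ hη.toKer := by
  have hm : ∀ {F}, C1Le F Λ → Small s Λ (Boussinesq.mol s hη.toKer F - F) := fun h => by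
    refine small_of_absLe 3 ((h.mol_sub hη).mono fun i => ?_)
    have := s.K_pos i
    have := hΛ i
    push_cast
    gcongr
    nlinarith
  have hQ : ∀ {F G}, C1Le F Λ → C1Le G Λ → Small s Λ
      (Boussinesq.mol s hη.toKer F * Boussinesq.mol s hη.toKer G
        - Boussinesq.mol s hη.toKer (F * G)) := fun h h' =>
    small_of_absLe 12 (by exact_mod_cast mol_mul_sub hη h h')
  refine ⟨hm hS.v₁, hm hS.v₂, hm hS.θ, ?_, ?_, ?_⟩
  · have := (hm hS.p).sub ((hQ hS.v₂ hS.v₂).sub (hQ hS.v₁ hS.v₂))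
    rwa [sub_right_comm] at this
  · rintro (_ | _)
    · simpa [Fld.mol] using (hQ hS.v₁ hS.v₁).sub (hQ hS.v₂ hS.v₂)
    · simpa [Fld.mol] using hQ hS.v₁ hS.v₂
  · rintro (_ | _)
    · simpa [Fld.mol] using (hQ hS.v₁ hS.θ).sub (hQ hS.v₂ hS.θ)
    · simpa [Fld.mol] using hQ hS.v₂ hS.θ

theorem absLe_osc (k : ℤ × ℤ) (h : R ι) (x : ℝ) : AbsLe (osc s k h x) fun _ => 1 :=
  fun _ _ => Real.abs_cos_le_one _

theorem absLe_lead {k : ℤ × ℤ} {h h' a a' : R ι} {A : ι → ℝ} (ha : AbsLe a A) (ha' : AbsLe a' A) :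
    AbsLe (lead s k h h' a a') fun i => 2 * A i := by
  refine ((ha.mul (absLe_osc _ h 0)).add (ha'.mul (absLe_osc _ h' 0))).mono fun i => le_of_eq ?_
  ring

theorem absLe_pol (b : Bool) : AbsLe (pol ι b) fun _ => 1 := fun i q => by
  cases b
  · change |(0 : ℝ)| ≤ 1; simp
  · change |(1 : ℝ)| ≤ 1; simp

theorem AbsLe.eventually_add {F G : R ι} {a : ι → ℝ} (hF : AbsLe F a) (hG : Small s Λ (G - F)) :
    ∀ᶠ N : ℕ in Filter.atTop, AbsLe G fun i => a i + err s Λ N i := by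
  filter_upwards [hG.eventually] with N h
  have := hF.add h
  rwa [add_sub_cancel] at this

theorem step_exists (hη : ProbKer η) (b : Bool) {S : Fld ι} (hS : S.IsSol)
    (hsupp : S.All (Supp s α β 0)) (hc : S.All fun F => C1Le F Λ) (hΛ : ∀ i, 1 ≤ Λ i)
    (hΛK : ∀ i, Λ i ≤ s.K i) (hδ : ∀ i, 0 < δ i) (hδ1 : ∀ i, δ i ≤ 1)
    (hδK : ∀ i, 1 / δ i ≤ s.K i) (hr : AbsLe (S.r b) δ) (hf : AbsLe (S.f b) δ)
    (hr' : AbsLe (S.r !b) ε) (hf' : AbsLe (S.f !b) ε) :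
    ∃ S' : Fld ι, ∀ᶠ N in Filter.atTop, Fld.Step s Λ δ ε α β b S S' N := by
  let m := mol s hη.toKer
  let S₁ := S.mol s hη.toKer
  have hS₁ : S₁.IsSol := hS.mol hη.toKer
  have hbd : S.All (Bd s 0) := hc.imp fun F h => h.1.bd (C := 1) 1 (by simpa using hΛK) zero_le_one
  have sy₁ : S₁.All (Sy s low 0) := hbd.sy_mol hη.toKer
  have er : S.MolErr s Λ hη.toKer := Fld.molErr hη hc hΛ
  have sT : Sy s low 0 (m (S.r b)) := sy_mol _ (hbd.r b)
  have sT' : Sy s low 0 (m (S.f b)) := sy_mol _ (hbd.f b)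
  have hm : ∀ {F}, Supp s α β 0 F → Supp s α β 1 (m F) := fun h => by
    simpa using h.mol hη.toKer
  have c1 : ∀ {F}, Supp s α β 1 F → cut s α β 2 * F = F := fun h => by
    have := cut_mul h; norm_num at this; exact this
  have c2 : ∀ {F}, Supp s α β 2 F → cut s α β 3 * F = F := fun h => by
    have := cut_mul h; norm_num at this; exact this
  have c3 : ∀ {F}, Supp s α β 3 F → cut s α β 4 * F = F := fun h => by
    have := cut_mul h; norm_num at this; exact this
  obtain ⟨h, h', a, a', c, c', P, H, H', dP, dP', e, e', hY, hb⟩ :=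
    exists_amplitudes sy₁.v₁ sy₁.v₂ (kv b) (X := cut s α β 2) hδ hδ1 hδK sT sT' sy_cut
      (hr.mol hη) (hf.mol hη) absLe_cut d_cut_one d_cut_two (c1 (hm (hsupp.r b)))
      (c1 (hm (hsupp.f b)))
  obtain ⟨w₁, w₂, ϑ, π, E, F, hsol, l₁, l₂, l₃, sπ, sE, sF, hw⟩ :=
    wave_step S₁ hS₁ b sy₁.v₁ sy₁.v₂ sy₁.θ H H' dP dP' e e'
  have hYX : (1 - cut s α β 3) * cut s α β 2 = 0 := by
    rw [sub_mul, c2 supp_cut, one_mul, sub_self]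
  obtain ⟨y1, y2, y3, y4⟩ := hY _ hYX
  have dY : ∀ u, d u (1 : R ι) = 0 := fun u => d_one u
  obtain ⟨z1, z2, z3⟩ := hw _ (by rw [map_sub, dY, d_cut_one, sub_self])
    (by rw [map_sub, dY, d_cut_two, sub_self]) y1 y2 y3 y4
  have u₁ : Supp s α β 3 (S₁.v₁ + w₁) :=
    ((hm hsupp.v₁).mono (by norm_num)).add (supp_of_mul_eq_zero z1)
  have u₂ : Supp s α β 3 (S₁.v₂ + w₂) :=
    ((hm hsupp.v₂).mono (by norm_num)).add (supp_of_mul_eq_zero z2)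
  have u₃ : Supp s α β 3 (S₁.θ + ϑ) :=
    ((hm hsupp.θ).mono (by norm_num)).add (supp_of_mul_eq_zero z3)
  have hsol' := hsol.cutoff (X := cut s α β 4) d_cut_one d_cut_two
    (fun u => ⟨c3 (u₁.d u), c3 (u₂.d u), c3 (u₃.d u)⟩) (c3 u₁) (c3 u₂) (c3 u₃)
  have s4 : Supp s α β 4 (cut s α β 4) := supp_cut
  have X1 : AbsLe (cut s α β 4) fun _ => 1 := absLe_cut
  have sX : Sy s fast 0 (cut s α β 4) := sy_cut.sym.fast
  have hXS : ∀ {F}, Supp s α β 0 F → cut s α β 4 * F = F := fun h => c3 (h.mono (by norm_num))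
  have le0 : ∀ {F}, Sy s fast (-1) F → Sy s fast 0 F := fun h => h.le (by norm_num)
  have sw : ∀ {w L : R ι}, Sy s fast (-1) (w - L) → Sy s fast 0 L → Sy s fast 0 w := fun h hL => by
    have := (le0 h).add hL
    rwa [sub_add_cancel] at this
  have sL : Sy s fast 0 (lead s (kv b) h h' a a') := H.sy_lead
  have sL' : Sy s fast 0 (lead s (kv b) h h' c c') := H'.sy_lead
  have sk : ∀ {T : R ι}, Sy s low 0 T → ∀ l, Sy s fast 0 (killed b T l) := fun hT l => by
    unfold killed; split_ifs
    exacts [hT.sym.fast, .zero]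
  have bL : AbsLe (lead s (kv b) h h' a a') fun i => 16 * √(δ i) :=
    (absLe_lead (fun i q => (hb i q).1) fun i q => (hb i q).2.1).mono fun i => by linarith
  have bL' : AbsLe (lead s (kv b) h h' c c') fun i => 16 * √(δ i) :=
    (absLe_lead (fun i q => (hb i q).2.2.1) fun i q => (hb i q).2.2.2).mono fun i => by linarith
  have inc : ∀ {v' v w L : R ι}, Small s Λ (v' - v) → Sy s fast (-1) (w - L) →
      Small s Λ (v' + w - v - L) := fun {v' v w L} h1 h2 => by
    have := h1.add (small_of_sy h2)
    rwa [show v' - v + (w - L) = v' + w - v - L by ring] at this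
  let S' : Fld ι := ⟨S₁.v₁ + w₁, S₁.v₂ + w₂, S₁.θ + ϑ, cut s α β 4 * (S₁.p + π),
    fun l => cut s α β 4 * (S₁.r l - killed b (m (S.r b)) l + E l),
    fun l => cut s α β 4 * (S₁.f l - killed b (m (S.f b)) l + F l)⟩
  have hX0 : ∀ {G}, Sy s fast 0 G → Sy s fast 0 (cut s α β 4 * G) := fun hG =>
    sX.mul_of_eq hG (zero_add _)
  have hall : S'.All (Sy s fast 0) :=
    { v₁ := sy₁.v₁.sym.fast.add (sw l₁ sL)
      v₂ := sy₁.v₂.sym.fast.add (sw l₂ ((sy_pol b).mul_of_eq sL (zero_add _)))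
      θ := sy₁.θ.sym.fast.add (sw l₃ sL')
      p := hX0 (sy₁.p.sym.fast.add (le0 sπ))
      r := fun l => hX0 (((sy₁.r l).sym.fast.sub (sk sT l)).add (le0 (sE l)))
      f := fun l => hX0 (((sy₁.f l).sym.fast.sub (sk sT' l)).add (le0 (sF l))) }
  have hsupp' : S'.All (Supp s α β 4) :=
    ⟨u₁.mono (by norm_num), u₂.mono (by norm_num), u₃.mono (by norm_num), s4.mul, fun _ => s4.mul,
      fun _ => s4.mul⟩
  have hp' : Small s Λ (S'.p - S.p) := by
    have := ((er.p.add (small_of_sy sπ)).one_mul X1)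
    rwa [show cut s α β 4 * ((S₁.p - S.p) + π) = S'.p - cut s α β 4 * S.p by
      change _ = cut s α β 4 * (S₁.p + π) - _; ring, hXS hsupp.p] at this
  have hkb : ∀ T : R ι, killed b T b = T := fun T => if_pos rfl
  have hkn : ∀ T : R ι, killed b T (!b) = 0 := fun T => if_neg (by simp)
  have hrb : Small s Λ (S'.r b) := by
    have := ((er.r b).add (small_of_sy (sE b))).one_mul X1
    simpa only [S', hkb] using this
  have hfb : Small s Λ (S'.f b) := by
    have := ((er.f b).add (small_of_sy (sF b))).one_mul X1
    simpa only [S', hkb] using this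
  have hrn : Small s Λ (S'.r (!b) - cut s α β 4 * m (S.r !b)) := by
    have := ((er.r (!b)).add (small_of_sy (sE (!b)))).one_mul X1
    convert this using 1
    simp only [S', hkn, S₁, m]; ring
  have hfn : Small s Λ (S'.f (!b) - cut s α β 4 * m (S.f !b)) := by
    have := ((er.f (!b)).add (small_of_sy (sF (!b)))).one_mul X1
    convert this using 1
    simp only [S', hkn, S₁, m]; ring
  refine ⟨S', ?_⟩
  filter_upwards [(hall.imp fun G hG => eventually_c1Le hG).eventually, hp'.eventually,
    hrb.eventually, hfb.eventually, (X1.one_mul (hr'.mol hη)).eventually_add hrn,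
    (X1.one_mul (hf'.mol hη)).eventually_add hfn, bL.eventually_add (inc er.v₁ l₁),
    ((absLe_pol b).one_mul bL).eventually_add (inc er.v₂ l₂), bL'.eventually_add (inc er.θ l₃)]
    with N h1 h2 h3 h4 h5 h6 h7 h8 h9
  exact ⟨hsol', hsupp', h1, h7, h8, h9, h2, h3, h4, h5, h6⟩

end StepExists

section UniformStep

/-- The hypotheses for one step of the iteration. -/
structure Fld.Ready {ι : Type} (s : Scale ι) (Λ δ ε α β : ι → ℝ) (b : Bool) (S : Fld ι) : Prop where
  sol : S.IsSol
  supp : S.All (Supp s α β 0)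
  c1 : S.All fun F => C1Le F Λ
  one_le : ∀ i, 1 ≤ Λ i
  le_K : ∀ i, Λ i ≤ s.K i
  δ_pos : ∀ i, 0 < δ i
  δ_le : ∀ i, δ i ≤ 1
  δ_K : ∀ i, 1 / δ i ≤ s.K i
  r : AbsLe (S.r b) δ
  f : AbsLe (S.f b) δ
  r' : AbsLe (S.r !b) ε
  f' : AbsLe (S.f !b) ε

/-- All admissible data for one step of the iteration. -/
structure Input (b : Bool) : Type where
  S : Fld Unit
  s : Scale Unit
  Λ : Unit → ℝ
  δ : Unit → ℝ
  ε : Unit → ℝ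
  α : Unit → ℝ
  β : Unit → ℝ
  ready : S.Ready s Λ δ ε α β b

variable {b : Bool}

/-- The scales of all the inputs. -/
def allScale (b : Bool) : Scale (Input b) where
  K i := i.s.K ()
  μ i := i.s.μ ()
  one_le_K i := i.s.one_le_K ()
  one_le_μ i := i.s.one_le_μ ()

/-- The family of all the inputs. -/
def allFld (b : Bool) : Fld (Input b) where
  v₁ i := i.S.v₁ ()
  v₂ i := i.S.v₂ ()
  θ i := i.S.θ ()
  p i := i.S.p ()
  r l i := i.S.r l ()
  f l i := i.S.f l ()

theorem ready_allFld (b : Bool) : (allFld b).Ready (allScale b) (fun i => i.Λ ()) (fun i => i.δ ())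
    (fun i => i.ε ()) (fun i => i.α ()) (fun i => i.β ()) b where
  sol := ⟨funext fun i => congrFun i.ready.sol.mom₁ (), funext fun i => congrFun i.ready.sol.mom₂ (),
    funext fun i => congrFun i.ready.sol.heat (), funext fun i => congrFun i.ready.sol.div ()⟩
  supp := ⟨fun i => i.ready.supp.v₁ (), fun i => i.ready.supp.v₂ (), fun i => i.ready.supp.θ (),
    fun i => i.ready.supp.p (), fun l i => i.ready.supp.r l (), fun l i => i.ready.supp.f l ()⟩
  c1 := ⟨⟨fun i => i.ready.c1.v₁.1 (), fun j i => i.ready.c1.v₁.2 j ()⟩,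
    ⟨fun i => i.ready.c1.v₂.1 (), fun j i => i.ready.c1.v₂.2 j ()⟩,
    ⟨fun i => i.ready.c1.θ.1 (), fun j i => i.ready.c1.θ.2 j ()⟩,
    ⟨fun i => i.ready.c1.p.1 (), fun j i => i.ready.c1.p.2 j ()⟩,
    fun l => ⟨fun i => (i.ready.c1.r l).1 (), fun j i => (i.ready.c1.r l).2 j ()⟩,
    fun l => ⟨fun i => (i.ready.c1.f l).1 (), fun j i => (i.ready.c1.f l).2 j ()⟩⟩
  one_le i := i.ready.one_le ()
  le_K i := i.ready.le_K ()
  δ_pos i := i.ready.δ_pos ()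
  δ_le i := i.ready.δ_le ()
  δ_K i := i.ready.δ_K ()
  r i := i.ready.r ()
  f i := i.ready.f ()
  r' i := i.ready.r' ()
  f' i := i.ready.f' ()

/-- The member of a family with a given index. -/
def Fld.at {ι : Type} (S : Fld ι) (i : ι) : Fld Unit where
  v₁ _ := S.v₁ i
  v₂ _ := S.v₂ i
  θ _ := S.θ i
  p _ := S.p i
  r l _ := S.r l i
  f l _ := S.f l i

theorem Fld.Step.at {i : Input b} {S' : Fld (Input b)} {N : ℕ}
    (h : Fld.Step (allScale b) (fun i => i.Λ ()) (fun i => i.δ ()) (fun i => i.ε ())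
      (fun i => i.α ()) (fun i => i.β ()) b (allFld b) S' N) :
    Fld.Step i.s i.Λ i.δ i.ε i.α i.β b i.S (S'.at i) N where
  sol := ⟨funext fun _ => congrFun h.sol.mom₁ i, funext fun _ => congrFun h.sol.mom₂ i,
    funext fun _ => congrFun h.sol.heat i, funext fun _ => congrFun h.sol.div i⟩
  supp := ⟨fun _ => h.supp.v₁ i, fun _ => h.supp.v₂ i, fun _ => h.supp.θ i,
    fun _ => h.supp.p i, fun l _ => h.supp.r l i, fun l _ => h.supp.f l i⟩
  c1 := ⟨⟨fun _ => h.c1.v₁.1 i, fun j _ => h.c1.v₁.2 j i⟩,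
    ⟨fun _ => h.c1.v₂.1 i, fun j _ => h.c1.v₂.2 j i⟩,
    ⟨fun _ => h.c1.θ.1 i, fun j _ => h.c1.θ.2 j i⟩,
    ⟨fun _ => h.c1.p.1 i, fun j _ => h.c1.p.2 j i⟩,
    fun l => ⟨fun _ => (h.c1.r l).1 i, fun j _ => (h.c1.r l).2 j i⟩,
    fun l => ⟨fun _ => (h.c1.f l).1 i, fun j _ => (h.c1.f l).2 j i⟩⟩
  v₁ _ := h.v₁ i
  v₂ _ := h.v₂ i
  θ _ := h.θ i
  p _ := h.p i
  r _ := h.r i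
  f _ := h.f i
  r' _ := h.r' i
  f' _ := h.f' i

/-- The constants in the step are uniform over all data. -/
theorem exists_uniform_step : ∃ N : ℕ, ∀ (b : Bool) (s : Scale Unit) (Λ δ ε α β : Unit → ℝ)
    (S : Fld Unit), S.Ready s Λ δ ε α β b → ∃ S', Fld.Step s Λ δ ε α β b S S' N := by
  obtain ⟨η, hη⟩ := exists_probKer
  have key : ∀ b : Bool, ∃ S' : Fld (Input b), ∀ᶠ N in Filter.atTop,
      Fld.Step (allScale b) (fun i => i.Λ ()) (fun i => i.δ ()) (fun i => i.ε ())
        (fun i => i.α ()) (fun i => i.β ()) b (allFld b) S' N := fun b =>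
    let h := ready_allFld b
    step_exists hη b h.sol h.supp h.c1 h.one_le h.le_K h.δ_pos h.δ_le h.δ_K h.r h.f h.r' h.f'
  choose S' hS' using key
  obtain ⟨N, hN⟩ := (Filter.eventually_all.2 hS').exists
  exact ⟨N, fun b s Λ δ ε α β S h => ⟨(S' b).at ⟨S, s, Λ, δ, ε, α, β, h⟩,
    Fld.Step.at (i := ⟨S, s, Λ, δ, ε, α, β, h⟩) (hN b)⟩⟩

end UniformStep

section Stages

/-- The frequency parameters of the iteration. -/
def freq (m B q : ℕ) : ℕ := m ^ B ^ q

theorem freq_succ (m B q : ℕ) : freq m B (q + 1) = freq m B q ^ B := by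
  rw [freq, freq, ← pow_mul, pow_succ]

theorem pow_succ_le_freq {m B : ℕ} (hm : 1 ≤ m) (hB : 2 ≤ B) (q : ℕ) : m ^ (q + 1) ≤ freq m B q :=
  Nat.pow_le_pow_right hm ((Nat.lt_pow_self (by omega)))

theorem le_freq {m B : ℕ} (hm : 1 ≤ m) (hB : 2 ≤ B) (q : ℕ) : m ≤ freq m B q :=
  (Nat.le_self_pow q.succ_ne_zero m).trans (pow_succ_le_freq hm hB q)

theorem freq_mono {m B : ℕ} (hm : 1 ≤ m) (hB : 2 ≤ B) {q q' : ℕ} (h : q ≤ q') :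
    freq m B q ≤ freq m B q' :=
  Nat.pow_le_pow_right hm (Nat.pow_le_pow_right (by omega) h)

/-- The inductive hypotheses of the iteration. -/
structure Stage (m B q : ℕ) (S : Fld Unit) : Prop where
  sol : S.IsSol
  supp : S.All fun F => ∀ u : Pt,
    u.1 ∉ Set.Icc (1 + (1 / 2 : ℝ) ^ q) (4 - (1 / 2 : ℝ) ^ q) → (F ()).1 u = 0
  c1 : S.All fun F => C1Le F fun _ => (freq m B (q + 2) : ℝ) ^ 2
  r : AbsLe (S.r (Nat.bodd q)) fun _ => 1 / (freq m B q : ℝ) ^ 2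
  f : AbsLe (S.f (Nat.bodd q)) fun _ => 1 / (freq m B q : ℝ) ^ 2
  r' : AbsLe (S.r !(Nat.bodd q)) fun _ => 1 / (2 * (freq m B (q + 1) : ℝ) ^ 2)
  f' : AbsLe (S.f !(Nat.bodd q)) fun _ => 1 / (2 * (freq m B (q + 1) : ℝ) ^ 2)

/-- Two consecutive stages are close. -/
structure Close (a : ℝ) (S S' : Fld Unit) : Prop where
  v₁ : AbsLe (S'.v₁ - S.v₁) fun _ => a
  v₂ : AbsLe (S'.v₂ - S.v₂) fun _ => a
  θ : AbsLe (S'.θ - S.θ) fun _ => a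
  p : AbsLe (S'.p - S.p) fun _ => a

/-- The scale used at one stage. -/
def stageScale (N y : ℕ) (hy : 1 ≤ y) : Scale Unit where
  K _ := (y : ℝ) ^ 8
  μ _ := y ^ (8 * N + 4)
  one_le_K _ := one_le_pow₀ (by exact_mod_cast hy)
  one_le_μ _ := Nat.one_le_pow _ _ hy

theorem err_stageScale {N y : ℕ} (hy : 1 ≤ y) (hN : 8 * N ≤ y) (i : Unit) :
    err (stageScale N y hy) (fun _ => (y : ℝ) ^ 2) N i ≤ 1 / (4 * (y : ℝ) ^ 2) := by
  have h1 : (1 : ℝ) ≤ y := by exact_mod_cast hy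
  have h0 : (0 : ℝ) < y := by linarith
  have h2 : 8 * (N : ℝ) ≤ y := by exact_mod_cast hN
  have e : err (stageScale N y hy) (fun _ => (y : ℝ) ^ 2) N i = 2 * N / (y : ℝ) ^ 4 := by
    simp only [err, stageScale]
    push_cast
    rw [← pow_mul (y : ℝ) 8 N, pow_add]
    field_simp
    ring
  rw [e, div_le_div_iff₀ (by positivity) (by positivity)]
  have : (y : ℝ) ≤ y ^ 2 := by nlinarith
  nlinarith [mul_le_mul_of_nonneg_right (h2.trans this) (by positivity : (0 : ℝ) ≤ y ^ 2)]

theorem grow_stageScale {N y : ℕ} (hy : 1 ≤ y) (hN : 8 * N ≤ y) (i : Unit) :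
    grow (stageScale N y hy) N i ≤ ((y : ℝ) ^ (12 * N + 5)) ^ 2 := by
  have h1 : (1 : ℝ) ≤ y := by exact_mod_cast hy
  have h2 : (N : ℝ) ≤ y := by exact_mod_cast (by omega : N ≤ y)
  calc grow (stageScale N y hy) N i = N * (y : ℝ) ^ (24 * N + 8) := by
        simp only [grow, stageScale]
        push_cast
        ring
    _ ≤ y * (y : ℝ) ^ (24 * N + 8) := by gcongr
    _ = (y : ℝ) ^ (24 * N + 9) := by ring
    _ ≤ (y : ℝ) ^ (24 * N + 10) := pow_le_pow_right₀ h1 (by omega)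
    _ = _ := by ring

theorem Stage.exists_next {N : ℕ} (hN : ∀ (b : Bool) (s : Scale Unit) (Λ δ ε α β : Unit → ℝ)
    (S : Fld Unit), S.Ready s Λ δ ε α β b → ∃ S', Fld.Step s Λ δ ε α β b S S' N)
    {m q : ℕ} (hm : 8 * N + 4 ≤ m) {S : Fld Unit} (hS : Stage m (12 * N + 5) q S) :
    ∃ S', Stage m (12 * N + 5) (q + 1) S' ∧ Close (17 / freq m (12 * N + 5) q) S S' := by
  set B := 12 * N + 5 with hB
  have hm1 : 1 ≤ m := by omega
  have hB2 : 2 ≤ B := by omega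
  set y := freq m B (q + 2) with hy
  set z := freq m B q with hz
  have hmz : m ≤ z := le_freq hm1 hB2 q
  have hzy : z ≤ y := freq_mono hm1 hB2 (by omega)
  have hy1 : 1 ≤ y := by omega
  have hyN : 8 * N ≤ y := by omega
  have z1 : (1 : ℝ) ≤ z := by exact_mod_cast (by omega : 1 ≤ z)
  have y1 : (1 : ℝ) ≤ y := by exact_mod_cast hy1
  have zy : (z : ℝ) ≤ y := by exact_mod_cast hzy
  have y0 : (0 : ℝ) < y := by linarith
  have z0 : (0 : ℝ) < z := by linarith
  let s := stageScale N y hy1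
  have hready : S.Ready s (fun _ => (y : ℝ) ^ 2) (fun _ => 1 / (z : ℝ) ^ 2)
      (fun _ => 1 / (2 * (freq m B (q + 1) : ℝ) ^ 2)) (fun _ => 1 + (1 / 2 : ℝ) ^ q)
      (fun _ => 4 - (1 / 2 : ℝ) ^ q) (Nat.bodd q) :=
    { sol := hS.sol
      supp := hS.supp.imp fun F h _ u hu => h u (by simpa using hu)
      c1 := hS.c1
      one_le := fun _ => one_le_pow₀ y1
      le_K := fun _ => pow_le_pow_right₀ y1 (by norm_num)
      δ_pos := fun _ => by positivity
      δ_le := fun _ => by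
        rw [div_le_one (by positivity)]; exact one_le_pow₀ z1
      δ_K := fun _ => by
        rw [one_div_one_div]
        exact (pow_le_pow_left₀ z0.le zy 2).trans (pow_le_pow_right₀ y1 (by norm_num))
      r := hS.r
      f := hS.f
      r' := hS.r'
      f' := hS.f' }
  obtain ⟨S', h⟩ := hN _ _ _ _ _ _ _ _ hready
  have herr := err_stageScale hy1 hyN
  have hyB : (freq m B (q + 1 + 2) : ℝ) = (y : ℝ) ^ B := by
    rw [hy, ← Nat.cast_pow, ← freq_succ]
  have hx : (freq m B (q + 1) : ℝ) ≤ y := by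
    exact_mod_cast freq_mono hm1 hB2 (by omega : q + 1 ≤ q + 2)
  have hx0 : (0 : ℝ) < freq m B (q + 1) := by
    exact_mod_cast lt_of_lt_of_le (by omega : 0 < m) (le_freq hm1 hB2 _)
  have hxy : 1 / (4 * (y : ℝ) ^ 2) ≤ 1 / (2 * (freq m B (q + 1) : ℝ) ^ 2) := by
    apply one_div_le_one_div_of_le (by positivity)
    nlinarith
  have hsum : 1 / (2 * (freq m B (q + 1) : ℝ) ^ 2) + 1 / (4 * (y : ℝ) ^ 2)
      ≤ 1 / (freq m B (q + 1) : ℝ) ^ 2 := by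
    refine (add_le_add_right hxy _).trans (le_of_eq ?_)
    field_simp; norm_num
  have hy4 : 1 / (4 * (y : ℝ) ^ 2) ≤ 1 / (2 * (freq m B (q + 1 + 1) : ℝ) ^ 2) :=
    one_div_le_one_div_of_le (by positivity) (by
      change 2 * (y : ℝ) ^ 2 ≤ 4 * (y : ℝ) ^ 2; nlinarith)
  have hz4 : 1 / (4 * (y : ℝ) ^ 2) ≤ 1 / z :=
    one_div_le_one_div_of_le z0 (by nlinarith)
  have hK : 4 / s.K () ≤ (1 / 2 : ℝ) ^ (q + 1) := by
    have h2 : ((2 : ℝ) ^ (q + 1)) ≤ y := by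
      have : 2 ^ (q + 1) ≤ y := calc
        2 ^ (q + 1) ≤ m ^ (q + 1) := Nat.pow_le_pow_left (by omega) _
        _ ≤ z := pow_succ_le_freq hm1 hB2 q
        _ ≤ y := hzy
      exact_mod_cast this
    have h4 : (4 : ℝ) ≤ y := by exact_mod_cast (by omega : 4 ≤ y)
    rw [one_div, inv_pow, ← one_div, div_le_div_iff₀ (s.K_pos ()) (by positivity), one_mul]
    calc (4 : ℝ) * 2 ^ (q + 1) ≤ y * y := by gcongr
      _ = (y : ℝ) ^ 2 := by ring
      _ ≤ (y : ℝ) ^ 8 := pow_le_pow_right₀ y1 (by norm_num)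
  have hhalf : (1 / 2 : ℝ) ^ q = 2 * (1 / 2 : ℝ) ^ (q + 1) := by rw [pow_succ]; ring
  have hsq : √(1 / (z : ℝ) ^ 2) = 1 / z := by
    rw [Real.sqrt_div zero_le_one, Real.sqrt_one, Real.sqrt_sq z0.le]
  have inc : ∀ i, 16 * √(1 / (z : ℝ) ^ 2) + err s (fun _ => (y : ℝ) ^ 2) N i ≤ 17 / z := fun i => by
    rw [hsq]
    have : (17 : ℝ) / z = 16 * (1 / z) + 1 / z := by ring
    linarith [herr i]
  refine ⟨S', ⟨h.sol, ?_, ?_, ?_, ?_, ?_, ?_⟩, h.v₁.mono inc, h.v₂.mono inc, h.θ.mono inc,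
    h.p.mono fun i => ?_⟩
  · refine h.supp.imp fun F hF u hu => hF () u fun hu' => hu ?_
    rw [hhalf] at hu'
    exact ⟨by linarith [hu'.1], by linarith [hu'.2]⟩
  · rw [hyB]
    have hg := grow_stageScale hy1 hyN
    exact h.c1.imp fun F hF => ⟨hF.1.mono hg, fun j => (hF.2 j).mono hg⟩
  · rw [Nat.bodd_succ]
    exact h.r'.mono fun i => (add_le_add_right (herr i) _).trans hsum
  · rw [Nat.bodd_succ]
    exact h.f'.mono fun i => (add_le_add_right (herr i) _).trans hsum
  · rw [Nat.bodd_succ, Bool.not_not]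
    exact h.r.mono fun i => (herr i).trans hy4
  · rw [Nat.bodd_succ, Bool.not_not]
    exact h.f.mono fun i => (herr i).trans hy4
  · have : (17 : ℝ) / z = 16 * (1 / z) + 1 / z := by ring
    have : (0 : ℝ) < 1 / z := by positivity
    linarith [herr i]

end Stages

section Initial

/-- The scale of the temporal cutoff. -/
def unitScale : Scale Unit where
  K _ := 4
  μ _ := 1
  one_le_K _ := by norm_num
  one_le_μ _ := le_rfl

/-- The temporal profile of the initial stage. -/
def bump : R Unit := cut unitScale (fun _ => 2) (fun _ => 3) 0

theorem d_bump (u : Pt) (hu : u = e1 ∨ u = e2) : d u bump = 0 := by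
  rcases hu with rfl | rfl
  exacts [d_cut_one, d_cut_two]

theorem bump_eq_one (x : ℝ × ℝ) : (bump ()).1 (5 / 2, x) = 1 := by
  rw [bump, cut_coe, Real.smoothTransition.one_of_one_le, Real.smoothTransition.one_of_one_le,
    one_mul] <;> norm_num [unitScale]

theorem Sy.exists_bound {F : R Unit} (h : Sy unitScale low 0 F) :
    ∃ C, 1 ≤ C ∧ C1Le F fun _ => C := by
  have hb : ∀ {G : R Unit}, Bd unitScale 0 G → ∃ C, AbsLe G fun _ => C := fun {G} hG => by
    obtain ⟨C, N, -, h⟩ := hG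
    exact ⟨C * 4 ^ N * 1, fun i q => by simpa [unitScale] using h i q⟩
  have hj : ∀ j, ∃ C, AbsLe (Boussinesq.d (bas j) F) fun _ => C := fun j =>
    hb ((h.d_low j).bd)
  obtain ⟨C, hC⟩ := hb h.bd
  choose D hD using hj
  refine ⟨1 + |C| + ∑ j, |D j|, ?_, hC.mono fun _ => ?_, fun j => (hD j).mono fun _ => ?_⟩
  · have := Finset.sum_nonneg fun j (_ : j ∈ Finset.univ) => abs_nonneg (D j)
    have := abs_nonneg C
    linarith
  · have := Finset.sum_nonneg fun j (_ : j ∈ Finset.univ) => abs_nonneg (D j)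
    have := le_abs_self C
    linarith
  · have := Finset.single_le_sum (fun j _ => abs_nonneg (D j)) (Finset.mem_univ j)
    have := le_abs_self (D j)
    have := abs_nonneg C
    linarith

/-- The scale of the initial oscillation. -/
def initScale (n : ℕ) (hn : 1 ≤ n) : Scale Unit where
  K _ := 1
  μ _ := n
  one_le_K _ := le_rfl
  one_le_μ _ := hn

variable {n : ℕ} {hn : 1 ≤ n}

/-- The function `cos (n² y + a)`. -/
def cosY (n : ℕ) (hn : 1 ≤ n) (a : ℝ) : R Unit := osc (initScale n hn) (1, 0) 0 a

theorem cosY_coe (a : ℝ) (q : Pt) : (cosY n hn a ()).1 q = Real.cos ((n : ℝ) ^ 2 * q.2.1 + a) := by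
  rw [cosY, osc_coe]; simp [initScale]

theorem con_coe (a : ℝ) (q : Pt) : ((con a : R Unit) ()).1 q = a := rfl

theorem d_cosY (a : ℝ) (u : Pt) :
    d u (cosY n hn a) = con ((n : ℝ) ^ 2 * u.2.1) * cosY n hn (a + Real.pi / 2) := by
  rw [cosY, d_osc, map_zero, mul_zero, add_zero, mul_comm, mu, con, con, ← map_mul]
  congr 2
  funext i
  simp [initScale, mul_comm]

theorem C1Le.mul_cosY {F : R Unit} {C : ℝ} (hF : C1Le F fun _ => C) (a : ℝ) :
    C1Le (F * cosY n hn a) fun _ => 2 * C * (n : ℝ) ^ 2 := by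
  have h0 : 0 ≤ C := hF.1.nonneg ()
  have h1 : (1 : ℝ) ≤ (n : ℝ) ^ 2 := one_le_pow₀ (by exact_mod_cast hn)
  have hc : ∀ a, AbsLe (cosY n hn a) fun _ => 1 := fun a => absLe_osc _ _ _
  refine ⟨(hF.1.mul (hc a)).mono fun _ => by nlinarith, fun j => ?_⟩
  rw [d_mul, d_cosY]
  have hn2 : AbsLe (con ((n : ℝ) ^ 2 * (bas j).2.1) : R Unit) fun _ => (n : ℝ) ^ 2 := fun i q => by
    rw [con_coe]
    fin_cases j <;> simp [bas]
  refine (((hF.2 j).mul (hc a)).add (hF.1.mul (hn2.mul (hc _)))).mono fun _ => by nlinarith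

theorem AbsLe.con_inv_mul {F : R Unit} {C c : ℝ} (hF : AbsLe F fun _ => C) (hc : 0 ≤ c) :
    AbsLe (con c * F) fun _ => c * C :=
  AbsLe.mul (a := fun _ => c) (fun i q => by rw [con_coe, abs_of_nonneg hc]) hF

theorem C1Le.con_inv_mul {F : R Unit} {C c : ℝ} (hF : C1Le F fun _ => C) (hc : 0 ≤ c) :
    C1Le (con c * F) fun _ => c * C := by
  refine ⟨hF.1.con_inv_mul hc, fun j => ?_⟩
  rw [d_mul, d_con, zero_mul, zero_add]
  exact (hF.2 j).con_inv_mul hc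

/-- The initial stage. -/
def initFld (n : ℕ) (hn : 1 ≤ n) : Fld Unit :=
  let c : R Unit := con (1 / (n : ℝ) ^ 2)
  let ρ := c * ((d e0 bump - bump) * cosY n hn (-(Real.pi / 2)))
  { v₁ := 0
    v₂ := bump * cosY n hn 0
    θ := bump * cosY n hn 0
    p := ρ
    r := fun
      | false => 0
      | true => ρ
    f := fun
      | false => c * (d e0 bump * cosY n hn (-(Real.pi / 2)))
      | true => 0 }

theorem isSol_initFld : (initFld n hn).IsSol := by
  have hc : (con (1 / (n : ℝ) ^ 2) * con ((n : ℝ) ^ 2) : R Unit) = 1 := by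
    have : (n : ℝ) ≠ 0 := by exact_mod_cast (by omega : n ≠ 0)
    rw [con_mul, ← con_one]; congr 1; field_simp
  have b1 := d_bump e1 (Or.inl rfl)
  have b2 := d_bump e2 (Or.inr rfl)
  have db : ∀ u, d u bump = 0 → d u (d e0 bump) = 0 := fun u h => by rw [d_comm, h, map_zero]
  have c0 : d e0 (cosY n hn 0) = 0 := by
    rw [d_cosY, show (n : ℝ) ^ 2 * e0.2.1 = 0 by simp [e0, bas], con_zero, zero_mul]
  have c2 : ∀ a, d e2 (cosY n hn a) = 0 := fun a => by
    rw [d_cosY, show (n : ℝ) ^ 2 * e2.2.1 = 0 by simp [e2, bas], con_zero, zero_mul]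
  have c1 : d e1 (cosY n hn (-(Real.pi / 2))) = con ((n : ℝ) ^ 2) * cosY n hn 0 := by
    rw [d_cosY, neg_add_cancel, show (n : ℝ) ^ 2 * e1.2.1 = (n : ℝ) ^ 2 by simp [e1, bas]]
  constructor
  · simp [initFld, d_diag, d_mul, b1, b2, db e1 b1, db e2 b2, c2, c1]
  · simp only [initFld, d_diag, d_mul, map_sub, b1, b2, db e1 b1, db e2 b2, c2, c1, c0, d_con, map_zero]
    linear_combination -(d e0 bump - bump) * cosY n hn 0 * hc
  · simp only [initFld, d_mul, b1, b2, db e1 b1, c2, c1, c0, d_con, map_zero]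
    linear_combination -d e0 bump * cosY n hn 0 * hc
  · simp [initFld, d_mul, b2, c2]

theorem exists_initial : ∃ C : ℝ, 1 ≤ C ∧ ∀ (n : ℕ) (hn : 1 ≤ n),
    ((initFld n hn).All fun F => C1Le F fun _ => 4 * C * (n : ℝ) ^ 2) ∧
    ∀ l, AbsLe ((initFld n hn).r l) (fun _ => 2 * C / (n : ℝ) ^ 2) ∧
      AbsLe ((initFld n hn).f l) fun _ => 2 * C / (n : ℝ) ^ 2 := by
  have hs : Sy unitScale low 0 bump := sy_cut
  obtain ⟨C, hC, h⟩ := hs.exists_bound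
  obtain ⟨C', hC', h'⟩ := (hs.d_low 0).exists_bound
  set M := max C C'
  have hM : 1 ≤ M := hC.trans (le_max_left _ _)
  have hb : C1Le bump fun _ => M :=
    ⟨h.1.mono fun _ => le_max_left _ _, fun j => (h.2 j).mono fun _ => le_max_left _ _⟩
  have hb' : C1Le (d e0 bump) fun _ => M :=
    ⟨h'.1.mono fun _ => le_max_right _ _, fun j => (h'.2 j).mono fun _ => le_max_right _ _⟩
  have hbb : C1Le (d e0 bump - bump) fun _ => 2 * M := by
    refine ⟨(hb'.1.sub hb.1).mono fun _ => by linarith, fun j => ?_⟩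
    rw [map_sub]
    exact ((hb'.2 j).sub (hb.2 j)).mono fun _ => by linarith
  refine ⟨M, hM, fun n hn => ?_⟩
  have h1 : (1 : ℝ) ≤ (n : ℝ) ^ 2 := one_le_pow₀ (by exact_mod_cast hn)
  have hinv : 0 ≤ 1 / (n : ℝ) ^ 2 := by positivity
  have mono : ∀ {F : R Unit} {c : ℝ}, C1Le F (fun _ => c) → c ≤ 4 * M * (n : ℝ) ^ 2 →
      C1Le F fun _ => 4 * M * (n : ℝ) ^ 2 := fun h hc => ⟨h.1.mono fun _ => hc, fun j =>
    (h.2 j).mono fun _ => hc⟩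
  have zero : ∀ {c : ℝ}, 0 ≤ c → C1Le (0 : R Unit) fun _ => c := fun hc =>
    ⟨fun _ _ => by simpa using hc, fun j _ _ => by simpa using hc⟩
  have w := mono (hb.mul_cosY (hn := hn) 0) (by nlinarith)
  have le : ∀ {c : ℝ}, 0 ≤ c → c ≤ 4 * M * (n : ℝ) ^ 2 →
      1 / (n : ℝ) ^ 2 * c ≤ 4 * M * (n : ℝ) ^ 2 := fun h0 hc =>
    (mul_le_of_le_one_left h0 (by rw [div_le_one (by positivity)]; exact h1)).trans hc
  have hρ := mono ((hbb.mul_cosY (hn := hn) (-(Real.pi / 2))).con_inv_mul hinv)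
    (le (by positivity) (by nlinarith))
  have hf := mono ((hb'.mul_cosY (hn := hn) (-(Real.pi / 2))).con_inv_mul hinv)
    (le (by positivity) (by nlinarith))
  have hc : AbsLe (cosY n hn (-(Real.pi / 2))) fun _ => 1 := absLe_osc _ _ _
  have z : ∀ {c : ℝ}, 0 ≤ c → AbsLe (0 : R Unit) fun _ => c := fun hc => (zero hc).1
  have hpos : (0 : ℝ) ≤ 2 * M / (n : ℝ) ^ 2 := by positivity
  refine ⟨⟨zero (by positivity), w, w, hρ, ?_, ?_⟩, ?_⟩
  · rintro (_ | _)
    exacts [zero (by positivity), hρ]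
  · rintro (_ | _)
    exacts [hf, zero (by positivity)]
  · rintro (_ | _)
    · exact ⟨z hpos, ((hb'.1.mul hc).con_inv_mul hinv).mono fun _ => by
        rw [one_div_mul_eq_div]
        exact div_le_div_of_nonneg_right (by linarith) (by positivity)⟩
    · exact ⟨((hbb.1.mul hc).con_inv_mul hinv).mono fun _ => le_of_eq (by ring), z hpos⟩

theorem supp_bump : Supp unitScale (fun _ => 2) (fun _ => 3) 0 bump := supp_cut

theorem supp_initFld : (initFld n hn).All (Supp unitScale (fun _ => 2) (fun _ => 3) 0) := by
  have h := supp_bump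
  have h' := h.d e0
  have hm : ∀ {c F G : R Unit}, Supp unitScale (fun _ => 2) (fun _ => 3) 0 F →
      Supp unitScale (fun _ => 2) (fun _ => 3) 0 (c * (F * G)) := fun {c F G} hF => by
    rw [mul_comm]; exact hF.mul.mul
  have z : Supp unitScale (fun _ => 2) (fun _ => 3) 0 0 := fun _ _ _ => rfl
  have hρ : Supp unitScale (fun _ => 2) (fun _ => 3) 0 (d e0 bump - bump) := by
    rw [show d e0 bump - bump = d e0 bump + bump * -1 by ring]
    exact h'.add h.mul
  refine ⟨z, h.mul, h.mul, hm hρ, ?_, ?_⟩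
  · rintro (_ | _)
    exacts [z, hm hρ]
  · rintro (_ | _)
    exacts [hm h', z]

theorem exists_stage_zero : ∃ m₀ : ℕ, ∀ m B : ℕ, m₀ ≤ m → 2 ≤ B → ∀ hn : 1 ≤ m ^ (B + 1),
    Stage m B 0 (initFld (m ^ (B + 1)) hn) := by
  obtain ⟨C, hC, h⟩ := exists_initial
  refine ⟨⌈4 * C⌉₊, fun m B hm hB hn => ?_⟩
  obtain ⟨hc, hr⟩ := h _ hn
  have hmC : 4 * C ≤ m := (Nat.le_ceil _).trans (by exact_mod_cast hm)
  have m1 : (1 : ℝ) ≤ m := by linarith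
  have m0 : (0 : ℝ) < m := by linarith
  have B4 : 2 * B ≤ B ^ 2 := by nlinarith
  have e0 : (freq m B 0 : ℝ) = m := by simp [freq]
  have e1 : (freq m B (0 + 1) : ℝ) = (m : ℝ) ^ B := by simp [freq]
  have e2 : (freq m B (0 + 2) : ℝ) = (m : ℝ) ^ B ^ 2 := by simp [freq]
  have key : 2 * C / ((m ^ (B + 1) : ℕ) : ℝ) ^ 2 ≤ 1 / (2 * ((m : ℝ) ^ B) ^ 2) := by
    rw [div_le_div_iff₀ (by positivity) (by positivity)]
    push_cast
    calc 2 * C * (2 * ((m : ℝ) ^ B) ^ 2) = 4 * C * ((m : ℝ) ^ B) ^ 2 := by ring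
      _ ≤ m * ((m : ℝ) ^ B) ^ 2 := by gcongr
      _ ≤ m ^ 2 * ((m : ℝ) ^ B) ^ 2 := by gcongr; nlinarith
      _ = _ := by ring
  have key' : 1 / (2 * ((m : ℝ) ^ B) ^ 2) ≤ 1 / (m : ℝ) ^ 2 := by
    have : (m : ℝ) ≤ (m : ℝ) ^ B := le_self_pow₀ m1 (by omega)
    apply one_div_le_one_div_of_le (by positivity)
    nlinarith
  refine ⟨isSol_initFld, supp_initFld.imp fun F hF u hu => hF () u ?_, hc.imp fun F hF => ?_, ?_,
    ?_, ?_, ?_⟩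
  · norm_num at hu ⊢
    exact hu
  · have : 4 * C * ((m ^ (B + 1) : ℕ) : ℝ) ^ 2 ≤ ((freq m B (0 + 2) : ℕ) : ℝ) ^ 2 := by
      rw [e2]
      push_cast
      calc 4 * C * ((m : ℝ) ^ (B + 1)) ^ 2 ≤ m * ((m : ℝ) ^ (B + 1)) ^ 2 := by gcongr
        _ = (m : ℝ) ^ (2 * B + 3) := by ring
        _ ≤ (m : ℝ) ^ (2 * B ^ 2) := pow_le_pow_right₀ m1 (by nlinarith)
        _ = _ := by ring
    exact ⟨hF.1.mono fun _ => this, fun j => (hF.2 j).mono fun _ => this⟩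
  · rw [e0]; exact (hr _).1.mono fun _ => key.trans key'
  · rw [e0]; exact (hr _).2.mono fun _ => key.trans key'
  · rw [e1]; exact (hr _).1.mono fun _ => key
  · rw [e1]; exact (hr _).2.mono fun _ => key

end Initial

section Limit

open Filter Topology

theorem exists_sequence : ∃ (m B : ℕ) (S : ℕ → Fld Unit), 170 ≤ m ∧ 2 ≤ B ∧
    (∀ q, Stage m B q (S q)) ∧ (∀ q, Close (17 / freq m B q) (S q) (S (q + 1))) ∧
    ∃ n hn, S 0 = initFld n hn := by
  obtain ⟨N, hN⟩ := exists_uniform_step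
  obtain ⟨m₀, h₀⟩ := exists_stage_zero
  let m := m₀ + 8 * N + 170
  let B := 12 * N + 5
  have hn : 1 ≤ m ^ (B + 1) := Nat.one_le_pow _ _ (by omega)
  have h0 := h₀ m B (by omega) (by omega) hn
  have hnext : ∀ q (S : {S : Fld Unit // Stage m B q S}), ∃ S' : {S : Fld Unit // Stage m B (q + 1) S},
      Close (17 / freq m B q) S.1 S'.1 := fun q S => by
    obtain ⟨S', h, h'⟩ := Stage.exists_next hN (by omega : 8 * N + 4 ≤ m) S.2
    exact ⟨⟨S', h⟩, h'⟩
  choose next hclose using hnext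
  let S : (q : ℕ) → {S : Fld Unit // Stage m B q S} := fun q => Nat.rec ⟨_, h0⟩ next q
  exact ⟨m, B, fun q => (S q).1, by omega, by omega, fun q => (S q).2, fun q => hclose q (S q),
    _, hn, rfl⟩

variable {m B : ℕ} {u : ℕ → R Unit}

theorem div_freq_le (hm : 170 ≤ m) (hB : 2 ≤ B) (q : ℕ) :
    (17 : ℝ) / freq m B q ≤ 1 / 10 * (1 / 2) ^ q := by
  have h : 170 * 2 ^ q ≤ freq m B q := calc
    170 * 2 ^ q ≤ m * m ^ q := Nat.mul_le_mul hm (Nat.pow_le_pow_left (by omega) _)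
    _ = m ^ (q + 1) := by ring
    _ ≤ _ := pow_succ_le_freq (by omega) hB q
  have h' : (170 : ℝ) * 2 ^ q ≤ freq m B q := by exact_mod_cast h
  rw [one_div_pow, div_mul_div_comm, div_le_div_iff₀ (by linarith [pow_pos (zero_lt_two' ℝ) q])
    (by positivity)]
  linarith

theorem exists_limit (hm : 170 ≤ m) (hB : 2 ≤ B)
    (hd : ∀ q, AbsLe (u (q + 1) - u q) fun _ => 17 / freq m B q) :
    ∃ U : Pt → ℝ, ∀ q x, |(u q ()).1 x - U x| ≤ 1 / 5 * (1 / 2) ^ q := by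
  have h : ∀ x q, dist ((u q ()).1 x) ((u (q + 1) ()).1 x) ≤ 1 / 10 * (1 / 2) ^ q := fun x q => by
    rw [dist_comm, Real.dist_eq]
    exact (hd q () x).trans (div_freq_le hm hB q)
  have hc := fun x => cauchySeq_tendsto_of_complete
    (cauchySeq_of_le_geometric _ _ one_half_lt_one (h x))
  choose U hU using hc
  refine ⟨U, fun q x => ?_⟩
  have := dist_le_of_le_geometric_of_tendsto _ _ one_half_lt_one (h x) (hU x) q
  rw [Real.dist_eq] at this
  exact this.trans (le_of_eq (by ring))

variable {U : Pt → ℝ}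

theorem tendsto_limit (h : ∀ q x, |(u q ()).1 x - U x| ≤ 1 / 5 * (1 / 2) ^ q) :
    TendstoUniformly (fun q => (u q ()).1) U atTop := by
  have h0 : Tendsto (fun q : ℕ => (1 / 5 : ℝ) * (1 / 2) ^ q) atTop (𝓝 0) := by
    have := (tendsto_pow_atTop_nhds_zero_of_lt_one (by norm_num : (0 : ℝ) ≤ 1 / 2)
      one_half_lt_one).const_mul (1 / 5)
    rwa [mul_zero] at this
  rw [Metric.tendstoUniformly_iff]
  intro ε hε
  filter_upwards [h0.eventually_lt_const hε] with q hq x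
  rw [dist_comm, Real.dist_eq]
  exact (h q x).trans_lt hq

theorem le_mul_rpow_of_pow_le {n : ℕ} (hn : n ≠ 0) {a C e : ℝ} (hC : 0 ≤ C) (he : 0 ≤ e)
    (h : a ^ n ≤ C ^ n * e) : a ≤ C * e ^ (n : ℝ)⁻¹ := by
  refine le_of_pow_le_pow_left₀ hn (mul_nonneg hC (Real.rpow_nonneg he _)) ?_
  rwa [mul_pow, Real.rpow_inv_natCast_pow he hn]

/-- The reciprocal of the Hölder exponent. -/
def expo (B : ℕ) : ℕ := 4 * B ^ 3 + 2

theorem increment_le (hm : 170 ≤ m) (hB : 2 ≤ B)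
    (hc : ∀ q, C1Le (u q) fun _ => (freq m B (q + 2) : ℝ) ^ 2)
    (hd : ∀ q, AbsLe (u (q + 1) - u q) fun _ => 17 / freq m B q) (q : ℕ) (x y : Pt) :
    |((u (q + 1) ()).1 x - (u q ()).1 x) - ((u (q + 1) ()).1 y - (u q ()).1 y)|
      ≤ 34 * (1 / 2) ^ q * ‖x - y‖ ^ (expo B : ℝ)⁻¹ := by
  set a := |((u (q + 1) ()).1 x - (u q ()).1 x) - ((u (q + 1) ()).1 y - (u q ()).1 y)| with ha
  set Y : ℝ := (freq m B q : ℝ) with hY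
  set P := 2 * B ^ 3 with hP
  have a0 : 0 ≤ a := abs_nonneg _
  have hYq : (4 : ℝ) ^ q ≤ Y := by
    have : 4 ^ q ≤ freq m B q := calc
      4 ^ q ≤ m ^ q := Nat.pow_le_pow_left (by omega) _
      _ ≤ m ^ (q + 1) := Nat.pow_le_pow_right (by omega) (by omega)
      _ ≤ _ := pow_succ_le_freq (by omega) hB q
    rw [hY]
    exact_mod_cast this
  have Y1 : 1 ≤ Y := (one_le_pow₀ (by norm_num)).trans hYq
  have Y0 : 0 < Y := by linarith
  have h1 : a ≤ 34 / Y := by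
    have := (abs_sub _ _).trans (add_le_add (hd q () x) (hd q () y))
    exact this.trans (le_of_eq (by ring))
  have e3 : (freq m B (q + 1 + 2) : ℝ) = Y ^ B ^ 3 := by
    rw [hY, ← Nat.cast_pow, freq, freq, ← pow_mul]
    congr 2; ring
  have e2 : (freq m B (q + 2) : ℝ) ≤ Y ^ B ^ 3 := by
    rw [← e3]; exact_mod_cast freq_mono (by omega) hB (by omega)
  have h2 : a ≤ 6 * Y ^ P * ‖x - y‖ := by
    have i1 := (hc (q + 1)).abs_sub_le () x y
    have i2 := (hc q).abs_sub_le () x y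
    have e : Y ^ P = (Y ^ B ^ 3) ^ 2 := by rw [hP]; ring
    have hle : (freq m B (q + 2) : ℝ) ^ 2 ≤ Y ^ P := by
      rw [e]; gcongr
    rw [e3, ← e] at i1
    have i3 : a ≤ |(u (q + 1) ()).1 x - (u (q + 1) ()).1 y| + |(u q ()).1 x - (u q ()).1 y| := by
      rw [ha, sub_sub_sub_comm]; exact abs_sub _ _
    nlinarith [mul_le_mul_of_nonneg_right hle (norm_nonneg (x - y))]
  have hn : expo B = 2 * P + 2 := by rw [expo, hP]; ring
  refine le_mul_rpow_of_pow_le (by rw [expo]; omega) (by positivity) (norm_nonneg _) ?_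
  rw [hn]
  have hYP : (2 : ℝ) ^ (q * (2 * P + 2)) ≤ Y ^ (P + 1) := calc
    (2 : ℝ) ^ (q * (2 * P + 2)) = ((4 : ℝ) ^ q) ^ (P + 1) := by
      rw [show (4 : ℝ) = 2 ^ 2 by norm_num, ← pow_mul, ← pow_mul]; congr 1; ring
    _ ≤ _ := by gcongr
  calc a ^ (2 * P + 2) = a ^ (2 * P + 1) * a := pow_succ _ _
    _ ≤ (34 / Y) ^ (2 * P + 1) * (6 * Y ^ P * ‖x - y‖) := by gcongr
    _ ≤ (34 / Y) ^ (2 * P + 1) * (34 * Y ^ P * ‖x - y‖) := by gcongr; norm_num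
    _ = 34 ^ (2 * P + 2) * (1 / Y ^ (P + 1)) * ‖x - y‖ := by
      rw [div_pow, show 2 * P + 1 = P + (P + 1) by ring, pow_add Y, pow_succ (34 : ℝ) (2 * P + 1)]
      field_simp
      ring
    _ ≤ 34 ^ (2 * P + 2) * (1 / 2 ^ (q * (2 * P + 2))) * ‖x - y‖ := by gcongr
    _ = (34 * (1 / 2) ^ q) ^ (2 * P + 2) * ‖x - y‖ := by
      rw [mul_pow, ← pow_mul, one_div_pow]

theorem holder_limit (hm : 170 ≤ m) (hB : 2 ≤ B)
    (hc : ∀ q, C1Le (u q) fun _ => (freq m B (q + 2) : ℝ) ^ 2)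
    (hd : ∀ q, AbsLe (u (q + 1) - u q) fun _ => 17 / freq m B q)
    (hU : TendstoUniformly (fun q => (u q ()).1) U atTop) :
    ∃ C, 0 ≤ C ∧ ∀ x y, |U x - U y| ≤ C * ‖x - y‖ ^ (expo B : ℝ)⁻¹ := by
  set Λ : ℝ := (freq m B (0 + 2) : ℝ) ^ 2
  have hΛ : 0 ≤ Λ := sq_nonneg _
  have h0 : ∀ x y, |(u 0 ()).1 x - (u 0 ()).1 y| ≤ 3 * Λ * ‖x - y‖ ^ (expo B : ℝ)⁻¹ := fun x y => by
    refine le_mul_rpow_of_pow_le (by rw [expo]; omega) (by positivity) (norm_nonneg _) ?_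
    have i1 := (hc 0).abs_sub_le () x y
    have i2 := (abs_sub _ _).trans (add_le_add ((hc 0).1 () x) ((hc 0).1 () y))
    rw [expo, show 4 * B ^ 3 + 2 = (4 * B ^ 3 + 1) + 1 by ring, pow_succ, pow_succ _ (4 * B ^ 3 + 1),
      mul_assoc]
    have i3 : |(u 0 ()).1 x - (u 0 ()).1 y| ≤ 3 * Λ := i2.trans (by
      change Λ + Λ ≤ _; linarith)
    gcongr
  have hq : ∀ q x y, |(u q ()).1 x - (u q ()).1 y|
      ≤ (3 * Λ + 68 * (1 - (1 / 2) ^ q)) * ‖x - y‖ ^ (expo B : ℝ)⁻¹ := by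
    intro q x y
    induction q with
    | zero => simpa using h0 x y
    | succ q ih =>
      have h := increment_le hm hB hc hd q x y
      calc |(u (q + 1) ()).1 x - (u (q + 1) ()).1 y|
          = |((u q ()).1 x - (u q ()).1 y) + (((u (q + 1) ()).1 x - (u q ()).1 x)
            - ((u (q + 1) ()).1 y - (u q ()).1 y))| := by congr 1; ring
        _ ≤ _ := (abs_add_le _ _).trans (add_le_add ih h)
        _ = _ := by rw [pow_succ]; ring
  refine ⟨3 * Λ + 68, by positivity, fun x y => ?_⟩
  refine le_of_tendsto ((hU.tendsto_at x).sub (hU.tendsto_at y)).abs (Eventually.of_forall fun q => ?_)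
  refine (hq q x y).trans (mul_le_mul_of_nonneg_right ?_ (Real.rpow_nonneg (norm_nonneg _) _))
  have : (0 : ℝ) ≤ (1 / 2) ^ q := by positivity
  linarith

end Limit

section Weak

open Filter Topology

/-- The directional derivative on space-time. -/
def Dd (w : SpaceTime) (ψ : SpaceTime → ℝ) : SpaceTime → ℝ := fun q => fderiv ℝ ψ q w

/-- The time direction of `SpaceTime`. -/
def tdir : SpaceTime := (1, 0)

/-- The spatial directions of `SpaceTime`. -/
def sdir (i : Fin 3) : SpaceTime := (0, Pi.single i 1)

theorem tderiv_eq {ψ : SpaceTime → ℝ} (h : Differentiable ℝ ψ) : tderiv ψ = Dd tdir ψ := by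
  funext q
  exact ((h (q.1, q.2)).hasFDerivAt.comp_hasDerivAt q.1
    ((hasDerivAt_id q.1).prodMk (hasDerivAt_const q.1 q.2))).deriv

theorem sderiv_eq {ψ : SpaceTime → ℝ} (h : Differentiable ℝ ψ) (i : Fin 3) :
    sderiv i ψ = Dd (sdir i) ψ := by
  funext q
  have e : (q.1, Function.update q.2 i (q.2 i)) = q := by simp
  have := ((h (q.1, Function.update q.2 i (q.2 i))).hasFDerivAt.comp_hasDerivAt (q.2 i)
    ((hasDerivAt_const (q.2 i) q.1).prodMk (hasDerivAt_update q.2 i (q.2 i)))).deriv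
  rw [e] at this
  exact this

/-- The projection forgetting the coordinate `x`. -/
def pr : SpaceTime →L[ℝ] Pt :=
  (ContinuousLinearMap.fst ℝ ℝ (Fin 3 → ℝ)).prod
    (((ContinuousLinearMap.proj 1).comp (ContinuousLinearMap.snd ℝ ℝ (Fin 3 → ℝ))).prod
      ((ContinuousLinearMap.proj 2).comp (ContinuousLinearMap.snd ℝ ℝ (Fin 3 → ℝ))))

theorem pr_apply (q : SpaceTime) : pr q = (q.1, q.2 1, q.2 2) := rfl

/-- Functions of `(t, y, z)` as functions on space-time. -/
def up (f : Pt → ℝ) : SpaceTime → ℝ := fun q => f (pr q)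

theorem continuous_up {f : Pt → ℝ} (h : Continuous f) : Continuous (up f) := h.comp pr.continuous

theorem stPeriodic_up {f : Pt → ℝ}
    (h : ∀ (q : Pt) (m n : ℤ), f (q + (0, 2 * Real.pi * m, 2 * Real.pi * n)) = f q) :
    stPeriodic (up f) := fun t x m => by
  simpa [up, pr_apply] using h (t, x 1, x 2) (m 1) (m 2)

theorem pr_tdir : pr tdir = e0 := by simp [pr_apply, tdir, e0, bas]

theorem pr_sdir_zero : pr (sdir 0) = 0 := by simp [pr_apply, sdir]

theorem pr_sdir_one : pr (sdir 1) = e1 := by simp [pr_apply, sdir, e1, bas]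

theorem pr_sdir_two : pr (sdir 2) = e2 := by simp [pr_apply, sdir, e2, bas]

theorem dA_zero_dir (f : A) : dA 0 f = 0 := by
  apply Subtype.ext
  rw [dA_coe]
  funext q
  simp [D]

/-- Real-valued test functions supported in the time interval `[a, b]`. -/
structure TF (a b : ℝ) (ψ : SpaceTime → ℝ) : Prop where
  smooth : ContDiff ℝ (⊤ : ℕ∞) ψ
  per : stPeriodic ψ
  supp : ∀ q : SpaceTime, q.1 ∉ Set.Icc a b → ψ q = 0

variable {a b : ℝ} {ψ : SpaceTime → ℝ}

theorem TF.diff (h : TF a b ψ) : Differentiable ℝ ψ := h.smooth.differentiable (by simp)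

theorem TF.cont (h : TF a b ψ) : Continuous ψ := h.smooth.continuous

theorem TF.Dd (h : TF a b ψ) (w : SpaceTime) : TF a b (Dd w ψ) := by
  refine ⟨(h.smooth.fderiv_right (m := (⊤ : ℕ∞)) (by simp)).clm_apply contDiff_const, ?_, ?_⟩
  · intro t x m
    have e : ψ = fun q => ψ (q + (0, fun i => 2 * Real.pi * m i)) := by
      funext q
      have := (h.per q.1 q.2 m).symm
      rw [show q + ((0 : ℝ), fun i => 2 * Real.pi * (m i : ℝ))
        = (q.1, fun i => q.2 i + 2 * Real.pi * m i) by ext <;> simp]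
      exact this
    unfold Boussinesq.Dd
    conv_rhs => rw [e]
    rw [fderiv_comp_add_right]
    congr 2
    ext <;> simp
  · intro q hq
    have hev : ψ =ᶠ[𝓝 q] fun _ => 0 := by
      filter_upwards [(isClosed_Icc.isOpen_compl.preimage continuous_fst).mem_nhds hq] with x hx
        using h.supp x hx
    simp [Boussinesq.Dd, hev.fderiv_eq]

theorem TF.mul_up (h : TF a b ψ) (f : A) : TF a b (fun q => up f.1 q * ψ q) := by
  refine ⟨((adm f).smooth.comp pr.contDiff).mul h.smooth, fun t x m => ?_, fun q hq => ?_⟩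
  · rw [h.per t x m, stPeriodic_up (adm f).per t x m]
  · rw [h.supp q hq, mul_zero]

theorem Dd_mul_up (h : TF a b ψ) (f : A) (w : SpaceTime) :
    Dd w (fun q => up f.1 q * ψ q) = fun q => up (dA (pr w) f).1 q * ψ q + up f.1 q * Dd w ψ q := by
  funext q
  have hf : HasFDerivAt (up f.1) ((fderiv ℝ f.1 (pr q)).comp pr) q :=
    ((adm f).diff (pr q)).hasFDerivAt.comp q pr.hasFDerivAt
  have := (hf.mul (h.diff q).hasFDerivAt).fderiv
  unfold Dd
  change fderiv ℝ (up f.1 * ψ) q w = _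
  rw [this]
  simp [up, dA_coe, D]
  ring

/-- The closed fundamental domain. -/
abbrev box : Set (Fin 3 → ℝ) := Set.Icc 0 fun _ => 2 * Real.pi

/-- Space-time box containing the supports of all functions in `TF a b`. -/
abbrev stBox (a b : ℝ) : Set SpaceTime := Set.Icc (a / 2) (b + 1) ×ˢ box

theorem isCompact_stBox : IsCompact (stBox a b) := isCompact_Icc.prod isCompact_Icc

theorem integrableOn_stBox {G : SpaceTime → ℝ} (h : Continuous G) : IntegrableOn G (stBox a b) :=
  h.continuousOn.integrableOn_compact isCompact_stBox

/-- Continuous functions with vanishing integral. -/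
def Null (a b : ℝ) (G : SpaceTime → ℝ) : Prop := Continuous G ∧ ∫ q in stBox a b, G q = 0

theorem Null.add {F G : SpaceTime → ℝ} (hF : Null a b F) (hG : Null a b G) :
    Null a b (fun q => F q + G q) := by
  refine ⟨hF.1.add hG.1, ?_⟩
  rw [integral_add (integrableOn_stBox hF.1) (integrableOn_stBox hG.1), hF.2, hG.2, add_zero]

theorem Null.sub {F G : SpaceTime → ℝ} (hF : Null a b F) (hG : Null a b G) :
    Null a b (fun q => F q - G q) := by
  refine ⟨hF.1.sub hG.1, ?_⟩
  rw [integral_sub (integrableOn_stBox hF.1) (integrableOn_stBox hG.1), hF.2, hG.2, sub_zero]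

theorem null_Dd_tdir (ha : 0 < a) (hab : a ≤ b) (h : TF a b ψ) : Null a b (Dd tdir ψ) := by
  refine ⟨(h.Dd _).cont, ?_⟩
  have hi : IntegrableOn (Dd tdir ψ) (stBox a b) := integrableOn_stBox (h.Dd _).cont
  rw [Measure.volume_eq_prod, ← Measure.prod_restrict, integral_prod_symm]
  swap
  · rwa [Measure.prod_restrict, ← Measure.volume_eq_prod]
  have key : ∀ x : Fin 3 → ℝ, ∫ t in Set.Icc (a / 2) (b + 1), Dd tdir ψ (t, x) = 0 := by
    intro x
    rw [integral_Icc_eq_integral_Ioc, ← intervalIntegral.integral_of_le (by linarith)]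
    have hd : ∀ t : ℝ, HasDerivAt (fun t => ψ (t, x)) (Dd tdir ψ (t, x)) t := fun t =>
      (h.diff (t, x)).hasFDerivAt.comp_hasDerivAt t
        ((hasDerivAt_id t).prodMk (hasDerivAt_const t x))
    rw [intervalIntegral.integral_eq_sub_of_hasDerivAt (fun t _ => hd t)
      (((h.Dd tdir).cont.comp (by fun_prop : Continuous fun t : ℝ => (t, x))).intervalIntegrable
        _ _),
      h.supp _ (fun hm => by simp at hm; linarith), h.supp _ (fun hm => by simp at hm; linarith),
      sub_zero]
  simp [key]

theorem null_Dd_sdir (h : TF a b ψ) (i : Fin 3) : Null a b (Dd (sdir i) ψ) := by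
  refine ⟨(h.Dd _).cont, ?_⟩
  rw [Measure.volume_eq_prod, setIntegral_prod]
  swap
  · rw [← Measure.volume_eq_prod]; exact integrableOn_stBox (h.Dd _).cont
  have key : ∀ t : ℝ, ∫ x in box, Dd (sdir i) ψ (t, x) = 0 := by
    intro t
    have hd : ∀ x : Fin 3 → ℝ, HasFDerivAt (fun x => ψ (t, x))
        ((fderiv ℝ ψ (t, x)).comp (ContinuousLinearMap.inr ℝ ℝ (Fin 3 → ℝ))) x := fun x =>
      (h.diff (t, x)).hasFDerivAt.comp x (hasFDerivAt_prodMk_right t x)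
    have hc : Continuous fun x : Fin 3 → ℝ => Dd (sdir i) ψ (t, x) :=
      (h.Dd _).cont.comp (by fun_prop)
    have hs : ∀ x : Fin 3 → ℝ, ∑ j, (if j = i then
        (fderiv ℝ ψ (t, x)).comp (ContinuousLinearMap.inr ℝ ℝ (Fin 3 → ℝ)) else 0)
          (Pi.single j 1) = Dd (sdir i) ψ (t, x) := by
      intro x
      rw [Finset.sum_eq_single i (fun j _ hj => by simp [hj]) (by simp)]
      simp [Dd, sdir]
    have := integral_divergence_of_hasFDerivAt_off_countable' (n := 2) (0 : Fin 3 → ℝ)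
      (fun _ => 2 * Real.pi) (fun _ => by simp [Real.pi_pos.le])
      (fun j x => if j = i then ψ (t, x) else 0)
      (fun j x => if j = i then
        (fderiv ℝ ψ (t, x)).comp (ContinuousLinearMap.inr ℝ ℝ (Fin 3 → ℝ)) else 0) ∅
      Set.countable_empty (fun j => ?_) (fun x _ j => ?_) ?_
    · simp only [hs] at this
      rw [this]
      refine Finset.sum_eq_zero fun j _ => ?_
      by_cases hj : j = i
      · simp only [hj, if_true]
        rw [sub_eq_zero]
        refine integral_congr_ae (.of_forall fun x => ?_)
        change ψ (t, i.insertNth (2 * Real.pi) x) = ψ (t, i.insertNth (0 : ℝ) x)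
        rw [← h.per t (i.insertNth (0 : ℝ) x) (Pi.single i 1)]
        congr 2
        funext k
        change i.insertNth (α := fun _ => ℝ) (2 * Real.pi) x k
          = i.insertNth (α := fun _ => ℝ) 0 x k + 2 * Real.pi * ((Pi.single i 1 : Fin 3 → ℤ) k)
        refine Fin.succAboveCases i ?_ (fun k => ?_) k
        · simp
        · simp
      · simp [hj]
    · by_cases hj : j = i
      · simp only [hj, if_true]
        exact (h.cont.comp (by fun_prop)).continuousOn
      · simp only [hj, if_false]
        exact continuousOn_const
    · by_cases hj : j = i
      · simp only [hj, if_true]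
        exact hd x
      · simp only [hj, if_false]
        exact hasFDerivAt_const _ _
    · simp only [hs]
      exact hc.continuousOn.integrableOn_compact isCompact_Icc
  simp [key]

theorem null_prod_t (ha : 0 < a) (hab : a ≤ b) (h : TF a b ψ) (f : A) :
    Null a b (fun q => up (dA e0 f).1 q * ψ q + up f.1 q * Dd tdir ψ q) := by
  have := null_Dd_tdir ha hab (h.mul_up f)
  rwa [Dd_mul_up h, pr_tdir] at this

theorem null_prod_s (h : TF a b ψ) (f : A) (i : Fin 3) :
    Null a b (fun q => up (dA (pr (sdir i)) f).1 q * ψ q + up f.1 q * Dd (sdir i) ψ q) := by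
  have := null_Dd_sdir (h.mul_up f) i
  rwa [Dd_mul_up h] at this

theorem null_prod_x (h : TF a b ψ) (f : A) :
    Null a b (fun q => up f.1 q * Dd (sdir 0) ψ q) := by
  have := null_prod_s h f 0
  rw [pr_sdir_zero, dA_zero_dir] at this
  simpa [up] using this

theorem null_prod_y (h : TF a b ψ) (f : A) :
    Null a b (fun q => up (dA e1 f).1 q * ψ q + up f.1 q * Dd (sdir 1) ψ q) := by
  have := null_prod_s h f 1
  rwa [pr_sdir_one] at this

theorem null_prod_z (h : TF a b ψ) (f : A) :
    Null a b (fun q => up (dA e2 f).1 q * ψ q + up f.1 q * Dd (sdir 2) ψ q) := by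
  have := null_prod_s h f 2
  rwa [pr_sdir_two] at this

end Weak

section WeakLimit

open Filter Topology

variable {a b : ℝ} {φ₀ φ₁ φ₂ ψ : SpaceTime → ℝ}

/-- The integrand in the weak momentum equation for a velocity field `(0, v₁, v₂)`. -/
def momI (v₁ v₂ p θ φ₀ φ₁ φ₂ : SpaceTime → ℝ) : SpaceTime → ℝ := fun q =>
  v₁ q * Dd tdir φ₁ q + v₂ q * Dd tdir φ₂ q
    + (v₁ q * v₁ q * Dd (sdir 1) φ₁ q + v₁ q * v₂ q * Dd (sdir 2) φ₁ q
      + v₁ q * v₂ q * Dd (sdir 1) φ₂ q + v₂ q * v₂ q * Dd (sdir 2) φ₂ q)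
    + p q * (Dd (sdir 0) φ₀ q + Dd (sdir 1) φ₁ q + Dd (sdir 2) φ₂ q)
    + (v₁ q * Dd (sdir 0) (Dd (sdir 0) φ₁) q + v₂ q * Dd (sdir 0) (Dd (sdir 0) φ₂) q)
    + θ q * φ₂ q

/-- The integrand in the weak temperature equation. -/
def heatI (v₁ v₂ θ ψ : SpaceTime → ℝ) : SpaceTime → ℝ := fun q =>
  θ q * Dd tdir ψ q + (v₁ q * θ q * Dd (sdir 1) ψ q + v₂ q * θ q * Dd (sdir 2) ψ q)
    + θ q * Dd (sdir 0) (Dd (sdir 0) ψ) q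

/-- The integrand in the weak divergence equation. -/
def divI (v₁ v₂ ψ : SpaceTime → ℝ) : SpaceTime → ℝ := fun q =>
  v₁ q * Dd (sdir 1) ψ q + v₂ q * Dd (sdir 2) ψ q

theorem d_diag_apply (F : R Unit) (q : Pt) :
    (d eη F ()).1 q = (dA e1 (F ())).1 q + (dA e2 (F ())).1 q := by
  rw [d_diag]; rfl

theorem Fld.IsSol.mom_null {S : Fld Unit} (h : S.IsSol) (ha : 0 < a) (hab : a ≤ b)
    (h₀ : TF a b φ₀) (h₁ : TF a b φ₁) (h₂ : TF a b φ₂) :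
    Null a b (fun q => momI (up (S.v₁ ()).1) (up (S.v₂ ()).1) (up (S.p ()).1) (up (S.θ ()).1)
      φ₀ φ₁ φ₂ q - (up (S.r false ()).1 q * Dd (sdir 1) φ₁ q
        + up (S.r true ()).1 q * (Dd (sdir 1) φ₁ q + Dd (sdir 2) φ₁ q
          + (Dd (sdir 1) φ₂ q + Dd (sdir 2) φ₂ q)))) := by
  have n₁ := (((null_prod_t ha hab h₁ (S.v₁ ())).add (null_prod_y h₁ ((S.v₁ * S.v₁) ()))).add
    ((null_prod_z h₁ ((S.v₁ * S.v₂) ())).add (null_prod_y h₁ (S.p ())))).sub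
    ((null_prod_y h₁ (S.r false ())).add
      ((null_prod_y h₁ (S.r true ())).add (null_prod_z h₁ (S.r true ()))))
  have n₂ := (((null_prod_t ha hab h₂ (S.v₂ ())).add (null_prod_y h₂ ((S.v₁ * S.v₂) ()))).add
    ((null_prod_z h₂ ((S.v₂ * S.v₂) ())).add (null_prod_z h₂ (S.p ())))).sub
    ((null_prod_y h₂ (S.r true ())).add (null_prod_z h₂ (S.r true ())))
  have n₃ := (null_prod_x h₀ (S.p ())).add
    ((null_prod_x (h₁.Dd (sdir 0)) (S.v₁ ())).add (null_prod_x (h₂.Dd (sdir 0)) (S.v₂ ())))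
  convert (n₁.add n₂).add n₃ using 1
  funext q
  have m₁ : (d e0 S.v₁ ()).1 (pr q) + (d e1 (S.v₁ * S.v₁) ()).1 (pr q)
      + (d e2 (S.v₁ * S.v₂) ()).1 (pr q) + (d e1 S.p ()).1 (pr q)
      = (d e1 (S.r false) ()).1 (pr q) + (d eη (S.r true) ()).1 (pr q) :=
    congrFun (congrArg Subtype.val (congrFun h.mom₁ ())) (pr q)
  have m₂ : (d e0 S.v₂ ()).1 (pr q) + (d e1 (S.v₁ * S.v₂) ()).1 (pr q)
      + (d e2 (S.v₂ * S.v₂) ()).1 (pr q) + (d e2 S.p ()).1 (pr q)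
      = (S.θ ()).1 (pr q) + (d eη (S.r true) ()).1 (pr q) :=
    congrFun (congrArg Subtype.val (congrFun h.mom₂ ())) (pr q)
  rw [d_diag_apply] at m₁ m₂
  simp only [d_apply] at m₁ m₂
  have e : ∀ F G : R Unit, ((F * G) ()).1 (pr q) = (F ()).1 (pr q) * (G ()).1 (pr q) :=
    fun _ _ => rfl
  simp only [momI, up, e]
  linear_combination (-φ₁ q) * m₁ - φ₂ q * m₂

theorem Fld.IsSol.heat_null {S : Fld Unit} (h : S.IsSol) (ha : 0 < a) (hab : a ≤ b)
    (hψ : TF a b ψ) :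
    Null a b (fun q => heatI (up (S.v₁ ()).1) (up (S.v₂ ()).1) (up (S.θ ()).1) ψ q
      - (up (S.f false ()).1 q * Dd (sdir 1) ψ q
        + up (S.f true ()).1 q * (Dd (sdir 1) ψ q + Dd (sdir 2) ψ q))) := by
  have n₁ := (((null_prod_t ha hab hψ (S.θ ())).add (null_prod_y hψ ((S.v₁ * S.θ) ()))).add
    (null_prod_z hψ ((S.v₂ * S.θ) ()))).sub
    ((null_prod_y hψ (S.f false ())).add
      ((null_prod_y hψ (S.f true ())).add (null_prod_z hψ (S.f true ()))))
  convert n₁.add (null_prod_x (hψ.Dd (sdir 0)) (S.θ ())) using 1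
  funext q
  have m₁ : (d e0 S.θ ()).1 (pr q) + (d e1 (S.v₁ * S.θ) ()).1 (pr q)
      + (d e2 (S.v₂ * S.θ) ()).1 (pr q)
      = (d e1 (S.f false) ()).1 (pr q) + (d eη (S.f true) ()).1 (pr q) :=
    congrFun (congrArg Subtype.val (congrFun h.heat ())) (pr q)
  rw [d_diag_apply] at m₁
  simp only [d_apply] at m₁
  have e : ∀ F G : R Unit, ((F * G) ()).1 (pr q) = (F ()).1 (pr q) * (G ()).1 (pr q) :=
    fun _ _ => rfl
  simp only [heatI, up, e]
  linear_combination (-ψ q) * m₁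

theorem Fld.IsSol.div_null {S : Fld Unit} (h : S.IsSol) (hψ : TF a b ψ) :
    Null a b (divI (up (S.v₁ ()).1) (up (S.v₂ ()).1) ψ) := by
  convert (null_prod_y hψ (S.v₁ ())).add (null_prod_z hψ (S.v₂ ())) using 1
  funext q
  have m₁ : (d e1 S.v₁ ()).1 (pr q) + (d e2 S.v₂ ()).1 (pr q) = 0 :=
    congrFun (congrArg Subtype.val (congrFun h.div ())) (pr q)
  simp only [d_apply] at m₁
  simp only [divI, up]
  linear_combination (-ψ q) * m₁

/-- Bounded pointwise convergence to a continuous limit. -/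
structure Conv (a b : ℝ) (F : ℕ → SpaceTime → ℝ) (f : SpaceTime → ℝ) : Prop where
  bdd : ∃ C, ∀ n, ∀ q ∈ stBox a b, |F n q| ≤ C
  lim : ∀ q, Tendsto (fun n => F n q) atTop (𝓝 (f q))
  cont : Continuous f

variable {F G : ℕ → SpaceTime → ℝ} {f g : SpaceTime → ℝ}

theorem Conv.add (hF : Conv a b F f) (hG : Conv a b G g) :
    Conv a b (fun n q => F n q + G n q) (fun q => f q + g q) := by
  obtain ⟨C, hC⟩ := hF.bdd
  obtain ⟨C', hC'⟩ := hG.bdd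
  exact ⟨⟨C + C', fun n q hq => (abs_add_le _ _).trans (add_le_add (hC n q hq) (hC' n q hq))⟩,
    fun q => (hF.lim q).add (hG.lim q), hF.cont.add hG.cont⟩

theorem Conv.mul (hF : Conv a b F f) (hG : Conv a b G g) :
    Conv a b (fun n q => F n q * G n q) (fun q => f q * g q) := by
  obtain ⟨C, hC⟩ := hF.bdd
  obtain ⟨C', hC'⟩ := hG.bdd
  refine ⟨⟨C * C', fun n q hq => ?_⟩, fun q => (hF.lim q).mul (hG.lim q), hF.cont.mul hG.cont⟩
  rw [abs_mul]
  exact mul_le_mul (hC n q hq) (hC' n q hq) (abs_nonneg _) ((abs_nonneg _).trans (hC n q hq))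

theorem Conv.const (h : Continuous f) : Conv a b (fun _ q => f q) f := by
  obtain ⟨C, hC⟩ := (isCompact_stBox (a := a) (b := b)).exists_bound_of_continuousOn h.continuousOn
  exact ⟨⟨C, fun _ q hq => hC q hq⟩, fun _ => tendsto_const_nhds, h⟩

theorem Conv.sub (hF : Conv a b F f) (hG : Conv a b G g) :
    Conv a b (fun n q => F n q - G n q) (fun q => f q - g q) := by
  convert hF.add ((Conv.const (continuous_const (y := (-1 : ℝ)))).mul hG) using 1
  · funext n q; ring
  · funext q; ring

theorem Conv.null (h : Conv a b F f) (hF : ∀ n, Null a b (F n)) : Null a b f := by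
  obtain ⟨C, hC⟩ := h.bdd
  refine ⟨h.cont, tendsto_nhds_unique (tendsto_integral_of_dominated_convergence (fun _ => C)
    (fun n => (hF n).1.aestronglyMeasurable) (integrableOn_stBox continuous_const) (fun n => ?_)
    (.of_forall h.lim)) (tendsto_const_nhds.congr fun n => (hF n).2.symm)⟩
  exact (ae_restrict_iff' (isCompact_stBox.measurableSet)).2 (.of_forall (hC n))

theorem Conv.of_abs_sub_le {c : ℕ → ℝ} (hc : Tendsto c atTop (𝓝 0)) (hf : Continuous f)
    (h : ∀ n q, |F n q - f q| ≤ c n) : Conv a b F f := by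
  obtain ⟨C, hC⟩ := (isCompact_stBox (a := a) (b := b)).exists_bound_of_continuousOn hf.continuousOn
  obtain ⟨C', hC'⟩ := hc.bddAbove_range
  refine ⟨⟨C + C', fun n q hq => ?_⟩, fun q => ?_, hf⟩
  · calc |F n q| = |f q + (F n q - f q)| := by ring_nf
      _ ≤ |f q| + |F n q - f q| := abs_add_le _ _
      _ ≤ C + C' := add_le_add (hC q hq) ((h n q).trans (hC' ⟨n, rfl⟩))
  · rw [tendsto_iff_norm_sub_tendsto_zero]
    exact squeeze_zero (fun _ => norm_nonneg _) (fun n => h n q) hc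

theorem Conv.momI {v₁ v₂ p θ : ℕ → SpaceTime → ℝ} {w₁ w₂ π κ : SpaceTime → ℝ}
    (h₀ : TF a b φ₀) (h₁ : TF a b φ₁) (h₂ : TF a b φ₂) (c₁ : Conv a b v₁ w₁) (c₂ : Conv a b v₂ w₂)
    (c₃ : Conv a b p π) (c₄ : Conv a b θ κ) :
    Conv a b (fun n q => momI (v₁ n) (v₂ n) (p n) (θ n) φ₀ φ₁ φ₂ q)
      (fun q => Boussinesq.momI w₁ w₂ π κ φ₀ φ₁ φ₂ q) := by
  have k₀ : ∀ w, Conv a b (fun _ => Dd w φ₀) (Dd w φ₀) := fun w => .const (h₀.Dd w).cont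
  have k₁ : ∀ w, Conv a b (fun _ => Dd w φ₁) (Dd w φ₁) := fun w => .const (h₁.Dd w).cont
  have k₂ : ∀ w, Conv a b (fun _ => Dd w φ₂) (Dd w φ₂) := fun w => .const (h₂.Dd w).cont
  have l₁ : ∀ w w', Conv a b (fun _ => Dd w (Dd w' φ₁)) (Dd w (Dd w' φ₁)) :=
    fun w w' => .const ((h₁.Dd w').Dd w).cont
  have l₂ : ∀ w w', Conv a b (fun _ => Dd w (Dd w' φ₂)) (Dd w (Dd w' φ₂)) :=
    fun w w' => .const ((h₂.Dd w').Dd w).cont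
  exact ((((((c₁.mul (k₁ _)).add (c₂.mul (k₂ _))).add
    (((((c₁.mul c₁).mul (k₁ _)).add ((c₁.mul c₂).mul (k₁ _))).add
      ((c₁.mul c₂).mul (k₂ _))).add ((c₂.mul c₂).mul (k₂ _)))).add
    (c₃.mul (((k₀ _).add (k₁ _)).add (k₂ _)))).add
    ((c₁.mul (l₁ _ _)).add (c₂.mul (l₂ _ _)))).add (c₄.mul (.const h₂.cont)))

theorem Conv.heatI {v₁ v₂ θ : ℕ → SpaceTime → ℝ} {w₁ w₂ κ : SpaceTime → ℝ}
    (h : TF a b ψ) (c₁ : Conv a b v₁ w₁) (c₂ : Conv a b v₂ w₂) (c₃ : Conv a b θ κ) :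
    Conv a b (fun n q => heatI (v₁ n) (v₂ n) (θ n) ψ q)
      (fun q => Boussinesq.heatI w₁ w₂ κ ψ q) := by
  have k : ∀ w, Conv a b (fun _ => Dd w ψ) (Dd w ψ) := fun w => .const (h.Dd w).cont
  have l : ∀ w w', Conv a b (fun _ => Dd w (Dd w' ψ)) (Dd w (Dd w' ψ)) :=
    fun w w' => .const ((h.Dd w').Dd w).cont
  exact ((c₃.mul (k _)).add (((c₁.mul c₃).mul (k _)).add ((c₂.mul c₃).mul (k _)))).add
    (c₃.mul (l _ _))

theorem Conv.divI {v₁ v₂ : ℕ → SpaceTime → ℝ} {w₁ w₂ : SpaceTime → ℝ}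
    (h : TF a b ψ) (c₁ : Conv a b v₁ w₁) (c₂ : Conv a b v₂ w₂) :
    Conv a b (fun n q => divI (v₁ n) (v₂ n) ψ q) (fun q => Boussinesq.divI w₁ w₂ ψ q) :=
  (c₁.mul (.const (h.Dd _).cont)).add (c₂.mul (.const (h.Dd _).cont))

/-- The integral over the box computes the iterated integrals in the weak formulation. -/
theorem Null.iterated {G : SpaceTime → ℝ} (h : Null a b G) (ha : 0 < a)
    (hG : ∀ q : SpaceTime, q.1 ∉ Set.Icc a b → G q = 0) :
    ∫ t in Set.Ioi (0 : ℝ), ∫ x in Tcube, G (t, x) = 0 := by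
  have hT : Tcube =ᵐ[volume] box := Measure.univ_pi_Ioc_ae_eq_Icc
  simp only [setIntegral_congr_set hT]
  have hi : IntegrableOn G (stBox a b) := integrableOn_stBox h.1
  have h0 := h.2
  rw [Measure.volume_eq_prod, setIntegral_prod _ (by rwa [← Measure.volume_eq_prod])] at h0
  rw [setIntegral_eq_of_subset_of_forall_sdiff_eq_zero measurableSet_Ioi (s := Set.Icc (a / 2) (b + 1)),
    h0]
  · intro t ht
    exact lt_of_lt_of_le (by linarith) ht.1
  · intro t ht
    have : t ∉ Set.Icc a b := fun hm => ht.2 ⟨by linarith [hm.1], by linarith [hm.2]⟩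
    simp [fun x => hG (t, x) this]

end WeakLimit

section Final

open Filter Topology

theorem exists_TF {ψ : SpaceTime → ℝ} (h : IsTest ψ) : ∃ a b, 0 < a ∧ a ≤ b ∧ TF a b ψ := by
  obtain ⟨h1, h2, a, b, ha, h3⟩ := h
  refine ⟨a, max a b, ha, le_max_left _ _, h1, h2, fun q hq => h3 q.1 q.2 fun hm => hq ?_⟩
  exact ⟨hm.1, hm.2.trans (le_max_right _ _)⟩

theorem exists_TF_components {φ : SpaceTime → Fin 3 → ℝ} (h : IsTest φ) :
    ∃ a b, 0 < a ∧ a ≤ b ∧ ∀ i, TF a b fun q => φ q i := by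
  obtain ⟨h1, h2, a, b, ha, h3⟩ := h
  refine ⟨a, max a b, ha, le_max_left _ _, fun i => ⟨contDiff_pi.1 h1 i, fun t x m => ?_,
    fun q hq => ?_⟩⟩
  · exact congrFun (h2 t x m) i
  · exact congrFun (h3 q.1 q.2 fun hm => hq ⟨hm.1, hm.2.trans (le_max_right _ _)⟩) i

theorem isWeakSolutionX_of_null {v₁ v₂ p θ : SpaceTime → ℝ}
    (hm : ∀ a b φ₀ φ₁ φ₂, 0 < a → a ≤ b → TF a b φ₀ → TF a b φ₁ → TF a b φ₂ →
      Null a b (momI v₁ v₂ p θ φ₀ φ₁ φ₂))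
    (hh : ∀ a b ψ, 0 < a → a ≤ b → TF a b ψ → Null a b (heatI v₁ v₂ θ ψ))
    (hd : ∀ a b ψ, 0 < a → a ≤ b → TF a b ψ → Null a b (divI v₁ v₂ ψ)) :
    IsWeakSolutionX (fun q => ![0, v₁ q, v₂ q]) p θ := by
  refine ⟨fun φ hφ => ?_, fun ψ hψ => ?_, fun ψ hψ => ?_⟩
  · obtain ⟨a, b, ha, hab, h⟩ := exists_TF_components hφ
    refine Eq.trans ?_ ((hm a b _ _ _ ha hab (h 0) (h 1) (h 2)).iterated ha fun q hq => ?_)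
    · refine integral_congr_ae (.of_forall fun t => integral_congr_ae (.of_forall fun x => ?_))
      simp only [Fin.sum_univ_three, Matrix.cons_val_zero, Matrix.cons_val_one, Matrix.cons_val,
        tderiv_eq (h _).diff, sderiv_eq (h _).diff, sderiv_eq ((h _).Dd _).diff, momI]
      ring
    · simp [momI, ((h _).Dd _).supp q hq, (((h _).Dd _).Dd _).supp q hq, (h 2).supp q hq]
  · obtain ⟨a, b, ha, hab, h⟩ := exists_TF hψ
    refine Eq.trans ?_ ((hh a b _ ha hab h).iterated ha fun q hq => ?_)
    · refine integral_congr_ae (.of_forall fun t => integral_congr_ae (.of_forall fun x => ?_))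
      simp only [Fin.sum_univ_three, Matrix.cons_val_zero, Matrix.cons_val_one, Matrix.cons_val,
        tderiv_eq h.diff, sderiv_eq h.diff, sderiv_eq (h.Dd _).diff, heatI]
      ring
    · simp [heatI, (h.Dd _).supp q hq, ((h.Dd _).Dd _).supp q hq]
  · obtain ⟨a, b, ha, hab, h⟩ := exists_TF hψ
    refine Eq.trans ?_ ((hd a b _ ha hab h).iterated ha fun q hq => ?_)
    · refine integral_congr_ae (.of_forall fun t => integral_congr_ae (.of_forall fun x => ?_))
      simp only [Fin.sum_univ_three, Matrix.cons_val_zero, Matrix.cons_val_one, Matrix.cons_val,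
        sderiv_eq h.diff, divI]
      ring
    · simp [divI, (h.Dd _).supp q hq]

theorem tendsto_geometric (c : ℝ) : Tendsto (fun q : ℕ => c * (1 / 2) ^ q) atTop (𝓝 0) := by
  have := (tendsto_pow_atTop_nhds_zero_of_lt_one (by norm_num : (0 : ℝ) ≤ 1 / 2)
    one_half_lt_one).const_mul c
  rwa [mul_zero] at this

variable {m B q : ℕ} {S : Fld Unit}

theorem one_div_sq_freq_le (hm : 170 ≤ m) (hB : 2 ≤ B) :
    1 / (freq m B q : ℝ) ^ 2 ≤ 1 * (1 / 2) ^ q := by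
  have h1 : (1 : ℝ) ≤ freq m B q := by
    exact_mod_cast (show 1 ≤ m by omega).trans (le_freq (by omega) hB q)
  have h2 := div_freq_le hm hB q
  have h3 : (0 : ℝ) < (1 / 2) ^ q := by positivity
  calc 1 / (freq m B q : ℝ) ^ 2 ≤ 17 / freq m B q := by
        rw [div_le_div_iff₀ (by positivity) (by positivity)]
        nlinarith
    _ ≤ _ := by linarith

theorem one_div_two_mul_sq_freq_le (hm : 170 ≤ m) (hB : 2 ≤ B) :
    1 / (2 * (freq m B (q + 1) : ℝ) ^ 2) ≤ 1 * (1 / 2) ^ q := by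
  have h1 : (1 : ℝ) ≤ freq m B (q + 1) := by
    exact_mod_cast (show 1 ≤ m by omega).trans (le_freq (by omega) hB (q + 1))
  have h2 := one_div_sq_freq_le (q := q + 1) hm hB
  have h3 : (0 : ℝ) < (1 / 2) ^ q := by positivity
  have h4 : 1 / (2 * (freq m B (q + 1) : ℝ) ^ 2) ≤ 1 / (freq m B (q + 1) : ℝ) ^ 2 :=
    one_div_le_one_div_of_le (by positivity) (by nlinarith)
  rw [pow_succ (1 / 2 : ℝ)] at h2
  linarith

theorem Stage.errors (h : Stage m B q S) (hm : 170 ≤ m) (hB : 2 ≤ B) (b : Bool) :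
    (AbsLe (S.r b) fun _ => 1 * (1 / 2) ^ q) ∧ AbsLe (S.f b) fun _ => 1 * (1 / 2) ^ q := by
  rcases Bool.eq_or_eq_not b (Nat.bodd q) with rfl | rfl
  · exact ⟨fun i x => (h.r i x).trans (one_div_sq_freq_le hm hB),
      fun i x => (h.f i x).trans (one_div_sq_freq_le hm hB)⟩
  · exact ⟨fun i x => (h.r' i x).trans (one_div_two_mul_sq_freq_le hm hB),
      fun i x => (h.f' i x).trans (one_div_two_mul_sq_freq_le hm hB)⟩

theorem limit_periodic {u : ℕ → R Unit} {U : Pt → ℝ}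
    (h : TendstoUniformly (fun q => (u q ()).1) U atTop) (x : Pt) (k l : ℤ) :
    U (x + (0, 2 * Real.pi * k, 2 * Real.pi * l)) = U x :=
  tendsto_nhds_unique ((h.tendsto_at _).congr fun n => (adm (u n ())).per x k l) (h.tendsto_at x)

theorem limit_supp {u : ℕ → R Unit} {U : Pt → ℝ}
    (h : TendstoUniformly (fun q => (u q ()).1) U atTop)
    (hs : ∀ q, ∀ x : Pt, x.1 ∉ Set.Icc (1 + (1 / 2 : ℝ) ^ q) (4 - (1 / 2 : ℝ) ^ q) →
      (u q ()).1 x = 0) (x : Pt) (hx : x.1 ∉ Set.Icc (1 : ℝ) 4) : U x = 0 := by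
  refine tendsto_nhds_unique ((h.tendsto_at x).congr fun n => hs n x fun hm => hx ?_)
    tendsto_const_nhds
  have h3 : (0 : ℝ) < (1 / 2) ^ n := by positivity
  exact ⟨by linarith [hm.1], by linarith [hm.2]⟩

theorem norm_pr_sub_le (q q' : SpaceTime) : ‖pr q - pr q'‖ ≤ dist q q' := by
  rw [← map_sub, dist_eq_norm, pr_apply]
  exact norm_prod_le_iff.2 ⟨norm_fst_le (q - q'), norm_prod_le_iff.2
    ⟨(norm_le_pi_norm (q - q').2 1).trans (norm_snd_le (q - q')), (norm_le_pi_norm (q - q').2 2).trans (norm_snd_le (q - q'))⟩⟩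

theorem up_holder {U : Pt → ℝ} {C α : ℝ} (hα : 0 ≤ α) (hC : 0 ≤ C)
    (h : ∀ x y, |U x - U y| ≤ C * ‖x - y‖ ^ α) (q q' : SpaceTime) :
    |up U q - up U q'| ≤ C * dist q q' ^ α :=
  (h _ _).trans (mul_le_mul_of_nonneg_left
    (Real.rpow_le_rpow (norm_nonneg _) (norm_pr_sub_le q q') hα) hC)

end Final

/-- The limit of one component of the iteration. -/
structure Lim (m B : ℕ) (u : ℕ → R Unit) (U : Pt → ℝ) : Prop where
  close : ∀ q x, |(u q ()).1 x - U x| ≤ 1 / 5 * (1 / 2) ^ q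
  cont : Continuous U
  per : ∀ (x : Pt) (k l : ℤ), U (x + (0, 2 * Real.pi * k, 2 * Real.pi * l)) = U x
  supp : ∀ x : Pt, x.1 ∉ Set.Icc (1 : ℝ) 4 → U x = 0
  holder : ∃ C, 0 ≤ C ∧ ∀ x y, |U x - U y| ≤ C * ‖x - y‖ ^ (expo B : ℝ)⁻¹

theorem exists_lim {m B : ℕ} {u : ℕ → R Unit} (hm : 170 ≤ m) (hB : 2 ≤ B)
    (hc : ∀ q, C1Le (u q) fun _ => (freq m B (q + 2) : ℝ) ^ 2)
    (hd : ∀ q, AbsLe (u (q + 1) - u q) fun _ => 17 / freq m B q)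
    (hs : ∀ q, ∀ x : Pt, x.1 ∉ Set.Icc (1 + (1 / 2 : ℝ) ^ q) (4 - (1 / 2 : ℝ) ^ q) →
      (u q ()).1 x = 0) : ∃ U, Lim m B u U := by
  obtain ⟨U, hU⟩ := exists_limit hm hB hd
  have ht := tendsto_limit hU
  exact ⟨U, hU, ht.continuous (.of_forall fun n => (adm _).cont), limit_periodic ht,
    limit_supp ht hs, holder_limit hm hB hc hd ht⟩

theorem Lim.conv {m B : ℕ} {u : ℕ → R Unit} {U : Pt → ℝ} (h : Lim m B u U) (a b : ℝ) :
    Conv a b (fun n => up (u n ()).1) (up U) :=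
  .of_abs_sub_le (tendsto_geometric _) (continuous_up h.cont) fun n q => h.close n (pr q)

theorem Lim.ne_zero {m B : ℕ} {u : ℕ → R Unit} {U : Pt → ℝ} (h : Lim m B u U)
    (h0 : (u 0 ()).1 (5 / 2, 0) = 1) : up U (5 / 2, 0) ≠ 0 := fun e => by
  have := h.close 0 (5 / 2, 0)
  have e' : U (5 / 2, 0) = 0 := e
  rw [h0, e'] at this
  norm_num at this

theorem initFld_value (n : ℕ) (hn : 1 ≤ n) :
    ((initFld n hn).v₂ ()).1 (5 / 2, 0) = 1 ∧ ((initFld n hn).θ ()).1 (5 / 2, 0) = 1 := by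
  have : ((bump * cosY n hn 0) ()).1 (5 / 2, 0) = 1 := by
    change (bump ()).1 (5 / 2, 0) * (cosY n hn 0 ()).1 (5 / 2, 0) = 1
    rw [bump_eq_one, cosY_coe]
    simp
  exact ⟨this, this⟩

theorem exists_solution : ∃ (m B : ℕ) (S : ℕ → Fld Unit) (V₁ V₂ Θ P : Pt → ℝ),
    2 ≤ B ∧ Lim m B (fun q => (S q).v₁) V₁ ∧ Lim m B (fun q => (S q).v₂) V₂ ∧
    Lim m B (fun q => (S q).θ) Θ ∧ Lim m B (fun q => (S q).p) P ∧
    up V₂ (5 / 2, 0) ≠ 0 ∧ up Θ (5 / 2, 0) ≠ 0 ∧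
    IsWeakSolutionX (fun q => ![0, up V₁ q, up V₂ q]) (up P) (up Θ) := by
  obtain ⟨m, B, S, hm, hB, hS, hcl, n, hn, h0⟩ := exists_sequence
  obtain ⟨V₁, l₁⟩ := exists_lim hm hB (fun q => (hS q).c1.v₁) (fun q => (hcl q).v₁)
    (fun q => (hS q).supp.v₁)
  obtain ⟨V₂, l₂⟩ := exists_lim hm hB (fun q => (hS q).c1.v₂) (fun q => (hcl q).v₂)
    (fun q => (hS q).supp.v₂)
  obtain ⟨Θ, l₃⟩ := exists_lim hm hB (fun q => (hS q).c1.θ) (fun q => (hcl q).θ)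
    (fun q => (hS q).supp.θ)
  obtain ⟨P, l₄⟩ := exists_lim hm hB (fun q => (hS q).c1.p) (fun q => (hcl q).p)
    (fun q => (hS q).supp.p)
  refine ⟨m, B, S, V₁, V₂, Θ, P, hB, l₁, l₂, l₃, l₄, l₂.ne_zero ?_, l₃.ne_zero ?_,
    isWeakSolutionX_of_null ?_ ?_ ?_⟩
  · simp only [h0]; exact (initFld_value n hn).1
  · simp only [h0]; exact (initFld_value n hn).2
  · intro a b φ₀ φ₁ φ₂ ha hab t₀ t₁ t₂
    have cr : ∀ c, Conv a b (fun q => up ((S q).r c ()).1) 0 := fun c =>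
      .of_abs_sub_le (tendsto_geometric 1) continuous_zero fun q x => by
        simpa [up] using ((hS q).errors hm hB c).1 () (pr x)
    have k : ∀ {φ : SpaceTime → ℝ}, TF a b φ → ∀ w, Conv a b (fun _ => Dd w φ) (Dd w φ) :=
      fun t w => .const (t.Dd w).cont
    have := ((Conv.momI t₀ t₁ t₂ (l₁.conv a b) (l₂.conv a b) (l₄.conv a b) (l₃.conv a b)).sub
      (((cr false).mul (k t₁ (sdir 1))).add ((cr true).mul
        (((k t₁ (sdir 1)).add (k t₁ (sdir 2))).add ((k t₂ (sdir 1)).add (k t₂ (sdir 2))))))).null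
      fun q => (hS q).sol.mom_null ha hab t₀ t₁ t₂
    simpa using this
  · intro a b ψ ha hab t
    have cf : ∀ c, Conv a b (fun q => up ((S q).f c ()).1) 0 := fun c =>
      .of_abs_sub_le (tendsto_geometric 1) continuous_zero fun q x => by
        simpa [up] using ((hS q).errors hm hB c).2 () (pr x)
    have k : ∀ w, Conv a b (fun _ => Dd w ψ) (Dd w ψ) := fun w => .const (t.Dd w).cont
    have := ((Conv.heatI t (l₁.conv a b) (l₂.conv a b) (l₃.conv a b)).sub
      (((cf false).mul (k (sdir 1))).add ((cf true).mul
        ((k (sdir 1)).add (k (sdir 2)))))).null fun q => (hS q).sol.heat_null ha hab t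
    simpa using this
  · intro a b ψ ha hab t
    exact (Conv.divI t (l₁.conv a b) (l₂.conv a b)).null fun q => (hS q).sol.div_null t

end Boussinesq

/-- there exist α ∈ (0,1) and a continuous triple (v,p,θ) on ℝ₊ × T³,
compactly supported in time, with v, θ not identically zero, solving the anisotropic
Boussinesq system with x-direction viscosity weakly, and with v, θ ∈ C^α. -/
theorem boussinesq_horizontal_viscosity_existence :
    ∃ α : ℝ, 0 < α ∧ α < 1 ∧
    ∃ (v : SpaceTime → Fin 3 → ℝ) (p θ : SpaceTime → ℝ),
      Continuous v ∧ Continuous p ∧ Continuous θ ∧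
      stPeriodic v ∧ stPeriodic p ∧ stPeriodic θ ∧
      (∃ a b : ℝ, 0 < a ∧ a < b ∧ ∀ t x, t ∉ Set.Icc a b →
        v (t, x) = 0 ∧ p (t, x) = 0 ∧ θ (t, x) = 0) ∧
      v ≠ 0 ∧ θ ≠ 0 ∧
      IsWeakSolutionX v p θ ∧
      (∃ C : ℝ, ∀ q q' : SpaceTime, ‖v q - v q'‖ ≤ C * dist q q' ^ α) ∧
      (∃ C : ℝ, ∀ q q' : SpaceTime, |θ q - θ q'| ≤ C * dist q q' ^ α) := by
  obtain ⟨m, B, S, V₁, V₂, Θ, P, hB, l₁, l₂, l₃, l₄, h₂, h₃, hw⟩ := Boussinesq.exists_solution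
  have hα : (1 : ℝ) < Boussinesq.expo B := by
    have : 1 < Boussinesq.expo B := by rw [Boussinesq.expo]; omega
    exact_mod_cast this
  have hα0 : (0 : ℝ) < (Boussinesq.expo B : ℝ)⁻¹ := by positivity
  refine ⟨(Boussinesq.expo B : ℝ)⁻¹, hα0, inv_lt_one_of_one_lt₀ hα,
    fun q => ![0, Boussinesq.up V₁ q, Boussinesq.up V₂ q], Boussinesq.up P, Boussinesq.up Θ,
    ?_, Boussinesq.continuous_up l₄.cont, Boussinesq.continuous_up l₃.cont, fun t x k => ?_,
    Boussinesq.stPeriodic_up l₄.per, Boussinesq.stPeriodic_up l₃.per,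
    ⟨1, 4, one_pos, by norm_num, fun t x ht => ⟨?_, l₄.supp _ ht, l₃.supp _ ht⟩⟩,
    fun h => h₂ (congrFun (congrFun h (5 / 2, 0)) 2), fun h => h₃ (congrFun h (5 / 2, 0)), hw,
    ?_, ?_⟩
  · refine continuous_pi fun i => ?_
    fin_cases i
    · exact continuous_const
    · exact Boussinesq.continuous_up l₁.cont
    · exact Boussinesq.continuous_up l₂.cont
  · simp only []
    rw [Boussinesq.stPeriodic_up l₁.per t x k, Boussinesq.stPeriodic_up l₂.per t x k]
  · have e₁ : Boussinesq.up V₁ (t, x) = 0 := l₁.supp _ ht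
    have e₂ : Boussinesq.up V₂ (t, x) = 0 := l₂.supp _ ht
    funext i
    fin_cases i <;> simp [e₁, e₂]
  · obtain ⟨C₁, hC₁, k₁⟩ := l₁.holder
    obtain ⟨C₂, hC₂, k₂⟩ := l₂.holder
    refine ⟨C₁ + C₂, fun q q' => ?_⟩
    have hp : 0 ≤ dist q q' ^ (Boussinesq.expo B : ℝ)⁻¹ := Real.rpow_nonneg dist_nonneg _
    have b₁ := Boussinesq.up_holder hα0.le hC₁ k₁ q q'
    have b₂ := Boussinesq.up_holder hα0.le hC₂ k₂ q q'
    refine (pi_norm_le_iff_of_nonneg (by positivity)).2 fun i => ?_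
    rw [add_mul]
    fin_cases i
    · simp only [Pi.sub_apply, Real.norm_eq_abs]
      simp
      positivity
    · exact b₁.trans (le_add_of_nonneg_right (by positivity))
    · exact b₂.trans (le_add_of_nonneg_left (by positivity))
  · obtain ⟨C, hC, k⟩ := l₃.holder
    exact ⟨C, Boussinesq.up_holder hα0.le hC k⟩
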